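/- arXiv:1305.4112 — 2 statements merged into one kernel-verified Lean document; each statement's English description precedes it below -/
import Mathlib

section
/- For every c ∈ (0,1] there exists α_*(c) ∈ (0,1) with the following properties: λ̲(α,c) ≥ 8π for every α ∈ (0, α_*(c)], and for every α ∈ (0, α_*(c)], every simple domain Ω ⊂ ℝ² that is (α,c)-sandwiched, and every λ ∈ (0, λ̲(α,c)], the problem P(λ,Ω) admits a solution. -/
open MeasureTheory Real Set Filter

noncomputable section

/-- The Euclidean plane ℝ². -/
abbrev R2 : Type := EuclideanSpace ℝ (Fin 2)

/-- The Laplacian of `u : R2 → ℝ`: the sum of the second derivatives of `u`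
along the two coordinate axes. -/
def lap (u : R2 → ℝ) (p : R2) : ℝ :=
  ∑ i : Fin 2, iteratedDeriv 2 (fun t : ℝ => u (p + t • EuclideanSpace.single i (1 : ℝ))) 0

/-- `u` is a solution of the mean field problem `P(λ, Ω)`:
`u ∈ C²(Ω) ∩ C⁰(cl Ω)`, `u = 0` on `∂Ω` and `-Δu = λ eᵘ / ∫_Ω eᵘ` in `Ω`. -/
def IsSolP (Ω : Set R2) (lam : ℝ) (u : R2 → ℝ) : Prop :=
  ContDiffOn ℝ 2 u Ω ∧ ContinuousOn u (closure Ω) ∧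
    (∀ p ∈ frontier Ω, u p = 0) ∧
    ∀ p ∈ Ω, -lap u p = lam * Real.exp (u p) / ∫ q in Ω, Real.exp (u q)

/-- A simple domain: a bounded open simply connected set whose boundary is the support of a
simple rectifiable (i.e. of bounded variation) Jordan curve. -/
def IsSimpleDomain (Ω : Set R2) : Prop :=
  IsOpen Ω ∧ Bornology.IsBounded Ω ∧ SimplyConnectedSpace Ω ∧
    ∃ γ : ℝ → R2, ContinuousOn γ (Icc 0 1) ∧ γ 0 = γ 1 ∧ InjOn γ (Ico 0 1) ∧
      γ '' Icc 0 1 = frontier Ω ∧ BoundedVariationOn γ (Icc 0 1)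

/-- The closed ellipse `E_α(β) = {α²x² + y² ≤ β²}`. -/
def EllipseSet (α β : ℝ) : Set R2 := {p | α ^ 2 * p 0 ^ 2 + p 1 ^ 2 ≤ β ^ 2}

/-- `Ω` is `(α,c)`-sandwiched: `E_α(β₋) ⊆ Ω ⊆ E_α(β₊)` with `c = β₋²/β₊²`. -/
def Sandwiched (α c : ℝ) (Ω : Set R2) : Prop :=
  ∃ βm βp : ℝ, 0 < βm ∧ βm ≤ βp ∧ c = βm ^ 2 / βp ^ 2 ∧
    EllipseSet α βm ⊆ Ω ∧ Ω ⊆ EllipseSet α βp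

/-- `γ̲²(α,c)`. -/
def gammaLowSq (α c : ℝ) : ℝ :=
  (1 + α ^ 2) * (c - 4 + c * α ^ 2 + 4 * Real.sqrt (1 - c * α ^ 2)) /
    (8 * (1 - α ^ 2) - c * (1 + α ^ 2) ^ 2)

/-- `λ̲(α,c) = (π c (1+α²)²/(2α)) (1 + γ̲²(α,c))`. -/
def lamLow (α c : ℝ) : ℝ :=
  π * c * (1 + α ^ 2) ^ 2 / (2 * α) * (1 + gammaLowSq α c)

namespace MeanField

open Metric Topology
open scoped ComplexConjugate BoundedContinuousFunction

/-! ### The Riemann mapping theorem for bounded domains -/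

/-- The disc automorphism `w ↦ (w - ζ) / (1 - conj ζ * w)`. -/
def moebius (ζ w : ℂ) : ℂ := (w - ζ) / (1 - conj ζ * w)

lemma one_sub_conj_mul_ne_zero {ζ w : ℂ} (hζ : ‖ζ‖ < 1) (hw : ‖w‖ < 1) :
    1 - conj ζ * w ≠ 0 := by
  intro h
  have h1 : ‖conj ζ * w‖ = 1 := by rw [← sub_eq_zero.1 h]; simp
  rw [norm_mul, RCLike.norm_conj] at h1
  nlinarith [norm_nonneg ζ, norm_nonneg w]

lemma norm_sq_one_sub_conj_mul (ζ w : ℂ) :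
    ‖1 - conj ζ * w‖ ^ 2 - ‖w - ζ‖ ^ 2 = (1 - ‖ζ‖ ^ 2) * (1 - ‖w‖ ^ 2) := by
  simp only [← Complex.normSq_eq_norm_sq, Complex.normSq_apply]
  simp
  ring

lemma norm_moebius_lt_one {ζ w : ℂ} (hζ : ‖ζ‖ < 1) (hw : ‖w‖ < 1) : ‖moebius ζ w‖ < 1 := by
  have h0 := norm_pos_iff.2 (one_sub_conj_mul_ne_zero hζ hw)
  rw [moebius, norm_div, div_lt_one h0]
  have := norm_sq_one_sub_conj_mul ζ w
  have h2 : 0 < (1 - ‖ζ‖ ^ 2) * (1 - ‖w‖ ^ 2) := by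
    apply mul_pos <;> nlinarith [norm_nonneg ζ, norm_nonneg w]
  nlinarith [norm_nonneg (w - ζ)]

lemma moebius_inj {ζ w w' : ℂ} (hζ : ‖ζ‖ < 1) (hw : ‖w‖ < 1) (hw' : ‖w'‖ < 1)
    (h : moebius ζ w = moebius ζ w') : w = w' := by
  have h1 := one_sub_conj_mul_ne_zero hζ hw
  have h2 := one_sub_conj_mul_ne_zero hζ hw'
  rw [moebius, moebius, div_eq_div_iff h1 h2] at h
  have h3 : (w - w') * (1 - conj ζ * ζ) = 0 := by linear_combination h
  rcases mul_eq_zero.1 h3 with h4 | h4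
  · exact sub_eq_zero.1 h4
  · exact absurd h4 (one_sub_conj_mul_ne_zero hζ hζ)

lemma hasDerivAt_moebius {ζ w : ℂ} (hζ : ‖ζ‖ < 1) (hw : ‖w‖ < 1) :
    HasDerivAt (moebius ζ) ((1 - conj ζ * ζ) / (1 - conj ζ * w) ^ 2) w := by
  have h1 := one_sub_conj_mul_ne_zero hζ hw
  have h2 : HasDerivAt (fun w => w - ζ) 1 w := (hasDerivAt_id w).sub_const ζ
  have h3 : HasDerivAt (fun w => 1 - conj ζ * w) (-(conj ζ)) w := by
    simpa using ((hasDerivAt_id w).const_mul (conj ζ)).const_sub 1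
  convert! h2.div h3 h1 using 1
  ring

lemma moebius_self (ζ : ℂ) : moebius ζ ζ = 0 := by simp [moebius]

lemma moebius_zero_right (ζ : ℂ) : moebius ζ 0 = -ζ := by simp [moebius]

lemma moebius_neg_moebius {ζ w : ℂ} (hζ : ‖ζ‖ < 1) (hw : ‖w‖ < 1) :
    moebius (-ζ) (moebius ζ w) = w := by
  have h1 := one_sub_conj_mul_ne_zero hζ hw
  have h2 := one_sub_conj_mul_ne_zero hζ hζ
  have h3 : 1 - conj (-ζ) * moebius ζ w = (1 - conj ζ * ζ) / (1 - conj ζ * w) := by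
    rw [moebius, map_neg]; field_simp; ring
  have h4 : moebius ζ w - -ζ = w * (1 - conj ζ * ζ) / (1 - conj ζ * w) := by
    rw [moebius, eq_div_iff h1, sub_neg_eq_add, add_mul, div_mul_cancel₀ _ h1]; ring
  rw [moebius, h3, h4, div_div_div_cancel_right₀ h1, mul_div_cancel_right₀ _ h2]

/-- **Hurwitz's theorem**: a zero of a locally uniform limit of nonvanishing holomorphic functions
is not isolated. -/
lemma eventually_eq_zero_of_tendstoLocallyUniformlyOn {ι : Type*} {l : Filter ι} [l.NeBot]
    {F : ι → ℂ → ℂ} {g : ℂ → ℂ} {U V : Set ℂ} {c : ℂ} (hU : IsOpen U) (hc : c ∈ U)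
    (hF : TendstoLocallyUniformlyOn F g l U) (hd : ∀ n, DifferentiableOn ℂ (F n) U)
    (hV : V ∈ 𝓝 c) (hne : ∀ n, ∀ z ∈ V, F n z ≠ 0) (hgc : g c = 0) :
    ∀ᶠ z in 𝓝 c, g z = 0 := by
  have hg : DifferentiableOn ℂ g U := hF.differentiableOn (Eventually.of_forall hd) hU
  refine ((hg.analyticAt (hU.mem_nhds hc)).eventually_eq_zero_or_eventually_ne_zero).resolve_right
    fun h => ?_
  have h1 : ∀ᶠ z in 𝓝 c, z ∈ U ∧ z ∈ V ∧ (z ∈ ({c}ᶜ : Set ℂ) → g z ≠ 0) := by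
    filter_upwards [hU.mem_nhds hc, hV, eventually_nhdsWithin_iff.1 h] with z h1 h2 h3
    exact ⟨h1, h2, h3⟩
  obtain ⟨r, hr, hrs⟩ := nhds_basis_closedBall.eventually_iff.1 h1
  have hBU : closedBall c r ⊆ U := fun z hz => (hrs hz).1
  have hsB : sphere c r ⊆ closedBall c r := sphere_subset_closedBall
  have hne' : (sphere c r).Nonempty := NormedSpace.sphere_nonempty.2 hr.le
  obtain ⟨z₀, hz₀, hmin⟩ := (isCompact_sphere c r).exists_isMinOn hne'
    ((hg.continuousOn.mono (hsB.trans hBU)).norm)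
  have hm : 0 < ‖g z₀‖ := norm_pos_iff.2 <| (hrs (hsB hz₀)).2.2 <| by
    rintro rfl
    simp [hr.ne] at hz₀
  have hu := (tendstoLocallyUniformlyOn_iff_forall_isCompact hU).1 hF _ hBU
    (isCompact_closedBall c r)
  obtain ⟨n, hn⟩ := (Metric.tendstoUniformlyOn_iff.1 hu _ (half_pos hm)).exists
  have hFd : DiffContOnCl ℂ (fun z => (F n z)⁻¹) (ball c r) := by
    have : DifferentiableOn ℂ (fun z => (F n z)⁻¹) (closedBall c r) :=
      ((hd n).mono hBU).inv fun z hz => hne n z (hrs hz).2.1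
    apply DifferentiableOn.diffContOnCl
    rwa [closure_ball c hr.ne']
  have hbd : ∀ z ∈ frontier (ball c r), ‖(F n z)⁻¹‖ ≤ (‖g z₀‖ / 2)⁻¹ := by
    intro z hz
    rw [frontier_ball c hr.ne'] at hz
    rw [norm_inv]
    have h2 := hn z (hsB hz)
    have h3 : ‖g z₀‖ ≤ ‖g z‖ := hmin hz
    rw [dist_eq_norm] at h2
    have h4 : ‖g z‖ ≤ ‖g z - F n z‖ + ‖F n z‖ := by simpa using norm_add_le (g z - F n z) (F n z)
    exact inv_anti₀ (half_pos hm) (by linarith)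
  have h5 := Complex.norm_le_of_forall_mem_frontier_norm_le isBounded_ball hFd hbd
    (subset_closure (mem_ball_self hr))
  have h6 := hn c (mem_closedBall_self hr.le)
  rw [hgc, dist_zero_left] at h6
  have h7 : 0 < ‖F n c‖ := norm_pos_iff.2 (hne n c (hrs (mem_closedBall_self hr.le)).2.1)
  rw [norm_inv, inv_le_inv₀ h7 (half_pos hm)] at h5
  linarith

/-- **Montel's theorem**, for ultrafilters: a family of holomorphic maps to the unit disc has a
locally uniform limit along every ultrafilter. -/
lemma exists_tendstoLocallyUniformlyOn_of_mapsTo_ball {ι : Type*} (l : Ultrafilter ι)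
    {F : ι → ℂ → ℂ} {U : Set ℂ} (hU : IsOpen U) (hd : ∀ n, DifferentiableOn ℂ (F n) U)
    (hm : ∀ n, MapsTo (F n) U (ball 0 1)) :
    ∃ g : ℂ → ℂ, TendstoLocallyUniformlyOn F g l U ∧ MapsTo g U (closedBall 0 1) := by
  have hlim : ∀ z, ∃ y, z ∈ U → y ∈ closedBall (0 : ℂ) 1 ∧ Tendsto (fun n => F n z) l (𝓝 y) := by
    intro z
    by_cases hz : z ∈ U
    · obtain ⟨y, hy, hly⟩ := (isCompact_closedBall (0 : ℂ) 1).ultrafilter_le_nhds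
        (l.map fun n => F n z) (by
          rw [le_principal_iff]
          change ∀ᶠ n in (l : Filter ι), F n z ∈ closedBall 0 1
          exact Eventually.of_forall fun n => ball_subset_closedBall (hm n hz))
      exact ⟨y, fun _ => ⟨hy, hly⟩⟩
    · exact ⟨0, fun h => absurd h hz⟩
  choose g hg using hlim
  refine ⟨g, ?_, fun z hz => (hg z hz).1⟩
  rw [Metric.tendstoLocallyUniformlyOn_iff]
  intro ε hε z₀ hz₀
  obtain ⟨r, hr, hrU⟩ := Metric.isOpen_iff.1 hU z₀ hz₀
  have hlip : ∀ n, ∀ z ∈ ball z₀ r, dist (F n z) (F n z₀) ≤ 2 / r * dist z z₀ := by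
    intro n z hz
    refine Complex.dist_le_div_mul_dist_of_mapsTo_ball ((hd n).mono hrU) (fun w hw => ?_) hz
    rw [mem_closedBall, dist_eq_norm]
    have h1 := hm n (hrU hw)
    have h2 := hm n hz₀
    rw [mem_ball_zero_iff] at h1 h2
    linarith [norm_sub_le (F n w) (F n z₀)]
  have hlipg : ∀ z ∈ ball z₀ r, dist (g z) (g z₀) ≤ 2 / r * dist z z₀ := fun z hz =>
    le_of_tendsto ((hg z (hrU hz)).2.dist (hg z₀ hz₀).2)
      (Eventually.of_forall fun n => hlip n z hz)
  set δ := min r (ε * r / 6) with hδ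
  have hδ0 : 0 < δ := by positivity
  refine ⟨ball z₀ δ, mem_nhdsWithin_of_mem_nhds (ball_mem_nhds _ hδ0), ?_⟩
  have h3 := (Metric.tendsto_nhds.1 (hg z₀ hz₀).2) (ε / 3) (by positivity)
  filter_upwards [h3] with n hn z hz
  have hzr : z ∈ ball z₀ r := ball_subset_ball (min_le_left _ _) hz
  have h4 : 2 / r * dist z z₀ < ε / 3 := by
    have : dist z z₀ < ε * r / 6 := lt_of_lt_of_le hz (min_le_right _ _)
    calc 2 / r * dist z z₀ < 2 / r * (ε * r / 6) := by gcongr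
      _ = ε / 3 := by field_simp; norm_num
  have h5 := hlip n z hzr
  have h6 := hlipg z hzr
  have h7 : dist (g z) (F n z) ≤ dist (g z) (g z₀) + dist (g z₀) (F n z₀) + dist (F n z₀) (F n z) :=
    dist_triangle4 _ _ _ _
  rw [dist_comm (g z₀), dist_comm (F n z₀) (F n z)] at h7
  linarith

lemma hasDerivAt_of_sq_eq {h g : ℂ → ℂ} {g' z : ℂ} (hc : ContinuousAt h z)
    (hsq : ∀ w, h w ^ 2 = g w) (hz : h z ≠ 0) (hg : HasDerivAt g g' z) :
    HasDerivAt h (g' / (2 * h z)) z := by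
  rw [hasDerivAt_iff_tendsto_slope] at hg ⊢
  have hc' : Tendsto (fun w => h w + h z) (𝓝[≠] z) (𝓝 (2 * h z)) := by
    rw [two_mul]
    exact (hc.tendsto.mono_left nhdsWithin_le_nhds).add_const _
  have hne : (2 * h z) ≠ 0 := mul_ne_zero two_ne_zero hz
  refine (hg.div hc' hne).congr' ?_
  filter_upwards [hc'.eventually_ne hne] with w hw
  rw [Pi.div_apply, slope_def_field, slope_def_field, ← hsq, ← hsq, div_right_comm, sq_sub_sq,
    mul_div_cancel_left₀ _ hw]

/-- Univalent maps of `U` to the unit disc sending `a` to the centre. -/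
structure IsUnivalent (U : Set ℂ) (a : ℂ) (f : ℂ → ℂ) : Prop where
  differentiableOn : DifferentiableOn ℂ f U
  mapsTo : MapsTo f U (ball 0 1)
  injOn : InjOn f U
  deriv_ne_zero : ∀ z ∈ U, deriv f z ≠ 0
  map_base : f a = 0

lemma IsUnivalent.norm_lt_one {U : Set ℂ} {a z : ℂ} {f : ℂ → ℂ} (hf : IsUnivalent U a f)
    (hz : z ∈ U) : ‖f z‖ < 1 := by simpa using hf.mapsTo hz

lemma exists_isUnivalent_forall_norm_deriv_le {U : Set ℂ} (hU : IsOpen U) (hUc : IsPreconnected U)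
    {a : ℂ} (ha : a ∈ U) (hne : ∃ f, IsUnivalent U a f) :
    ∃ f, IsUnivalent U a f ∧ ∀ h, IsUnivalent U a h → ‖deriv h a‖ ≤ ‖deriv f a‖ := by
  set S : Set ℝ := {s | ∃ f, IsUnivalent U a f ∧ ‖deriv f a‖ = s} with hS
  obtain ⟨r, hr, hrU⟩ := Metric.isOpen_iff.1 hU a ha
  have hSne : S.Nonempty := let ⟨f, hf⟩ := hne; ⟨_, f, hf, rfl⟩
  have hSb : BddAbove S := by
    refine ⟨1 / r, ?_⟩
    rintro _ ⟨f, hf, rfl⟩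
    refine Complex.norm_deriv_le_div_of_mapsTo_ball (hf.differentiableOn.mono hrU) ?_ hr
    rw [hf.map_base]
    exact (hf.mapsTo.mono_left hrU).mono_right ball_subset_closedBall
  obtain ⟨s, -, hs, hsS⟩ := exists_seq_tendsto_sSup hSne hSb
  choose F hF hFs using hsS
  have hFd : ∀ n, DifferentiableOn ℂ (F n) U := fun n => (hF n).differentiableOn
  obtain ⟨g, hg, hgm⟩ := exists_tendstoLocallyUniformlyOn_of_mapsTo_ball (hyperfilter ℕ) hU hFd
    fun n => (hF n).mapsTo
  have hgd : DifferentiableOn ℂ g U := hg.differentiableOn (Eventually.of_forall hFd) hU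
  have hg' := hg.deriv (Eventually.of_forall hFd) hU
  have hle : (hyperfilter ℕ : Filter ℕ) ≤ atTop := by
    rw [← Nat.cofinite_eq_atTop]; exact hyperfilter_le_cofinite
  have hgs : ‖deriv g a‖ = sSup S := by
    refine tendsto_nhds_unique (hg'.tendsto_at ha).norm ?_
    simpa [hFs] using hs.mono_left hle
  have hpos : 0 < ‖deriv g a‖ := by
    obtain ⟨f, hf⟩ := hne
    rw [hgs]
    exact lt_of_lt_of_le (norm_pos_iff.2 (hf.deriv_ne_zero a ha)) (le_csSup hSb ⟨f, hf, rfl⟩)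
  have hnc : ∀ y, ¬ EqOn g (fun _ => y) U := by
    intro y hy
    have : deriv g a = 0 := by
      rw [((hy.eventuallyEq_of_mem (hU.mem_nhds ha))).deriv_eq]
      simp
    simp [this] at hpos
  have hnc' : ∀ y, ∀ c ∈ U, ¬ ∀ᶠ z in 𝓝 c, g z - y = 0 := by
    intro y c hc h
    refine hnc y fun z hz => ?_
    have := ((hgd.sub_const y).analyticOnNhd hU).eqOn_zero_of_preconnected_of_eventuallyEq_zero
      hUc hc h hz
    simpa [sub_eq_zero] using this
  refine ⟨g, ⟨hgd, fun z hz => ?_, fun z₁ hz₁ z₂ hz₂ h12 => ?_, fun z hz h0 => ?_, ?_⟩, ?_⟩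
  · rw [mem_ball_zero_iff]
    refine lt_of_le_of_ne (by simpa using hgm hz) fun h1 => ?_
    refine hnc (g z) (Complex.eqOn_of_isPreconnected_of_isMaxOn_norm hUc hU hgd hz fun w hw => ?_)
    simpa [h1] using hgm hw
  · by_contra hne12
    refine hnc' (g z₁) z₂ hz₂ ?_
    have hconst : TendstoLocallyUniformlyOn (fun n _ => F n z₁) (fun _ => g z₁)
        (hyperfilter ℕ : Filter ℕ) U := by
      rw [Metric.tendstoLocallyUniformlyOn_iff]
      intro ε hε x hx
      refine ⟨univ, univ_mem, ?_⟩
      filter_upwards [(Metric.tendsto_nhds.1 (hg.tendsto_at hz₁)) ε hε] with n hn y _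
      rwa [dist_comm]
    obtain ⟨V, hV, hVs⟩ : ∃ V ∈ 𝓝 z₂, ∀ z ∈ V, z ∈ U ∧ z ≠ z₁ :=
      ⟨U ∩ {z₁}ᶜ, inter_mem (hU.mem_nhds hz₂) (compl_singleton_mem_nhds (Ne.symm hne12)),
        fun z hz => hz⟩
    refine eventually_eq_zero_of_tendstoLocallyUniformlyOn (l := (hyperfilter ℕ : Filter ℕ)) hU hz₂
      (F := fun n z => F n z - F n z₁) (hg.sub hconst) (fun n => (hFd n).sub_const _) hV ?_
      (by simp [h12])
    intro n z hz h
    exact (hVs z hz).2 ((hF n).injOn (hVs z hz).1 hz₁ (sub_eq_zero.1 h))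
  · have h1 := eventually_eq_zero_of_tendstoLocallyUniformlyOn (l := (hyperfilter ℕ : Filter ℕ))
      hU hz hg' (fun n => (hFd n).deriv hU) (hU.mem_nhds hz)
      (fun n w hw => (hF n).deriv_ne_zero w hw) h0
    have h2 := ((hgd.deriv hU).analyticOnNhd hU).eqOn_zero_of_preconnected_of_eventuallyEq_zero
      hUc hz h1 ha
    simp [h2] at hpos
  · refine tendsto_nhds_unique (hg.tendsto_at ha) ?_
    simp [(hF _).map_base]
  · intro h hh
    rw [hgs]
    exact le_csSup hSb ⟨h, hh, rfl⟩

lemma IsUnivalent.exists_norm_deriv_lt {U : Set ℂ} (hU : IsOpen U) (hUc : IsSimplyConnected U)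
    {a ζ : ℂ} (ha : a ∈ U) {f : ℂ → ℂ} (hf : IsUnivalent U a f) (hζ : ‖ζ‖ < 1)
    (hζf : ζ ∉ f '' U) : ∃ h, IsUnivalent U a h ∧ ‖deriv f a‖ < ‖deriv h a‖ := by
  set g : ℂ → ℂ := fun z => moebius ζ (f z) with hg
  have hgd : ∀ z ∈ U, HasDerivAt g ((1 - conj ζ * ζ) / (1 - conj ζ * f z) ^ 2 * deriv f z) z :=
    fun z hz => (hasDerivAt_moebius hζ (hf.norm_lt_one hz)).comp z
      (hf.differentiableOn.differentiableAt (hU.mem_nhds hz)).hasDerivAt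
  have hg0 : ∀ z ∈ U, g z ≠ 0 := by
    intro z hz h
    rw [← moebius_self ζ] at h
    exact hζf ⟨z, hz, moebius_inj hζ (hf.norm_lt_one hz) hζ h⟩
  have hg1 : ∀ z ∈ U, ‖g z‖ < 1 := fun z hz => norm_moebius_lt_one hζ (hf.norm_lt_one hz)
  obtain ⟨h, hhc, hsq⟩ := Complex.exists_continuousOn_pow_eq hUc hU
    (g := g) (fun z hz => (hgd z hz).continuousAt.continuousWithinAt)
    (by rintro ⟨z, hz, h0⟩; exact hg0 z hz h0) two_ne_zero
  have hh0 : ∀ z ∈ U, h z ≠ 0 := fun z hz h0 => hg0 z hz (by rw [← hsq, h0]; simp)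
  have hh1 : ∀ z ∈ U, ‖h z‖ < 1 := by
    intro z hz
    have := hg1 z hz
    rw [← hsq, norm_pow] at this
    nlinarith [norm_nonneg (h z)]
  have hhd := fun z hz => hasDerivAt_of_sq_eq (hhc.continuousAt (hU.mem_nhds hz)) hsq (hh0 z hz)
    (hgd z hz)
  set b := h a with hb
  have hb1 : ‖b‖ < 1 := hh1 a ha
  set k : ℂ → ℂ := fun z => moebius b (h z) with hk
  have hkd : ∀ z ∈ U, HasDerivAt k ((1 - conj b * b) / (1 - conj b * h z) ^ 2 *
      ((1 - conj ζ * ζ) / (1 - conj ζ * f z) ^ 2 * deriv f z / (2 * h z))) z := fun z hz =>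
    (hasDerivAt_moebius hb1 (hh1 z hz)).comp z (hhd z hz)
  refine ⟨k, ⟨fun z hz => (hkd z hz).differentiableAt.differentiableWithinAt,
    fun z hz => by simpa using norm_moebius_lt_one hb1 (hh1 z hz), fun z hz w hw hzw => ?_,
    fun z hz => ?_, moebius_self _⟩, ?_⟩
  · have h1 := moebius_inj hb1 (hh1 z hz) (hh1 w hw) hzw
    have h2 : g z = g w := by rw [← hsq, ← hsq, h1]
    exact hf.injOn hz hw (moebius_inj hζ (hf.norm_lt_one hz) (hf.norm_lt_one hw) h2)
  · rw [(hkd z hz).deriv]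
    have h1 := one_sub_conj_mul_ne_zero hb1 hb1
    have h2 := one_sub_conj_mul_ne_zero hb1 (hh1 z hz)
    have h3 := one_sub_conj_mul_ne_zero hζ hζ
    have h4 := one_sub_conj_mul_ne_zero hζ (hf.norm_lt_one hz)
    have h5 := hf.deriv_ne_zero z hz
    have h6 := hh0 z hz
    exact mul_ne_zero (div_ne_zero h1 (pow_ne_zero 2 h2)) (div_ne_zero
      (mul_ne_zero (div_ne_zero h3 (pow_ne_zero 2 h4)) h5) (mul_ne_zero two_ne_zero h6))
  · rw [(hkd a ha).deriv, hf.map_base]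
    have hsqa : ‖ζ‖ = ‖b‖ ^ 2 := by
      rw [hb, ← norm_pow, hsq, hg]
      simp [hf.map_base, moebius_zero_right]
    have hD : 0 < ‖deriv f a‖ := norm_pos_iff.2 (hf.deriv_ne_zero a ha)
    have hb0 : 0 < ‖b‖ := norm_pos_iff.2 (hh0 a ha)
    have hn : ∀ x : ℂ, ‖x‖ < 1 → ‖1 - conj x * x‖ = 1 - ‖x‖ ^ 2 := by
      intro x hx
      rw [mul_comm, Complex.mul_conj, Complex.normSq_eq_norm_sq]
      norm_cast
      rw [Real.norm_eq_abs, abs_of_nonneg]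
      nlinarith [norm_nonneg x]
    simp only [← hb, mul_zero, sub_zero, one_pow, div_one, norm_mul, norm_div, norm_pow, hn b hb1,
      hn ζ hζ, hsqa, Complex.norm_ofNat]
    have h1 : 0 < 1 - ‖b‖ ^ 2 := by nlinarith
    have h2 : (1 - ‖b‖ ^ 2) / (1 - ‖b‖ ^ 2) ^ 2 * ((1 - (‖b‖ ^ 2) ^ 2) * ‖deriv f a‖ / (2 * ‖b‖))
        = ‖deriv f a‖ * ((1 + ‖b‖ ^ 2) / (2 * ‖b‖)) := by
      field_simp
      ring
    rw [h2]
    refine lt_mul_of_one_lt_right hD ?_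
    rw [one_lt_div (by positivity)]
    nlinarith [sq_nonneg (1 - ‖b‖), mul_pos (sub_pos.2 hb1) (sub_pos.2 hb1)]

/-- **Riemann mapping theorem** for bounded simply connected open sets. -/
theorem exists_biholomorphic_ball {U : Set ℂ} (hU : IsOpen U) (hUc : IsSimplyConnected U)
    (hUb : Bornology.IsBounded U) :
    ∃ φ ψ : ℂ → ℂ, DifferentiableOn ℂ φ U ∧ DifferentiableOn ℂ ψ (ball 0 1) ∧
      MapsTo φ U (ball 0 1) ∧ MapsTo ψ (ball 0 1) U ∧ (∀ z ∈ U, ψ (φ z) = z) ∧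
      (∀ w ∈ ball 0 1, φ (ψ w) = w) ∧ ∀ z ∈ U, deriv φ z ≠ 0 := by
  obtain ⟨a, ha⟩ := hUc.nonempty
  obtain ⟨R, hR, hUR⟩ := hUb.subset_ball_lt 0 a
  have hlin : ∀ z, HasDerivAt (fun z => (z - a) / (R : ℂ)) (1 / (R : ℂ)) z := fun z =>
    ((hasDerivAt_id z).sub_const a).div_const _
  have hR' : (R : ℂ) ≠ 0 := by exact_mod_cast hR.ne'
  have h0 : IsUnivalent U a fun z => (z - a) / (R : ℂ) := by
    refine ⟨fun z _ => (hlin z).differentiableAt.differentiableWithinAt, fun z hz => ?_,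
      fun z _ w _ h => ?_, fun z _ => ?_, by simp⟩
    · have := hUR hz
      rw [mem_ball, dist_eq_norm] at this
      rw [mem_ball_zero_iff, norm_div, Complex.norm_real, Real.norm_of_nonneg hR.le]
      rwa [div_lt_one hR]
    · simpa [hR'] using h
    · rw [(hlin z).deriv]
      simpa using hR'
  obtain ⟨φ, hφ, hmax⟩ := exists_isUnivalent_forall_norm_deriv_le hU
    hUc.isPathConnected.isConnected.isPreconnected ha ⟨_, h0⟩
  have hsurj : ∀ w ∈ ball (0 : ℂ) 1, ∃ z ∈ U, φ z = w := by
    intro w hw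
    by_contra hcon
    obtain ⟨h, hh, hlt⟩ := hφ.exists_norm_deriv_lt hU hUc ha (by simpa using hw) hcon
    exact absurd (hmax h hh) (not_le.2 hlt)
  choose! ψ hψU hψ using hsurj
  have hl : ∀ z ∈ U, ψ (φ z) = z := fun z hz =>
    hφ.injOn (hψU _ (hφ.mapsTo hz)) hz (hψ _ (hφ.mapsTo hz))
  refine ⟨φ, ψ, hφ.differentiableOn, fun w hw => ?_, hφ.mapsTo, hψU, hl, hψ, hφ.deriv_ne_zero⟩
  obtain ⟨z, hz, rfl⟩ : ∃ z ∈ U, φ z = w := ⟨ψ w, hψU w hw, hψ w hw⟩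
  have hs := (hφ.differentiableOn.analyticAt (hU.mem_nhds hz)).hasStrictDerivAt
  have hd := hs.to_localInverse (hφ.deriv_ne_zero z hz)
  have hself : HasStrictDerivAt.localInverse φ _ z hs (hφ.deriv_ne_zero z hz) (φ z) = z :=
    (hs.hasStrictFDerivAt_equiv (hφ.deriv_ne_zero z hz)).localInverse_apply_image
  refine (hd.hasDerivAt.differentiableAt.congr_of_eventuallyEq ?_).differentiableWithinAt
  have hU' : U ∈ 𝓝 (HasStrictDerivAt.localInverse φ _ z hs (hφ.deriv_ne_zero z hz) (φ z)) := by
    rw [hself]; exact hU.mem_nhds hz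
  filter_upwards [hs.eventually_right_inverse (hφ.deriv_ne_zero z hz),
    hd.hasDerivAt.continuousAt.eventually hU', isOpen_ball.mem_nhds hw] with y hy hyU hyb
  exact hφ.injOn (hψU y hyb) hyU (by rw [hψ y hyb, hy])

/-! ### Parametric integrals of holomorphic functions -/

lemma differentiableAt_integral_of_norm_le {X : Type*} [MeasurableSpace X] {μ : Measure X}
    {K : X → ℂ → ℂ} {b : X → ℝ} {z₀ : ℂ} {r : ℝ} (hr : 0 < r)
    (hm : ∀ z ∈ ball z₀ r, AEStronglyMeasurable (fun x => K x z) μ)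
    (hd : ∀ᵐ x ∂μ, DifferentiableOn ℂ (K x) (ball z₀ r))
    (hb : ∀ᵐ x ∂μ, ∀ z ∈ ball z₀ r, ‖K x z‖ ≤ b x) (hbi : Integrable b μ) :
    DifferentiableAt ℂ (fun z => ∫ x, K x z ∂μ) z₀ := by
  have hz₀ : z₀ ∈ ball z₀ r := mem_ball_self hr
  have hball : ∀ z ∈ ball z₀ (r / 2), ball z (r / 2) ⊆ ball z₀ r := fun z hz => by
    apply ball_subset_ball'
    rw [mem_ball] at hz
    linarith
  have hsub : ball z₀ (r / 2) ⊆ ball z₀ r := ball_subset_ball (by linarith)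
  have hdm : AEStronglyMeasurable (fun x => deriv (K x) z₀) μ := by
    have hu : Tendsto (fun n : ℕ => z₀ + ((r / 2 * (1 / 2) ^ n : ℝ) : ℂ)) atTop (𝓝[≠] z₀) := by
      rw [tendsto_nhdsWithin_iff]
      constructor
      · have h1 : Tendsto (fun n : ℕ => (r / 2 * (1 / 2) ^ n : ℝ)) atTop (𝓝 (r / 2 * 0)) :=
          (tendsto_pow_atTop_nhds_zero_of_lt_one (by norm_num) (by norm_num)).const_mul _
        have h2 := (Complex.continuous_ofReal.tendsto _).comp h1
        simpa using h2.const_add z₀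
      · refine Eventually.of_forall fun n => ?_
        have h3 : (r / 2 * (1 / 2) ^ n : ℝ) ≠ 0 := by positivity
        have h4 : ((r / 2 * (1 / 2) ^ n : ℝ) : ℂ) ≠ 0 := Complex.ofReal_ne_zero.2 h3
        simpa only [mem_compl_iff, mem_singleton_iff, add_eq_left] using h4
    refine aestronglyMeasurable_of_tendsto_ae atTop
      (f := fun (n : ℕ) x => slope (K x) z₀ (z₀ + ((r / 2 * (1 / 2) ^ n : ℝ) : ℂ))) (fun n => ?_) ?_
    · simp only [slope_def_field]
      simp only [div_eq_mul_inv]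
      refine ((hm _ ?_).sub (hm _ hz₀)).mul_const _
      rw [mem_ball, dist_eq_norm, add_sub_cancel_left, Complex.norm_real, Real.norm_of_nonneg
        (by positivity)]
      have : (1 / 2 : ℝ) ^ n ≤ 1 := pow_le_one₀ (by norm_num) (by norm_num)
      nlinarith
    · filter_upwards [hd] with x hx
      exact ((hasDerivAt_iff_tendsto_slope.1
        (hx.differentiableAt (isOpen_ball.mem_nhds hz₀)).hasDerivAt)).comp hu
  refine (hasDerivAt_integral_of_dominated_loc_of_deriv_le (s := ball z₀ (r / 2))
    (F := fun z x => K x z) (F' := fun z x => deriv (K x) z)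
    (bound := fun x => 2 * b x / (r / 2)) (ball_mem_nhds _ (half_pos hr)) ?_ ?_ hdm ?_ ?_
    ?_).2.differentiableAt
  · filter_upwards [isOpen_ball.mem_nhds hz₀] with z hz using hm z hz
  · exact hbi.mono' (hm _ hz₀) (hb.mono fun x hx => hx _ hz₀)
  · filter_upwards [hd, hb] with x hx hbx z hz
    refine Complex.norm_deriv_le_div_of_mapsTo_ball (hx.mono (hball z hz)) (fun w hw => ?_)
      (half_pos hr)
    rw [mem_closedBall, dist_eq_norm]
    linarith [norm_sub_le (K x w) (K x z), hbx w (hball z hz hw), hbx z (hsub hz)]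
  · simpa [mul_div_assoc] using (hbi.const_mul 2).div_const (r / 2)
  · filter_upwards [hd] with x hx z hz
    exact (hx.differentiableAt (isOpen_ball.mem_nhds (hsub hz))).hasDerivAt

/-- An integral of functions `log ‖F x ·‖` with `F x` holomorphic and bounded above and below is
harmonic. -/
lemma harmonicAt_integral_log_norm {X : Type*} [MeasurableSpace X] {μ : Measure X}
    {F : X → ℂ → ℂ} {f : X → ℝ} {z₀ : ℂ} {r m M : ℝ} (hr : 0 < r) (hm0 : 0 < m)
    (hmeas : ∀ z ∈ ball z₀ r, AEStronglyMeasurable (fun x => F x z) μ)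
    (hd : ∀ᵐ x ∂μ, DifferentiableOn ℂ (F x) (ball z₀ r))
    (hlow : ∀ᵐ x ∂μ, ∀ z ∈ ball z₀ r, m ≤ ‖F x z‖)
    (hup : ∀ᵐ x ∂μ, ∀ z ∈ ball z₀ r, ‖F x z‖ ≤ M) (hf : Integrable f μ) :
    InnerProductSpace.HarmonicAt (fun z => ∫ x, Real.log ‖F x z‖ * f x ∂μ) z₀ := by
  have hz₀ : z₀ ∈ ball z₀ r := mem_ball_self hr
  rcases eq_or_ne μ 0 with rfl | hμ
  · simp only [integral_zero_measure]
    exact InnerProductSpace.harmonicAt_const (0 : ℝ)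
  have hM0 : 0 < M := by
    have : (ae μ).NeBot := ae_neBot.2 hμ
    obtain ⟨x, h1, h2⟩ := (hlow.and hup).exists
    exact hm0.trans_le ((h1 _ hz₀).trans (h2 _ hz₀))
  set ρ := min r (r * m / (4 * M)) with hρ
  have hρ0 : 0 < ρ := by positivity
  have hρr : ball z₀ ρ ⊆ ball z₀ r := ball_subset_ball (min_le_left _ _)
  have hclose : ∀ᵐ x ∂μ, ∀ z ∈ ball z₀ ρ, ‖F x z / F x z₀ - 1‖ ≤ 1 / 2 := by
    filter_upwards [hd, hlow, hup] with x hdx hlx hux z hz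
    have h1 : dist (F x z) (F x z₀) ≤ 2 * M / r * dist z z₀ := by
      refine Complex.dist_le_div_mul_dist_of_mapsTo_ball hdx (fun w hw => ?_) (hρr hz)
      rw [mem_closedBall, dist_eq_norm]
      linarith [norm_sub_le (F x w) (F x z₀), hux w hw, hux z₀ hz₀]
    have h2 := hlx z₀ hz₀
    have h3 : F x z₀ ≠ 0 := norm_pos_iff.1 (hm0.trans_le h2)
    rw [div_sub_one h3, norm_div, div_le_iff₀ (norm_pos_iff.2 h3), ← dist_eq_norm]
    have h4 : dist z z₀ ≤ r * m / (4 * M) := (mem_ball.1 hz).le.trans (min_le_right _ _)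
    calc dist (F x z) (F x z₀) ≤ 2 * M / r * (r * m / (4 * M)) := h1.trans (by gcongr)
      _ = 1 / 2 * m := by field_simp; norm_num
      _ ≤ _ := by gcongr
  set L : X → ℂ → ℂ := fun x z => Complex.log (F x z / F x z₀) with hL
  have hLm : ∀ z ∈ ball z₀ ρ, AEStronglyMeasurable (fun x => L x z) μ := fun z hz =>
    (Complex.measurable_log.comp_aemeasurable
      ((hmeas z (hρr hz)).aemeasurable.div (hmeas z₀ hz₀).aemeasurable)).aestronglyMeasurable
  have hLb : ∀ᵐ x ∂μ, ∀ z ∈ ball z₀ ρ, ‖L x z‖ ≤ 1 := by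
    filter_upwards [hclose] with x hx z hz
    have h1 := Complex.norm_log_one_add_half_le_self (hx z hz)
    rw [add_sub_cancel] at h1
    linarith [hx z hz]
  have hLd : ∀ᵐ x ∂μ, DifferentiableOn ℂ (L x) (ball z₀ ρ) := by
    filter_upwards [hclose, hd] with x hx hdx
    refine ((hdx.mono hρr).div_const _).clog fun z hz => ?_
    have h1 := Complex.abs_re_le_norm (F x z / F x z₀ - 1)
    have h2 := hx z hz
    left
    rw [Complex.sub_re, Complex.one_re] at h1
    have := neg_abs_le ((F x z / F x z₀).re - 1)
    linarith
  have hLi : ∀ z ∈ ball z₀ ρ, Integrable (fun x => L x z * f x) μ := fun z hz =>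
    hf.norm.mono' ((hLm z hz).mul (Complex.continuous_ofReal.comp_aestronglyMeasurable
      hf.aestronglyMeasurable)) (by
      filter_upwards [hLb] with x hx
      rw [norm_mul, Complex.norm_real]
      exact mul_le_of_le_one_left (norm_nonneg _) (hx z hz))
  have hZ : ∀ z₁ ∈ ball z₀ ρ, DifferentiableAt ℂ (fun z => ∫ x, L x z * f x ∂μ) z₁ := by
    intro z₁ hz₁
    have hs : ball z₁ (ρ - dist z₁ z₀) ⊆ ball z₀ ρ := ball_subset_ball' (by simp)
    refine differentiableAt_integral_of_norm_le (b := fun x => ‖f x‖) (r := ρ - dist z₁ z₀)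
      (by simpa using hz₁) (fun z hz => (hLi z (hs hz)).aestronglyMeasurable) ?_ ?_ hf.norm
    · filter_upwards [hLd] with x hx using (hx.mono hs).mul_const _
    · filter_upwards [hLb] with x hx z hz
      rw [norm_mul, Complex.norm_real]
      exact mul_le_of_le_one_left (norm_nonneg _) (hx z (hs hz))
  have hZa : AnalyticAt ℂ (fun z => ∫ x, L x z * f x ∂μ) z₀ :=
    DifferentiableOn.analyticAt (s := ball z₀ ρ)
      (fun z hz => (hZ z hz).differentiableWithinAt) (ball_mem_nhds _ hρ0)
  have hsum := hZa.harmonicAt_re.add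
    (InnerProductSpace.harmonicAt_const (∫ x, Real.log ‖F x z₀‖ * f x ∂μ) (x := z₀))
  refine (InnerProductSpace.harmonicAt_congr_nhds ?_).1 hsum
  filter_upwards [ball_mem_nhds _ hρ0] with z hz
  have hci : Integrable (fun x => Real.log ‖F x z₀‖ * f x) μ := by
    refine (hf.norm.const_mul (|Real.log m| + |Real.log M|)).mono' ?_ ?_
    · exact ((Real.measurable_log.comp_aemeasurable
        (hmeas z₀ hz₀).norm.aemeasurable).aestronglyMeasurable).mul hf.aestronglyMeasurable
    · filter_upwards [hlow, hup] with x h1 h2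
      rw [norm_mul]
      gcongr
      have h3 := Real.log_le_log hm0 (h1 z₀ hz₀)
      have h4 := Real.log_le_log (hm0.trans_le (h1 z₀ hz₀)) (h2 z₀ hz₀)
      rw [Real.norm_eq_abs, abs_le]
      constructor <;> linarith [neg_abs_le (Real.log m), le_abs_self (Real.log M),
        abs_nonneg (Real.log m), abs_nonneg (Real.log M)]
  have hre : (∫ x, L x z * f x ∂μ).re = ∫ x, (L x z * f x).re ∂μ :=
    (integral_re (hLi z hz)).symm
  have hLre : Integrable (fun x => (L x z * f x).re) μ := (hLi z hz).re
  simp only [Pi.add_apply]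
  rw [hre, ← integral_add hLre hci]
  refine integral_congr_ae ?_
  filter_upwards [hlow] with x hx
  have h1 : F x z ≠ 0 := norm_pos_iff.1 (hm0.trans_le (hx z (hρr hz)))
  have h2 : F x z₀ ≠ 0 := norm_pos_iff.1 (hm0.trans_le (hx z₀ hz₀))
  simp only [hL, Complex.re_mul_ofReal, Complex.log_re, norm_div]
  rw [Real.log_div (norm_ne_zero_iff.2 h1) (norm_ne_zero_iff.2 h2)]
  ring

/-! ### The logarithmic potential -/

lemma integrableOn_ball_norm_inv (R : ℝ) : IntegrableOn (fun w : ℂ => ‖w‖⁻¹) (ball 0 R) := by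
  have h := (integrable_fun_norm_addHaar (volume : Measure ℂ)
    (f := (Iio R).indicator fun y : ℝ => y⁻¹)).2 (by
      simp only [Complex.finrank_real_complex, Nat.add_one_sub_one, pow_one, smul_eq_mul]
      have : IntegrableOn (fun _ : ℝ => (1 : ℝ)) (Ioo 0 R) := by simp
      rw [← integrable_indicator_iff measurableSet_Ioi]
      rw [← integrable_indicator_iff measurableSet_Ioo] at this
      refine this.congr (Eventually.of_forall fun y => ?_)
      simp only [indicator, mem_Ioo, mem_Ioi, mem_Iio]
      by_cases h1 : 0 < y <;> by_cases h2 : y < R <;> simp [h1, h2]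
      exact (mul_inv_cancel₀ h1.ne').symm)
  rw [← integrable_indicator_iff measurableSet_ball]
  refine h.congr (Eventually.of_forall fun w => ?_)
  simp [indicator]

lemma locallyIntegrable_norm_inv : LocallyIntegrable fun w : ℂ => ‖w‖⁻¹ := by
  rw [locallyIntegrable_iff]
  intro K hK
  obtain ⟨R, hR⟩ := hK.isBounded.subset_ball 0
  exact (integrableOn_ball_norm_inv R).mono_set hR

lemma locallyIntegrable_inv : LocallyIntegrable fun w : ℂ => w⁻¹ :=
  locallyIntegrable_norm_inv.mono (by fun_prop)
    (Eventually.of_forall fun w => by simp)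

lemma abs_log_norm_le (w : ℂ) : |Real.log ‖w‖| ≤ ‖w‖⁻¹ + ‖w‖ := by
  rcases eq_or_ne w 0 with rfl | hw
  · simp
  have h := norm_pos_iff.2 hw
  rw [abs_le]
  have h1 := Real.log_le_sub_one_of_pos h
  have h2 := Real.log_le_sub_one_of_pos (inv_pos.2 h)
  rw [Real.log_inv] at h2
  constructor <;> linarith [inv_pos.2 h]

lemma locallyIntegrable_log_norm : LocallyIntegrable fun w : ℂ => Real.log ‖w‖ := by
  have h : LocallyIntegrable fun w : ℂ => ‖w‖⁻¹ + ‖w‖ :=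
    locallyIntegrable_norm_inv.add continuous_norm.locallyIntegrable
  refine h.mono (Real.measurable_log.comp measurable_norm).aestronglyMeasurable
    (Eventually.of_forall fun w => ?_)
  rw [Real.norm_eq_abs, Real.norm_of_nonneg (by positivity)]
  exact abs_log_norm_le w

/-- The logarithmic potential of `F`. -/
def logPot (F : ℂ → ℝ) (z : ℂ) : ℝ := ∫ w, Real.log ‖w‖ * F (z - w)

/-- The Cauchy transform of `F`. -/
def cauchyPot (F : ℂ → ℝ) (z : ℂ) : ℂ := ∫ w, w⁻¹ * (F (z - w) : ℂ)

lemma logPot_eq (F : ℂ → ℝ) (z : ℂ) : logPot F z = ∫ w, Real.log ‖z - w‖ * F w := by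
  rw [logPot, ← integral_sub_left_eq_self _ volume z]
  simp

lemma cauchyPot_eq (F : ℂ → ℝ) (z : ℂ) : cauchyPot F z = ∫ w, (z - w)⁻¹ * (F w : ℂ) := by
  rw [cauchyPot, ← integral_sub_left_eq_self _ volume z]
  simp

lemma _root_.HasCompactSupport.ofReal {F : ℂ → ℝ} (hF : HasCompactSupport F) :
    HasCompactSupport fun w => (F w : ℂ) :=
  hF.comp_left (g := fun x : ℝ => (x : ℂ)) (by simp)

lemma continuous_cauchyPot {F : ℂ → ℝ} (hF : Continuous F) (hc : HasCompactSupport F) :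
    Continuous (cauchyPot F) :=
  hc.ofReal.continuous_convolution_right (ContinuousLinearMap.mul ℝ ℂ) locallyIntegrable_inv
    (by fun_prop)

lemma integrable_logPot {F : ℂ → ℝ} (hF : Continuous F) (hc : HasCompactSupport F) (z : ℂ) :
    Integrable fun w => Real.log ‖z - w‖ * F w := by
  have := (hc.convolutionExists_right (ContinuousLinearMap.mul ℝ ℝ)
    locallyIntegrable_log_norm hF z).integrable.comp_sub_left z
  simpa using this

lemma integrable_cauchyPot {F : ℂ → ℝ} (hF : Continuous F) (hc : HasCompactSupport F) (z : ℂ) :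
    Integrable fun w => (z - w)⁻¹ * (F w : ℂ) := by
  have := (hc.ofReal.convolutionExists_right (ContinuousLinearMap.mul ℝ ℂ)
    locallyIntegrable_inv (by fun_prop) z).integrable.comp_sub_left z
  simpa using this

lemma integrable_norm_inv_mul {F : ℂ → ℝ} (hF : Continuous F) (hc : HasCompactSupport F) (z : ℂ) :
    Integrable fun w => ‖z - w‖⁻¹ * F w := by
  have := (hc.convolutionExists_right (ContinuousLinearMap.mul ℝ ℝ)
    locallyIntegrable_norm_inv hF z).integrable.comp_sub_left z
  simpa using this

lemma continuous_integral_norm_inv_mul {F : ℂ → ℝ} (hF : Continuous F) (hc : HasCompactSupport F) :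
    Continuous fun z => ∫ w, ‖z - w‖⁻¹ * F w := by
  have h := hc.continuous_convolution_right (ContinuousLinearMap.mul ℝ ℝ)
    locallyIntegrable_norm_inv hF
  refine h.congr fun z => ?_
  rw [convolution_def, ← integral_sub_left_eq_self _ volume z]
  simp

lemma hasDerivAt_log_norm_line {a v : ℂ} {s : ℝ} (h : a + s * v ≠ 0) :
    HasDerivAt (fun s : ℝ => Real.log ‖a + s * v‖) (((a + s * v)⁻¹ * v).re) s := by
  have h1 : HasDerivAt (fun s : ℝ => a + s * v) v s := by
    simpa using (((Complex.ofRealCLM.hasDerivAt (x := s)).mul_const v).const_add a)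
  have h2 := (h1.norm_sq.log (by positivity)).div_const 2
  have h3 : (fun s : ℝ => Real.log (‖a + s * v‖ ^ 2) / 2) = fun s : ℝ => Real.log ‖a + s * v‖ := by
    ext s
    rw [Real.log_pow]
    push_cast
    ring
  rw [← h3]
  convert! h2 using 1
  rw [Complex.inner, Complex.inv_def, ← Complex.normSq_eq_norm_sq, mul_right_comm,
    Complex.re_mul_ofReal]
  ring_nf

lemma ae_forall_add_mul_ne (z v : ℂ) : ∀ᵐ w : ℂ, ∀ s : ℝ, z - w + s * v ≠ 0 := by
  have h1 : (volume : Measure ℂ) ((AffineSubspace.mk' z (Submodule.span ℝ {v}) :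
      AffineSubspace ℝ ℂ) : Set ℂ) = 0 := by
    apply Measure.addHaar_affineSubspace
    intro h
    have h2 := congrArg AffineSubspace.direction h
    rw [AffineSubspace.direction_mk', AffineSubspace.direction_top] at h2
    have h3 := finrank_span_le_card (R := ℝ) ({v} : Set ℂ)
    rw [h2, finrank_top, Complex.finrank_real_complex] at h3
    simp at h3
  filter_upwards [measure_eq_zero_iff_ae_notMem.1 h1] with w hw s hs
  refine hw ?_
  rw [SetLike.mem_coe, AffineSubspace.mem_mk', Submodule.mem_span_singleton]
  refine ⟨s, ?_⟩
  rw [Complex.real_smul, vsub_eq_sub]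
  linear_combination hs

lemma integrable_uncurry_re_inv_mul {F : ℂ → ℝ} (hF : Continuous F) (hc : HasCompactSupport F)
    (z v : ℂ) : Integrable (Function.uncurry fun (s : ℝ) (w : ℂ) =>
      ((z - w + s * v)⁻¹ * v).re * F w) ((volume.restrict (Ioc 0 1)).prod volume) := by
  have hFm : Measurable F := hF.measurable
  have hmain : Integrable (fun p : ℝ × ℂ => ‖v‖ * (‖z + p.1 * v - p.2‖⁻¹ * ‖F p.2‖))
      ((volume.restrict (Ioc 0 1)).prod volume) := by
    refine Integrable.const_mul ?_ _
    have hm : Measurable fun p : ℝ × ℂ => ‖z + p.1 * v - p.2‖⁻¹ * ‖F p.2‖ := by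
      fun_prop
    rw [integrable_prod_iff hm.aestronglyMeasurable]
    have h0 : ∀ s : ℝ, Integrable fun w => ‖z + s * v - w‖⁻¹ * ‖F w‖ := fun s =>
      integrable_norm_inv_mul (F := fun w => ‖F w‖) hF.norm hc.norm (z + s * v)
    refine ⟨Eventually.of_forall fun s => h0 s, ?_⟩
    have h1 : ∀ s : ℝ, ∫ w, ‖‖z + s * v - w‖⁻¹ * ‖F w‖‖ = ∫ w, ‖z + s * v - w‖⁻¹ * ‖F w‖ := by
      intro s
      congr 1
      ext w
      exact Real.norm_of_nonneg (by positivity)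
    simp only [h1]
    have h2 : Continuous fun s : ℝ => ∫ w, ‖z + s * v - w‖⁻¹ * ‖F w‖ :=
      (continuous_integral_norm_inv_mul hF.norm hc.norm).comp (by fun_prop)
    exact (h2.integrableOn_Icc (a := 0) (b := 1)).mono_set Ioc_subset_Icc_self
  have hm' : Measurable fun p : ℝ × ℂ => ((z - p.2 + p.1 * v)⁻¹ * v).re * F p.2 := by
    fun_prop
  refine hmain.mono' hm'.aestronglyMeasurable (Eventually.of_forall fun p => ?_)
  simp only [Function.uncurry, norm_mul]
  rw [← mul_assoc, mul_comm ‖v‖]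
  gcongr
  refine (Complex.abs_re_le_norm _).trans ?_
  rw [norm_mul, norm_inv, sub_add_eq_add_sub]

lemma logPot_add_sub {F : ℂ → ℝ} (hF : Continuous F) (hc : HasCompactSupport F) (z v : ℂ) :
    logPot F (z + v) - logPot F z = ∫ s in (0 : ℝ)..1, (cauchyPot F (z + s * v) * v).re := by
  rw [logPot_eq, logPot_eq, ← integral_sub (integrable_logPot hF hc _) (integrable_logPot hF hc _)]
  have h1 : ∀ᵐ w : ℂ, Real.log ‖z + v - w‖ * F w - Real.log ‖z - w‖ * F w =
      ∫ s in (0 : ℝ)..1, ((z - w + s * v)⁻¹ * v).re * F w := by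
    filter_upwards [ae_forall_add_mul_ne z v] with w hw
    have hd : ∀ s ∈ uIcc (0 : ℝ) 1, HasDerivAt (fun s : ℝ => Real.log ‖z - w + s * v‖)
        (((z - w + s * v)⁻¹ * v).re) s := fun s _ => hasDerivAt_log_norm_line (hw s)
    have hcont : Continuous fun s : ℝ => ((z - w + s * v)⁻¹ * v).re :=
      Complex.continuous_re.comp ((Continuous.inv₀ (by fun_prop) hw).mul continuous_const)
    rw [intervalIntegral.integral_mul_const,
      intervalIntegral.integral_eq_sub_of_hasDerivAt hd (hcont.intervalIntegrable _ _)]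
    simp only [Complex.ofReal_one, one_mul, Complex.ofReal_zero, zero_mul, add_zero]
    rw [sub_add_eq_add_sub]
    ring
  rw [integral_congr_ae h1]
  simp only [intervalIntegral.integral_of_le zero_le_one]
  rw [← integral_integral_swap (integrable_uncurry_re_inv_mul hF hc z v)]
  congr 1
  ext s
  rw [cauchyPot_eq, ← integral_mul_const]
  have h2 : Integrable fun w => (z + s * v - w)⁻¹ * (F w : ℂ) * v :=
    (integrable_cauchyPot hF hc _).mul_const v
  rw [← Complex.reCLM_apply, ← ContinuousLinearMap.integral_comp_comm _ h2]
  congr 1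
  ext w
  rw [Complex.reCLM_apply, mul_right_comm, Complex.re_mul_ofReal, sub_add_eq_add_sub]

/-- The real linear functional `v ↦ Re (q v)`. -/
def reMul : ℂ →L[ℝ] ℂ →L[ℝ] ℝ :=
  (ContinuousLinearMap.compL ℝ ℂ ℂ ℝ Complex.reCLM).comp (ContinuousLinearMap.mul ℝ ℂ)

lemma reMul_apply (q v : ℂ) : reMul q v = (q * v).re := rfl

lemma hasFDerivAt_logPot {F : ℂ → ℝ} (hF : Continuous F) (hc : HasCompactSupport F) (z : ℂ) :
    HasFDerivAt (logPot F) (reMul (cauchyPot F z)) z := by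
  rw [hasFDerivAt_iff_isLittleO_nhds_zero, Asymptotics.isLittleO_iff]
  intro ε hε
  have hQ := continuous_cauchyPot hF hc
  obtain ⟨δ, hδ, hδQ⟩ := Metric.continuousAt_iff.1 (hQ.continuousAt (x := z)) ε hε
  filter_upwards [ball_mem_nhds (0 : ℂ) hδ] with v hv
  rw [mem_ball_zero_iff] at hv
  rw [logPot_add_sub hF hc, reMul_apply]
  have h1 : ∫ s in (0 : ℝ)..1, (cauchyPot F z * v).re = (cauchyPot F z * v).re := by simp
  have hcont : Continuous fun s : ℝ => (cauchyPot F (z + s * v) * v).re := by fun_prop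
  rw [← h1, ← intervalIntegral.integral_sub (hcont.intervalIntegrable _ _) (by simp)]
  have h2 : ∀ s ∈ uIoc (0 : ℝ) 1, ‖(cauchyPot F (z + s * v) * v).re - (cauchyPot F z * v).re‖
      ≤ ε * ‖v‖ := by
    intro s hs
    rw [uIoc_of_le zero_le_one] at hs
    rw [← Complex.sub_re, ← sub_mul]
    refine (Complex.abs_re_le_norm _).trans ?_
    rw [norm_mul, ← dist_eq_norm]
    gcongr
    refine (hδQ ?_).le
    rw [dist_eq_norm, add_sub_cancel_left, norm_mul, Complex.norm_real, Real.norm_of_nonneg hs.1.le]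
    exact (mul_le_of_le_one_left (norm_nonneg _) hs.2).trans_lt hv
  simpa using intervalIntegral.norm_integral_le_of_norm_le_const h2

lemma hasFDerivAt_cauchyPot {F : ℂ → ℝ} (hF : ContDiff ℝ 1 F) (hc : HasCompactSupport F) (z : ℂ) :
    ∃ D : ℂ →L[ℝ] ℂ, HasFDerivAt (cauchyPot F) D z ∧
      ∀ v, Integrable (fun w => w⁻¹ * (fderiv ℝ F (z - w) v : ℂ)) ∧
        D v = ∫ w, w⁻¹ * (fderiv ℝ F (z - w) v : ℂ) := by
  have hFc : ContDiff ℝ 1 fun w => (F w : ℂ) := Complex.ofRealCLM.contDiff.comp hF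
  have hD : ∀ w, fderiv ℝ (fun w => (F w : ℂ)) w = Complex.ofRealCLM.comp (fderiv ℝ F w) :=
    fun w => (Complex.ofRealCLM.hasFDerivAt.comp w
      (hF.differentiable one_ne_zero w).hasFDerivAt).fderiv
  have h1 := hc.ofReal.hasFDerivAt_convolution_right (ContinuousLinearMap.mul ℝ ℂ)
    locallyIntegrable_inv hFc z
  have h2 := (hc.ofReal.fderiv ℝ).convolutionExists_right
    ((ContinuousLinearMap.mul ℝ ℂ).precompR ℂ) locallyIntegrable_inv
    (hFc.continuous_fderiv one_ne_zero) z
  have h3 : ∀ v, (fun w => ((ContinuousLinearMap.mul ℝ ℂ).precompR ℂ w⁻¹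
      (fderiv ℝ (fun w => (F w : ℂ)) (z - w))) v) =
      fun w => w⁻¹ * (fderiv ℝ F (z - w) v : ℂ) := by
    intro v
    ext w
    rw [hD]
    rfl
  refine ⟨_, h1, fun v => ⟨?_, ?_⟩⟩
  · rw [← h3]
    exact h2.integrable.apply_continuousLinearMap v
  · rw [← h3, convolution_def, ContinuousLinearMap.integral_apply h2.integrable]

lemma integral_fderiv_radial {F : ℂ → ℝ} (hF : ContDiff ℝ 1 F) (hc : HasCompactSupport F) (z : ℂ) :
    ∫ w, (w⁻¹ * ((fderiv ℝ F (z - w) 1 : ℂ) + fderiv ℝ F (z - w) Complex.I * Complex.I)).re =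
      2 * π * F z := by
  set e : ℝ → ℂ := fun θ => Real.cos θ + Real.sin θ * Complex.I with he
  have hec : Continuous e := by fun_prop
  have hen : ∀ θ, ‖e θ‖ = 1 := fun θ => by
    rw [he]
    simp only [Complex.ofReal_cos, Complex.ofReal_sin]
    rw [← Complex.exp_mul_I, Complex.norm_exp_ofReal_mul_I]
  have hF'c := hF.continuous_fderiv one_ne_zero
  set h : ℝ × ℝ → ℝ := fun p => fderiv ℝ F (z - p.1 * e p.2) (e p.2) with hh
  have hcont : Continuous h := by fun_prop
  obtain ⟨R, hR⟩ := hc.isCompact.isBounded.subset_closedBall z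
  have hsupp : ∀ r θ : ℝ, R < r → 0 < r → z - r * e θ ∉ tsupport F := by
    intro r θ hr hr0 hmem
    have := hR hmem
    rw [mem_closedBall, dist_eq_norm, sub_sub_cancel_left, norm_neg, norm_mul, hen,
      Complex.norm_real, Real.norm_of_nonneg hr0.le] at this
    linarith
  have hzero : ∀ r θ : ℝ, R < r → 0 < r → h (r, θ) = 0 := fun r θ hr hr0 => by
    have h1 : fderiv ℝ F (z - r * e θ) = 0 :=
      image_eq_zero_of_notMem_tsupport fun hm => hsupp r θ hr hr0 (tsupport_fderiv_subset ℝ hm)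
    simp [hh, h1]
  have hint : IntegrableOn h (Ioi 0 ×ˢ Ioo (-π) π) := by
    refine IntegrableOn.of_forall_sdiff_eq_zero
      (hcont.continuousOn.integrableOn_compact (K := Icc 0 R ×ˢ Icc (-π) π)
        (isCompact_Icc.prod isCompact_Icc)) (measurableSet_Ioi.prod measurableSet_Ioo) ?_
    rintro ⟨r, θ⟩ ⟨⟨hr, hθ⟩, hn⟩
    refine hzero r θ ?_ hr
    by_contra! hle
    exact hn ⟨⟨le_of_lt hr, hle⟩, Ioo_subset_Icc_self hθ⟩
  have hinner : ∀ θ, ∫ r in Ioi (0 : ℝ), h (r, θ) = F z := by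
    intro θ
    have hd : ∀ r ∈ Ici (0 : ℝ), HasDerivAt (fun r : ℝ => -F (z - r * e θ)) (h (r, θ)) r := by
      intro r _
      have h1 : HasDerivAt (fun r : ℝ => z - r * e θ) (-e θ) r := by
        simpa using (((Complex.ofRealCLM.hasDerivAt (x := r)).mul_const (e θ)).const_sub z)
      have h2 := ((hF.differentiable one_ne_zero (z - r * e θ)).hasFDerivAt.comp_hasDerivAt r h1).neg
      rw [map_neg, neg_neg] at h2
      exact h2
    have hi : IntegrableOn (fun r => h (r, θ)) (Ioi 0) := by
      refine IntegrableOn.of_forall_sdiff_eq_zero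
        ((hcont.comp (by fun_prop : Continuous fun r : ℝ => (r, θ))).integrableOn_Icc
          (a := 0) (b := R)) measurableSet_Ioi fun r hr => ?_
      refine hzero r θ ?_ hr.1
      by_contra! hle
      exact hr.2 ⟨le_of_lt hr.1, hle⟩
    have ht : Tendsto (fun r : ℝ => -F (z - r * e θ)) atTop (𝓝 0) := by
      refine tendsto_const_nhds.congr' ?_
      filter_upwards [eventually_gt_atTop R, eventually_gt_atTop 0] with r h1 h2
      rw [image_eq_zero_of_notMem_tsupport (hsupp r θ h1 h2), neg_zero]
    rw [integral_Ioi_of_hasDerivAt_of_tendsto' hd hi ht]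
    simp
  rw [← Complex.integral_comp_polarCoord_symm]
  have hcongr : ∫ p in polarCoord.target, p.1 • ((Complex.polarCoord.symm p)⁻¹ *
      ((fderiv ℝ F (z - Complex.polarCoord.symm p) 1 : ℂ) +
        fderiv ℝ F (z - Complex.polarCoord.symm p) Complex.I * Complex.I)).re =
      ∫ p in Ioi (0 : ℝ) ×ˢ Ioo (-π) π, h p := by
    refine setIntegral_congr_fun (measurableSet_Ioi.prod measurableSet_Ioo) ?_
    rintro ⟨r, θ⟩ ⟨hr, -⟩
    have hr' : r ≠ 0 := ne_of_gt hr
    have h1 : fderiv ℝ F (z - r * e θ) (e θ) = Real.cos θ * fderiv ℝ F (z - r * e θ) 1 +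
        Real.sin θ * fderiv ℝ F (z - r * e θ) Complex.I := by
      have hlin : ∀ T : ℂ →L[ℝ] ℝ,
          T (e θ) = Real.cos θ * T 1 + Real.sin θ * T Complex.I := fun T => by
        rw [show e θ = Real.cos θ • (1 : ℂ) + Real.sin θ • Complex.I by simp [he],
          map_add, map_smul, map_smul, smul_eq_mul, smul_eq_mul]
      exact hlin _
    have h2 : (e θ)⁻¹ = Real.cos θ - Real.sin θ * Complex.I := by
      rw [Complex.inv_def, Complex.normSq_eq_norm_sq, hen]
      simp only [he, map_add, map_mul, Complex.conj_ofReal, Complex.conj_I]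
      push_cast
      ring
    simp only [Complex.polarCoord_symm_apply, hh]
    rw [h1]
    change r • (((r : ℂ) * e θ)⁻¹ * _).re = _
    rw [mul_inv, h2, ← Complex.ofReal_inv]
    set a := fderiv ℝ F (z - r * e θ) 1
    set b := fderiv ℝ F (z - r * e θ) Complex.I
    change r • (((r⁻¹ : ℝ) : ℂ) * (Real.cos θ - Real.sin θ * Complex.I) *
      ((a : ℂ) + b * Complex.I)).re = _
    rw [mul_assoc, Complex.re_ofReal_mul, smul_eq_mul, mul_inv_cancel_left₀ hr']
    simp only [Complex.mul_re, Complex.mul_im, Complex.sub_re, Complex.sub_im, Complex.add_re,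
      Complex.add_im, Complex.ofReal_re, Complex.ofReal_im, Complex.I_re, Complex.I_im]
    ring
  rw [hcongr, Measure.volume_eq_prod, ← Measure.prod_restrict, integral_prod_symm]
  · simp only [hinner]
    simp
    left
    rw [max_eq_left (by positivity)]
    ring
  · rw [Measure.prod_restrict]
    exact hint

lemma contDiff_logPot {F : ℂ → ℝ} (hF : ContDiff ℝ 1 F) (hc : HasCompactSupport F) :
    ContDiff ℝ 2 (logPot F) := by
  have hQ : ContDiff ℝ 1 (cauchyPot F) :=
    hc.ofReal.contDiff_convolution_right (n := 1) (ContinuousLinearMap.mul ℝ ℂ)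
      locallyIntegrable_inv (Complex.ofRealCLM.contDiff.comp hF)
  rw [show (2 : WithTop ℕ∞) = ((1 : ℕ) : WithTop ℕ∞) + 1 by norm_num,
    contDiff_succ_iff_hasFDerivAt]
  exact ⟨fun z => reMul (cauchyPot F z), reMul.contDiff.comp (by exact_mod_cast hQ),
    hasFDerivAt_logPot hF.continuous hc⟩

open InnerProductSpace in
lemma laplacian_eq_of_hasFDerivAt {U : ℂ → ℝ} {Q : ℂ → ℂ} {D : ℂ →L[ℝ] ℂ} {z : ℂ}
    (hU : ∀ᶠ w in 𝓝 z, HasFDerivAt U (reMul (Q w)) w) (hQ : HasFDerivAt Q D z) :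
    Laplacian.laplacian U z = (D 1 + D Complex.I * Complex.I).re := by
  have h1 : fderiv ℝ U =ᶠ[𝓝 z] fun w => reMul (Q w) := hU.mono fun w hw => hw.fderiv
  have h2 : fderiv ℝ (fderiv ℝ U) z = reMul.comp D := by
    rw [h1.fderiv_eq]
    exact (reMul.hasFDerivAt.comp z hQ).fderiv
  rw [laplacian_eq_iteratedFDeriv_complexPlane]
  simp only [iteratedFDeriv_two_apply, h2]
  simp [reMul_apply]

lemma laplacian_logPot {F : ℂ → ℝ} (hF : ContDiff ℝ 1 F) (hc : HasCompactSupport F) (z : ℂ) :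
    Laplacian.laplacian (logPot F) z = 2 * π * F z := by
  obtain ⟨D, hD, hDv⟩ := hasFDerivAt_cauchyPot hF hc z
  rw [laplacian_eq_of_hasFDerivAt (Eventually.of_forall (hasFDerivAt_logPot hF.continuous hc)) hD,
    ← integral_fderiv_radial hF hc z, (hDv 1).2, (hDv Complex.I).2, ← integral_mul_const,
    ← integral_add (hDv 1).1 ((hDv Complex.I).1.mul_const _)]
  have hi : Integrable fun w => w⁻¹ * (fderiv ℝ F (z - w) 1 : ℂ) +
      w⁻¹ * (fderiv ℝ F (z - w) Complex.I : ℂ) * Complex.I :=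
    (hDv 1).1.add ((hDv Complex.I).1.mul_const _)
  rw [← Complex.reCLM_apply, ← ContinuousLinearMap.integral_comp_comm _ hi]
  congr 1
  ext w
  rw [Complex.reCLM_apply]
  congr 1
  ring

/-! ### The Green operator of a bounded simply connected domain -/

/-- `φ` is a biholomorphism of the bounded open set `U` onto the unit disc, with inverse `ψ`. -/
structure IsRiemannMap (U : Set ℂ) (φ ψ : ℂ → ℂ) : Prop where
  isOpen : IsOpen U
  isBounded : Bornology.IsBounded U
  diff : DifferentiableOn ℂ φ U
  diff_inv : DifferentiableOn ℂ ψ (ball 0 1)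
  mapsTo : MapsTo φ U (ball 0 1)
  mapsTo_inv : MapsTo ψ (ball 0 1) U
  left_inv : ∀ z ∈ U, ψ (φ z) = z
  right_inv : ∀ w ∈ ball (0 : ℂ) 1, φ (ψ w) = w
  deriv_ne : ∀ z ∈ U, deriv φ z ≠ 0

/-- The Green function `-2π G(z, w)` normalised to have singularity `-log ‖z - w‖`. -/
def green (φ : ℂ → ℂ) (z w : ℂ) : ℝ := -Real.log ‖moebius (φ w) (φ z)‖

/-- The solution operator of `-Δu = f` with zero boundary values. -/
def greenOp (U : Set ℂ) (φ : ℂ → ℂ) (f : ℂ → ℝ) (z : ℂ) : ℝ :=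
  (2 * π)⁻¹ * ∫ w in U, green φ z w * f w

namespace IsRiemannMap

variable {U : Set ℂ} {φ ψ : ℂ → ℂ}

lemma norm_lt_one (h : IsRiemannMap U φ ψ) {z : ℂ} (hz : z ∈ U) : ‖φ z‖ < 1 := by
  simpa using h.mapsTo hz

lemma green_nonneg (h : IsRiemannMap U φ ψ) {z w : ℂ} (hz : z ∈ U) (hw : w ∈ U) :
    0 ≤ green φ z w :=
  neg_nonneg.2 (Real.log_nonpos (norm_nonneg _)
    (norm_moebius_lt_one (h.norm_lt_one hw) (h.norm_lt_one hz)).le)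

lemma exists_dslope_bounds (h : IsRiemannMap U φ ψ) {z₀ : ℂ} (hz₀ : z₀ ∈ U) :
    ∃ ρ > 0, ∃ m > 0, ∃ M : ℝ, ball z₀ ρ ⊆ U ∧
      ∀ z ∈ ball z₀ ρ, ∀ w ∈ U, m ≤ ‖dslope φ w z‖ ∧ ‖dslope φ w z‖ ≤ M := by
  have hU := h.isOpen.mem_nhds hz₀
  set a := deriv φ z₀ with ha
  have ha0 : 0 < ‖a‖ := norm_pos_iff.2 (h.deriv_ne z₀ hz₀)
  have hstrict : HasStrictDerivAt φ a z₀ := (h.diff.analyticAt hU).hasStrictDerivAt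
  have h1 := hstrict.isLittleO.def (half_pos ha0)
  rw [nhds_prod_eq] at h1
  obtain ⟨t, ht, h1⟩ := Filter.mem_prod_self_iff.1 h1
  obtain ⟨s, hs, hst⟩ := Metric.mem_nhds_iff.1 (inter_mem ht hU)
  have hslope : ∀ z ∈ ball z₀ s, ∀ w ∈ ball z₀ s, z ≠ w →
      ‖a‖ / 2 ≤ ‖dslope φ w z‖ ∧ ‖dslope φ w z‖ ≤ 2 * ‖a‖ := by
    intro z hz w hw hzw
    have h2 : ‖φ z - φ w - ContinuousLinearMap.toSpanSingleton ℂ a (z - w)‖ ≤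
        ‖a‖ / 2 * ‖z - w‖ := h1 (mk_mem_prod (hst hz).1 (hst hw).1)
    have h0 : 0 < ‖z - w‖ := norm_pos_iff.2 (sub_ne_zero.2 hzw)
    have h3 : ‖dslope φ w z - a‖ ≤ ‖a‖ / 2 := by
      rw [dslope_of_ne _ hzw, slope_def_field]
      have h4 : (φ z - φ w) / (z - w) - a = (φ z - φ w - (z - w) * a) / (z - w) := by
        field_simp [sub_ne_zero.2 hzw]
      rw [h4, norm_div, div_le_iff₀ h0]
      simpa using h2
    have h5 := norm_sub_norm_le a (dslope φ w z)
    have h6 := norm_sub_norm_le (dslope φ w z) a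
    rw [norm_sub_rev] at h5
    constructor <;> linarith
  have hslope' : ∀ z ∈ ball z₀ s, ∀ w ∈ ball z₀ s,
      ‖a‖ / 2 ≤ ‖dslope φ w z‖ ∧ ‖dslope φ w z‖ ≤ 2 * ‖a‖ := by
    intro z hz w hw
    rcases ne_or_eq z w with hzw | rfl
    · exact hslope z hz w hw hzw
    have hc : Tendsto (fun y => ‖dslope φ z y‖) (𝓝[≠] z) (𝓝 ‖dslope φ z z‖) :=
      ((continuousAt_dslope_same.2 (h.diff.differentiableAt
        (h.isOpen.mem_nhds (hst hz).2))).norm.tendsto).mono_left nhdsWithin_le_nhds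
    have hev : ∀ᶠ y in 𝓝[≠] z, y ∈ ball z₀ s ∧ y ≠ z :=
      inter_mem (mem_nhdsWithin_of_mem_nhds (isOpen_ball.mem_nhds hz)) self_mem_nhdsWithin
    exact ⟨ge_of_tendsto hc (hev.mono fun y hy => (hslope y hy.1 z hz hy.2).1),
      le_of_tendsto hc (hev.mono fun y hy => (hslope y hy.1 z hz hy.2).2)⟩
  obtain ⟨ε, hε, hψ⟩ := Metric.continuousAt_iff.1
    (h.diff_inv.differentiableAt (isOpen_ball.mem_nhds (h.mapsTo hz₀))).continuousAt s hs
  rw [h.left_inv z₀ hz₀] at hψ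
  obtain ⟨η, hη, hφ⟩ := Metric.continuousAt_iff.1
    (h.diff.differentiableAt hU).continuousAt (ε / 2) (half_pos hε)
  obtain ⟨D, hD0, hD⟩ := h.isBounded.exists_pos_norm_le
  refine ⟨min η (s / 2), lt_min hη (half_pos hs), min (‖a‖ / 2) (ε / 2 / (D + D)),
    lt_min (half_pos ha0) (by positivity), max (2 * ‖a‖) (2 / (s / 2)), fun z hz =>
      (hst (ball_subset_ball ((min_le_right _ _).trans (half_le_self hs.le)) hz)).2, ?_⟩
  intro z hz w hw
  have hzs : z ∈ ball z₀ (s / 2) := ball_subset_ball (min_le_right _ _) hz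
  have hzs' : z ∈ ball z₀ s := ball_subset_ball (half_le_self hs.le) hzs
  have hzη : z ∈ ball z₀ η := ball_subset_ball (min_le_left _ _) hz
  by_cases hws : w ∈ ball z₀ s
  · exact ⟨(min_le_left _ _).trans (hslope' z hzs' w hws).1,
      (hslope' z hzs' w hws).2.trans (le_max_left _ _)⟩
  have hd : s / 2 ≤ ‖z - w‖ := by
    rw [mem_ball, not_lt] at hws
    rw [mem_ball] at hzs
    have := dist_triangle w z z₀
    rw [← dist_eq_norm, dist_comm]
    linarith
  have hzw : z ≠ w := by
    rintro rfl
    exact hws hzs'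
  have h0 : 0 < ‖z - w‖ := by linarith [half_pos hs]
  have hd' : ‖z - w‖ ≤ D + D :=
    (norm_sub_le _ _).trans (add_le_add (hD z (hst hzs').2) (hD w hw))
  have hφd : ε / 2 ≤ ‖φ z - φ w‖ := by
    by_contra! hlt
    refine hws ?_
    rw [mem_ball, ← h.left_inv w hw]
    apply hψ
    have h1 := hφ hzη
    have h2 := dist_triangle (φ w) (φ z) (φ z₀)
    rw [← dist_eq_norm, dist_comm] at hlt
    linarith
  have hφu : ‖φ z - φ w‖ ≤ 2 := by
    have := norm_sub_le (φ z) (φ w)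
    linarith [h.norm_lt_one hw, h.norm_lt_one (hst hzs').2]
  rw [dslope_of_ne _ hzw, slope_def_field, norm_div]
  refine ⟨(min_le_right _ _).trans ?_, le_trans ?_ (le_max_right _ _)⟩
  · gcongr
  · gcongr

/-- Near an interior point the Green function is the logarithmic kernel plus a harmonic function. -/
lemma green_eq (h : IsRiemannMap U φ ψ) {z w : ℂ} (hz : z ∈ U) (hw : w ∈ U) (hzw : z ≠ w) :
    green φ z w = Real.log ‖(1 - conj (φ w) * φ z) / dslope φ w z‖ - Real.log ‖z - w‖ := by
  have h1 := norm_ne_zero_iff.2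
    (one_sub_conj_mul_ne_zero (h.norm_lt_one hw) (h.norm_lt_one hz))
  have h2 : φ z - φ w ≠ 0 := fun h0 => hzw <| by
    rw [← h.left_inv z hz, ← h.left_inv w hw, sub_eq_zero.1 h0]
  have h3 := sub_ne_zero.2 hzw
  rw [green, moebius, dslope_of_ne _ hzw, slope_def_field, norm_div, norm_div, norm_div,
    Real.log_div (norm_ne_zero_iff.2 h2) h1, Real.log_div h1 (by positivity),
    Real.log_div (norm_ne_zero_iff.2 h2) (norm_ne_zero_iff.2 h3)]
  ring

lemma aestronglyMeasurable (h : IsRiemannMap U φ ψ) :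
    AEStronglyMeasurable φ (volume.restrict U) :=
  h.diff.continuousOn.aestronglyMeasurable h.isOpen.measurableSet

lemma aestronglyMeasurable_dslope (h : IsRiemannMap U φ ψ) (z : ℂ) :
    AEStronglyMeasurable (fun w => dslope φ w z) (volume.restrict U) := by
  have h1 : AEStronglyMeasurable (fun w => (φ z - φ w) / (z - w)) (volume.restrict U) :=
    ((h.aestronglyMeasurable.aemeasurable.const_sub (φ z)).div
      (measurable_id.const_sub z).aemeasurable).aestronglyMeasurable
  refine h1.congr ?_
  have : ∀ᵐ w : ℂ ∂(volume.restrict U), w ≠ z := ae_restrict_of_ae (Measure.ae_ne volume z)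
  filter_upwards [this] with w hw
  rw [dslope_of_ne _ hw.symm, slope_def_field]

lemma aestronglyMeasurable_green (h : IsRiemannMap U φ ψ) (z : ℂ) :
    AEStronglyMeasurable (fun w => green φ z w) (volume.restrict U) := by
  have h1 : AEMeasurable (fun w => moebius (φ w) (φ z)) (volume.restrict U) := by
    have := h.aestronglyMeasurable.aemeasurable
    unfold moebius
    fun_prop
  exact (Real.measurable_log.comp_aemeasurable h1.norm).neg.aestronglyMeasurable

/-- The part of the Green operator left after removing the logarithmic kernel is harmonic. -/
lemma harmonicAt_regular_part (h : IsRiemannMap U φ ψ) {f : ℂ → ℝ} (hf : IntegrableOn f U) {z₀ : ℂ}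
    (hz₀ : z₀ ∈ U) : InnerProductSpace.HarmonicAt
      (fun z => ∫ w in U, Real.log ‖(1 - conj (φ w) * φ z) / dslope φ w z‖ * f w) z₀ ∧
      ∀ᶠ z in 𝓝 z₀, IntegrableOn
        (fun w => Real.log ‖(1 - conj (φ w) * φ z) / dslope φ w z‖ * f w) U := by
  obtain ⟨ρ, hρ, m, hm, M, hsub, hb⟩ := h.exists_dslope_bounds hz₀
  obtain ⟨q, hq, hq1⟩ := exists_between (h.norm_lt_one hz₀)
  have hcont : ContinuousAt (fun z => ‖φ z‖) z₀ :=
    (h.diff.differentiableAt (h.isOpen.mem_nhds hz₀)).continuousAt.norm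
  obtain ⟨η, hη, hφ⟩ := Metric.mem_nhds_iff.1 (hcont.eventually (gt_mem_nhds hq))
  have hM : 0 < M := lt_of_lt_of_le hm
    ((hb z₀ (mem_ball_self hρ) z₀ hz₀).1.trans (hb z₀ (mem_ball_self hρ) z₀ hz₀).2)
  have hbound : ∀ z ∈ ball z₀ (min ρ η), ∀ w ∈ U,
      (1 - q) / M ≤ ‖(1 - conj (φ w) * φ z) / dslope φ w z‖ ∧
      ‖(1 - conj (φ w) * φ z) / dslope φ w z‖ ≤ 2 / m := by
    intro z hz w hw
    have hzρ := ball_subset_ball (min_le_left _ _) hz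
    have hzη : ‖φ z‖ < q := hφ (ball_subset_ball (min_le_right _ _) hz)
    have hb1 := hb z hzρ w hw
    have hw1 := h.norm_lt_one hw
    have hmul : ‖conj (φ w) * φ z‖ ≤ q := by
      rw [norm_mul, RCLike.norm_conj]
      nlinarith [norm_nonneg (φ z), norm_nonneg (φ w)]
    have hlow : 1 - q ≤ ‖1 - conj (φ w) * φ z‖ := by
      have := norm_sub_norm_le 1 (conj (φ w) * φ z)
      rw [norm_one] at this
      linarith
    have hup : ‖1 - conj (φ w) * φ z‖ ≤ 2 := by
      have := norm_sub_le 1 (conj (φ w) * φ z)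
      rw [norm_one] at this
      linarith
    have hpos : 0 < ‖dslope φ w z‖ := hm.trans_le hb1.1
    rw [norm_div]
    constructor
    · exact div_le_div₀ (norm_nonneg _) hlow hpos hb1.2
    · exact div_le_div₀ zero_le_two hup hm hb1.1
  have hmeas : ∀ z, AEStronglyMeasurable (fun w => (1 - conj (φ w) * φ z) / dslope φ w z)
      (volume.restrict U) := fun z => by
    have h1 : AEStronglyMeasurable (fun w => conj (φ w)) (volume.restrict U) :=
      Complex.continuous_conj.comp_aestronglyMeasurable h.aestronglyMeasurable
    exact ((h1.aemeasurable.mul_const (φ z)).const_sub 1).div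
      (h.aestronglyMeasurable_dslope z).aemeasurable |>.aestronglyMeasurable
  have hmem : ∀ᵐ w ∂(volume.restrict U), w ∈ U := ae_restrict_mem h.isOpen.measurableSet
  constructor
  · refine harmonicAt_integral_log_norm (lt_min hρ hη)
      (div_pos (sub_pos.2 hq1) hM) (M := 2 / m) (fun z _ => hmeas z) ?_ ?_ ?_ hf
    · filter_upwards [hmem] with w hw
      have hsub' := (ball_subset_ball (min_le_left ρ η)).trans hsub
      refine DifferentiableOn.div ?_ (DifferentiableOn.mono ?_ hsub') fun z hz => ?_
      · exact ((h.diff.mono hsub').const_mul _).const_sub _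
      · exact (Complex.differentiableOn_dslope (h.isOpen.mem_nhds hw)).2 h.diff
      · exact norm_pos_iff.1 (hm.trans_le (hb z (ball_subset_ball (min_le_left _ _) hz) w hw).1)
    · filter_upwards [hmem] with w hw z hz using (hbound z hz w hw).1
    · filter_upwards [hmem] with w hw z hz using (hbound z hz w hw).2
  · filter_upwards [ball_mem_nhds z₀ (lt_min hρ hη)] with z hz
    refine hf.bdd_mul (c := max |Real.log (2 / m)| |Real.log ((1 - q) / M)|)
      (Real.measurable_log.comp_aemeasurable (hmeas z).aemeasurable.norm).aestronglyMeasurable ?_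
    filter_upwards [hmem] with w hw
    obtain ⟨h1, h2⟩ := hbound z hz w hw
    have h0 := div_pos (sub_pos.2 hq1) hM
    rw [Real.norm_eq_abs, max_comm]
    exact abs_le_max_abs_abs (Real.log_le_log h0 h1) (Real.log_le_log (h0.trans_le h1) h2)

end IsRiemannMap

lemma integrable_indicator_norm_inv_sub (R : ℝ) (z : ℂ) :
    Integrable fun w => (ball (0 : ℂ) R).indicator (fun v => ‖v‖⁻¹) (z - w) :=
  ((integrableOn_ball_norm_inv R).integrable_indicator measurableSet_ball).comp_sub_left z

lemma tendsto_integral_ball_norm_inv :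
    Tendsto (fun δ : ℝ => ∫ v, (ball (0 : ℂ) δ).indicator (fun v => ‖v‖⁻¹) v) (𝓝[>] 0) (𝓝 0) := by
  have hlim : ∀ v : ℂ, Tendsto (fun δ : ℝ => (ball (0 : ℂ) δ).indicator (fun v => ‖v‖⁻¹) v)
      (𝓝[>] 0) (𝓝 0) := by
    intro v
    rcases eq_or_ne v 0 with rfl | hv
    · refine tendsto_const_nhds.congr fun δ => ?_
      by_cases h : (0 : ℂ) ∈ ball (0 : ℂ) δ
      · rw [indicator_of_mem h, norm_zero, inv_zero]
      · rw [indicator_of_notMem h]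
    · refine tendsto_const_nhds.congr' ?_
      filter_upwards [mem_nhdsWithin_of_mem_nhds (Iio_mem_nhds (norm_pos_iff.2 hv))] with δ hδ
      rw [indicator_of_notMem]
      rw [mem_ball_zero_iff, not_lt]
      exact le_of_lt hδ
  have h := tendsto_integral_filter_of_dominated_convergence
    (μ := (volume : Measure ℂ)) (l := 𝓝[>] (0 : ℝ))
    (F := fun δ => (ball (0 : ℂ) δ).indicator fun v => ‖v‖⁻¹) (f := fun _ => (0 : ℝ))
    ((ball (0 : ℂ) 1).indicator fun v => ‖v‖⁻¹)
    (Eventually.of_forall fun δ =>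
      ((integrableOn_ball_norm_inv δ).integrable_indicator measurableSet_ball).1) ?_
    ((integrableOn_ball_norm_inv 1).integrable_indicator measurableSet_ball)
    (Eventually.of_forall hlim)
  · simpa using h
  · filter_upwards [mem_nhdsWithin_of_mem_nhds (Iio_mem_nhds one_pos)] with δ hδ
    refine Eventually.of_forall fun v => ?_
    rw [Real.norm_of_nonneg (indicator_nonneg (fun _ _ => by positivity) _)]
    exact indicator_le_indicator_of_subset (ball_subset_ball (le_of_lt hδ))
      (fun _ => by positivity) v

namespace IsRiemannMap

variable {U : Set ℂ} {φ ψ : ℂ → ℂ}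

lemma exists_green_le (h : IsRiemannMap U φ ψ) :
    ∃ D > 0, (∀ z ∈ U, ∀ w ∈ U, ‖z - w‖ < D) ∧
      ∀ z ∈ U, ∀ w ∈ U, z ≠ w → green φ z w ≤ D * ‖z - w‖⁻¹ := by
  obtain ⟨C, hC0, hC⟩ := h.isBounded.exists_pos_norm_le
  have hdiam : ∀ z ∈ U, ∀ w ∈ U, ‖z - w‖ < C + C + 1 := fun z hz w hw => by
    have := norm_sub_le z w
    linarith [hC z hz, hC w hw]
  refine ⟨C + C + 1, by positivity, hdiam, fun z hz w hw hzw => ?_⟩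
  set D := C + C + 1
  have hw1 := h.norm_lt_one hw
  have hw1' : ‖-φ w‖ < 1 := by rwa [norm_neg]
  have hz1 := h.norm_lt_one hz
  set F : ℂ → ℂ := fun v => ψ (moebius (-φ w) v) with hF
  have hF0 : F 0 = w := by
    simp only [hF, moebius_zero_right, neg_neg]
    exact h.left_inv w hw
  have hmaps : MapsTo (moebius (-φ w)) (ball 0 1) (ball 0 1) := fun v hv => by
    rw [mem_ball_zero_iff] at hv ⊢
    exact norm_moebius_lt_one hw1' hv
  have hd : DifferentiableOn ℂ F (ball 0 1) := by
    refine h.diff_inv.comp (fun v hv => ?_) hmaps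
    exact (hasDerivAt_moebius hw1' (by simpa using hv)).differentiableAt.differentiableWithinAt
  have hm : MapsTo F (ball 0 1) (closedBall (F 0) D) := fun v hv => by
    rw [hF0, mem_closedBall, dist_eq_norm]
    exact (hdiam _ (h.mapsTo_inv (hmaps hv)) _ hw).le
  have hv := norm_moebius_lt_one hw1 hz1
  have key := Complex.dist_le_div_mul_dist_of_mapsTo_ball hd hm
    (z := moebius (φ w) (φ z)) (by simpa using hv)
  rw [hF0, div_one, dist_zero_right, hF] at key
  simp only [moebius_neg_moebius hw1 hz1, h.left_inv z hz, dist_eq_norm] at key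
  have h0 : 0 < ‖z - w‖ := norm_pos_iff.2 (sub_ne_zero.2 hzw)
  have hm0 : 0 < ‖moebius (φ w) (φ z)‖ := by
    by_contra! hle
    have : ‖moebius (φ w) (φ z)‖ = 0 := le_antisymm hle (norm_nonneg _)
    rw [this, mul_zero] at key
    linarith
  rw [green, ← Real.log_inv]
  refine (Real.log_le_self (by positivity)).trans ?_
  rw [inv_le_iff_one_le_mul₀ hm0, ← div_eq_mul_inv, mul_comm, ← mul_div_assoc, one_le_div h0,
    mul_comm]
  exact key

lemma ae_green_le (h : IsRiemannMap U φ ψ) :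
    ∃ D > 0, ∀ z ∈ U, ∀ᵐ w ∂(volume.restrict U), w ∈ U ∧ 0 ≤ green φ z w ∧
      green φ z w ≤ D * (ball (0 : ℂ) D).indicator (fun v => ‖v‖⁻¹) (z - w) := by
  obtain ⟨D, hD, hdiam, hle⟩ := h.exists_green_le
  refine ⟨D, hD, fun z hz => ?_⟩
  filter_upwards [ae_restrict_mem h.isOpen.measurableSet,
    ae_restrict_of_ae (Measure.ae_ne volume z)] with w hw hne
  refine ⟨hw, h.green_nonneg hz hw, ?_⟩
  rw [indicator_of_mem (by rw [mem_ball_zero_iff]; exact hdiam z hz w hw)]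
  exact hle z hz w hw hne.symm

lemma integrableOn_green (h : IsRiemannMap U φ ψ) {z : ℂ} (hz : z ∈ U) :
    IntegrableOn (green φ z) U := by
  obtain ⟨D, hD, hle⟩ := h.ae_green_le
  refine (((integrable_indicator_norm_inv_sub D z).const_mul D).integrableOn).mono'
    (h.aestronglyMeasurable_green z) ?_
  filter_upwards [hle z hz] with w hw
  rw [Real.norm_of_nonneg hw.2.1]
  exact hw.2.2

lemma integrableOn_green_mul (h : IsRiemannMap U φ ψ) {z : ℂ} (hz : z ∈ U) {f : ℂ → ℝ} {M : ℝ}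
    (hf : ContinuousOn f U) (hM : ∀ w ∈ U, |f w| ≤ M) :
    IntegrableOn (fun w => green φ z w * f w) U :=
  (h.integrableOn_green hz).mul_bdd (c := M) (hf.aestronglyMeasurable h.isOpen.measurableSet)
    ((ae_restrict_mem h.isOpen.measurableSet).mono hM)

lemma tendsto_norm_frontier (h : IsRiemannMap U φ ψ) {ζ : ℂ} (hζ : ζ ∈ frontier U) :
    Tendsto (fun z => ‖φ z‖) (𝓝[U] ζ) (𝓝 1) := by
  have hζU : ζ ∉ U := by
    rw [h.isOpen.frontier_eq] at hζ
    exact hζ.2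
  refine tendsto_order.2 ⟨fun r hr => ?_, fun r hr => ?_⟩
  · have hsub : closedBall (0 : ℂ) r ⊆ ball 0 1 := closedBall_subset_ball hr
    have hK : IsCompact (ψ '' closedBall 0 r) :=
      (isCompact_closedBall _ _).image_of_continuousOn (h.diff_inv.continuousOn.mono hsub)
    have hmem : (ψ '' closedBall 0 r)ᶜ ∈ 𝓝 ζ := by
      refine hK.isClosed.isOpen_compl.mem_nhds ?_
      rintro ⟨v, hv, rfl⟩
      exact hζU (h.mapsTo_inv (hsub hv))
    filter_upwards [mem_nhdsWithin_of_mem_nhds hmem, self_mem_nhdsWithin] with z hz hzU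
    by_contra! hle
    exact hz ⟨φ z, by simpa using hle, h.left_inv z hzU⟩
  · filter_upwards [self_mem_nhdsWithin] with z hzU
    exact (h.norm_lt_one hzU).trans hr

lemma tendsto_green_frontier (h : IsRiemannMap U φ ψ) {ζ w : ℂ} (hζ : ζ ∈ frontier U)
    (hw : w ∈ U) : Tendsto (fun z => green φ z w) (𝓝[U] ζ) (𝓝 0) := by
  have hw1 := h.norm_lt_one hw
  have h1 : Tendsto (fun z => 1 - (1 - ‖φ z‖ ^ 2) / (1 - ‖φ w‖) ^ 2) (𝓝[U] ζ) (𝓝 1) := by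
    have := (((h.tendsto_norm_frontier hζ).pow 2).const_sub 1).div_const ((1 - ‖φ w‖) ^ 2)
    simpa using this.const_sub 1
  have h2 : Tendsto (fun z => ‖moebius (φ w) (φ z)‖ ^ 2) (𝓝[U] ζ) (𝓝 1) := by
    refine tendsto_of_tendsto_of_tendsto_of_le_of_le' h1 tendsto_const_nhds ?_ ?_
    · filter_upwards [self_mem_nhdsWithin] with z hz
      have hz1 := h.norm_lt_one hz
      have hid := norm_sq_one_sub_conj_mul (φ w) (φ z)
      have hlow : 1 - ‖φ w‖ ≤ ‖1 - conj (φ w) * φ z‖ := by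
        have h3 := norm_sub_norm_le 1 (conj (φ w) * φ z)
        rw [norm_one, norm_mul, RCLike.norm_conj] at h3
        nlinarith [norm_nonneg (φ w)]
      have hpos : 0 < 1 - ‖φ w‖ := by linarith
      have hpos' : 0 < ‖1 - conj (φ w) * φ z‖ := hpos.trans_le hlow
      have hn : 0 ≤ 1 - ‖φ z‖ ^ 2 := by nlinarith [norm_nonneg (φ z)]
      have heq : ‖moebius (φ w) (φ z)‖ ^ 2 =
          1 - (1 - ‖φ w‖ ^ 2) * (1 - ‖φ z‖ ^ 2) / ‖1 - conj (φ w) * φ z‖ ^ 2 := by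
        rw [moebius, norm_div, ← hid, div_pow, sub_div, div_self (by positivity)]
        ring
      rw [heq]
      have : (1 - ‖φ w‖ ^ 2) * (1 - ‖φ z‖ ^ 2) ≤ 1 - ‖φ z‖ ^ 2 := by
        nlinarith [sq_nonneg ‖φ w‖]
      gcongr
    · filter_upwards [self_mem_nhdsWithin] with z hz
      exact pow_le_one₀ (norm_nonneg _) (norm_moebius_lt_one hw1 (h.norm_lt_one hz)).le
  have h3 := ((Real.continuousAt_log one_ne_zero).tendsto.comp h2).div_const (-2)
  rw [Real.log_one, zero_div] at h3
  refine h3.congr fun z => ?_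
  rw [Function.comp, Real.log_pow, green]
  push_cast
  ring

lemma tendsto_integral_green (h : IsRiemannMap U φ ψ) {ζ : ℂ} (hζ : ζ ∈ frontier U) :
    Tendsto (fun z => ∫ w in U, green φ z w) (𝓝[U] ζ) (𝓝 0) := by
  obtain ⟨D, hD, hle⟩ := h.ae_green_le
  have hnn : ∀ z ∈ U, 0 ≤ ∫ w in U, green φ z w := fun z hz =>
    setIntegral_nonneg h.isOpen.measurableSet fun w hw => h.green_nonneg hz hw
  rw [Metric.tendsto_nhds]
  intro ε hε
  obtain ⟨δ, hδε, hδ0 : 0 < δ⟩ := ((((tendsto_integral_ball_norm_inv.const_mul D).eventually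
    (gt_mem_nhds (by simpa using half_pos hε : D * 0 < ε / 2))).and self_mem_nhdsWithin).exists)
  have : IsFiniteMeasure (volume.restrict U) :=
    isFiniteMeasure_restrict.2 h.isBounded.measure_lt_top.ne
  have hmeas : ∀ z : ℂ, MeasurableSet (ball z δ)ᶜ := fun z => measurableSet_ball.compl
  have hfar : Tendsto (fun z => ∫ w in U, (ball z δ)ᶜ.indicator (green φ z) w) (𝓝[U] ζ)
      (𝓝 (∫ w in U, (0 : ℝ))) := by
    refine tendsto_integral_filter_of_dominated_convergence (fun _ => D * δ⁻¹)
      (Eventually.of_forall fun z => (h.aestronglyMeasurable_green z).indicator (hmeas z)) ?_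
      (integrable_const _) ?_
    · filter_upwards [self_mem_nhdsWithin] with z hz
      filter_upwards [hle z hz] with w ⟨hw, h0, h1⟩
      by_cases hwδ : w ∈ (ball z δ)ᶜ
      · rw [indicator_of_mem hwδ, Real.norm_of_nonneg h0]
        refine h1.trans (mul_le_mul_of_nonneg_left ?_ hD.le)
        refine indicator_apply_le' (fun _ => ?_) (fun _ => by positivity)
        rw [mem_compl_iff, mem_ball, not_lt, dist_comm, dist_eq_norm] at hwδ
        exact inv_anti₀ hδ0 hwδ
      · rw [indicator_of_notMem hwδ, norm_zero]
        positivity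
    · filter_upwards [ae_restrict_mem h.isOpen.measurableSet] with w hw
      refine squeeze_zero' ?_ ?_ (h.tendsto_green_frontier hζ hw)
      · filter_upwards [self_mem_nhdsWithin] with z hz
        exact indicator_apply_nonneg fun _ => h.green_nonneg hz hw
      · filter_upwards [self_mem_nhdsWithin] with z hz
        exact indicator_apply_le' (fun _ => le_rfl) fun _ => h.green_nonneg hz hw
  rw [integral_zero] at hfar
  filter_upwards [hfar.eventually (gt_mem_nhds (half_pos hε)), self_mem_nhdsWithin] with z hz hzU
  rw [Real.dist_0_eq_abs, abs_of_nonneg (hnn z hzU)]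
  have hint := h.integrableOn_green hzU
  have hsplit : ∫ w in U, green φ z w = ∫ w in U, (ball z δ).indicator (green φ z) w +
      (ball z δ)ᶜ.indicator (green φ z) w := by
    congr 1
    ext w
    exact (indicator_self_add_compl_apply _ _ _).symm
  rw [hsplit, integral_add (hint.indicator measurableSet_ball) (hint.indicator (hmeas z))]
  have hnear : ∫ w in U, (ball z δ).indicator (green φ z) w ≤
      D * ∫ v, (ball (0 : ℂ) δ).indicator (fun v => ‖v‖⁻¹) v := by
    have hi := (integrable_indicator_norm_inv_sub δ z).const_mul D
    calc _ ≤ ∫ w in U, D * (ball (0 : ℂ) δ).indicator (fun v => ‖v‖⁻¹) (z - w) := by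
          refine integral_mono_ae (hint.indicator measurableSet_ball) hi.integrableOn ?_
          filter_upwards [hle z hzU] with w ⟨hw, h0, h1⟩
          by_cases hwδ : w ∈ ball z δ
          · rw [indicator_of_mem hwδ, indicator_of_mem
              (by rwa [mem_ball_zero_iff, ← dist_eq_norm, dist_comm])]
            exact h1.trans (mul_le_mul_of_nonneg_left
              (indicator_apply_le' (fun _ => le_rfl) fun _ => by positivity) hD.le)
          · rw [indicator_of_notMem hwδ]
            exact mul_nonneg hD.le (indicator_nonneg (fun _ _ => by positivity) _)
      _ ≤ ∫ w, D * (ball (0 : ℂ) δ).indicator (fun v => ‖v‖⁻¹) (z - w) :=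
          setIntegral_le_integral hi (Eventually.of_forall fun w =>
            mul_nonneg hD.le (indicator_nonneg (fun _ _ => by positivity) _))
      _ = _ := by
          rw [integral_const_mul, integral_sub_left_eq_self
            ((ball (0 : ℂ) δ).indicator fun v : ℂ => ‖v‖⁻¹) volume z]
  linarith

end IsRiemannMap

lemma exists_cutoff {U : Set ℂ} (hU : IsOpen U) {f : ℂ → ℝ} (hf : ContinuousOn f U) {z₀ : ℂ}
    (hz₀ : z₀ ∈ U) : ∃ χ : ℂ → ℝ, ∃ ρ > 0, Continuous χ ∧ (∀ w, 0 ≤ χ w ∧ χ w ≤ 1) ∧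
      (∀ w ∈ ball z₀ ρ, χ w = 1) ∧ (∀ w, w ∉ U → χ w = 0) ∧
      Continuous (fun w => χ w * f w) ∧ HasCompactSupport (fun w => χ w * f w) ∧
      (ContDiffOn ℝ 1 f U → ContDiff ℝ 1 fun w => χ w * f w) := by
  obtain ⟨r, hr, hrU⟩ := Metric.isOpen_iff.1 hU z₀ hz₀
  let χ : ContDiffBump z₀ := ⟨r / 4, r / 2, by positivity, by linarith⟩
  have hsub : tsupport χ ⊆ U := by
    rw [χ.tsupport_eq]
    exact (closedBall_subset_ball (half_lt_self hr)).trans hrU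
  have hts : tsupport (fun w => χ w * f w) ⊆ U := (tsupport_mul_subset_left).trans hsub
  refine ⟨χ, r / 4, by positivity, χ.continuous, fun w => ⟨χ.nonneg, χ.le_one⟩,
    fun w hw => χ.one_of_mem_closedBall (ball_subset_closedBall hw),
    fun w hw => image_eq_zero_of_notMem_tsupport fun h => hw (hsub h), ?_,
    χ.hasCompactSupport.mul_right, fun hf1 => ?_⟩
  · exact continuous_of_tsupport fun x hx =>
      χ.continuous.continuousAt.mul (hf.continuousAt (hU.mem_nhds (hts hx)))
  · refine contDiff_iff_contDiffAt.2 fun x => ?_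
    by_cases hx : x ∈ tsupport fun w => χ w * f w
    · exact χ.contDiff.contDiffAt.mul (hf1.contDiffAt (hU.mem_nhds (hts hx)))
    · exact contDiffAt_const.congr_of_eventuallyEq (notMem_tsupport_iff_eventuallyEq.1 hx)

/-- A logarithmic potential is harmonic away from the support of its density. -/
lemma harmonicAt_integral_log_norm_sub {S : Set ℂ} (hS : Bornology.IsBounded S)
    (hSm : MeasurableSet S) {f : ℂ → ℝ} (hf : IntegrableOn f S) {z₀ : ℂ} {ρ : ℝ} (hρ : 0 < ρ)
    (hd : Disjoint S (ball z₀ ρ)) :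
    InnerProductSpace.HarmonicAt (fun z => ∫ w in S, Real.log ‖z - w‖ * f w) z₀ := by
  obtain ⟨C, hC0, hC⟩ := hS.exists_pos_norm_le
  have hmem : ∀ᵐ w ∂(volume.restrict S), w ∈ S := ae_restrict_mem hSm
  refine harmonicAt_integral_log_norm (F := fun w z => z - w) (half_pos hρ) (half_pos hρ)
    (M := ‖z₀‖ + ρ + C) (fun z _ => by fun_prop) ?_ ?_ ?_ hf
  · exact Eventually.of_forall fun w => by fun_prop
  · filter_upwards [hmem] with w hw z hz
    have h1 : ρ ≤ dist w z₀ := by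
      by_contra! hlt
      exact Set.disjoint_left.1 hd hw hlt
    have h2 := dist_triangle w z z₀
    rw [mem_ball] at hz
    rw [← dist_eq_norm, dist_comm]
    linarith
  · filter_upwards [hmem] with w hw z hz
    rw [mem_ball, dist_eq_norm] at hz
    have h1 := norm_sub_le z w
    have h2 := norm_sub_norm_le z z₀
    linarith [hC w hw]

lemma integrableOn_log_norm_sub_mul {U : Set ℂ} (hU : IsOpen U) (hb : Bornology.IsBounded U)
    {f : ℂ → ℝ} {M : ℝ} (hf : ContinuousOn f U) (hM : ∀ w ∈ U, |f w| ≤ M) (z : ℂ) :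
    IntegrableOn (fun w => Real.log ‖z - w‖ * f w) U := by
  obtain ⟨R, hR⟩ := hb.subset_ball z
  have h1 : IntegrableOn (fun w : ℂ => Real.log ‖w‖) (ball 0 R) :=
    (locallyIntegrable_log_norm.integrableOn_isCompact (isCompact_closedBall 0 R)).mono_set
      ball_subset_closedBall
  have h2 := (h1.integrable_indicator measurableSet_ball).comp_sub_left z
  have h3 : IntegrableOn (fun w => Real.log ‖z - w‖) U := by
    refine (h2.integrableOn (s := U)).congr_fun (fun w hw => ?_) hU.measurableSet
    have h4 := hR hw
    rw [mem_ball, dist_comm, dist_eq_norm] at h4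
    exact indicator_of_mem (by rwa [mem_ball_zero_iff]) _
  exact h3.mul_bdd (c := M) (hf.aestronglyMeasurable hU.measurableSet)
    ((ae_restrict_mem hU.measurableSet).mono hM)

namespace IsRiemannMap

variable {U : Set ℂ} {φ ψ : ℂ → ℂ}

lemma integrableOn_of_bounded (h : IsRiemannMap U φ ψ) {f : ℂ → ℝ} {M : ℝ}
    (hf : ContinuousOn f U) (hM : ∀ w ∈ U, |f w| ≤ M) : IntegrableOn f U :=
  IntegrableOn.of_bound h.isBounded.measure_lt_top (hf.aestronglyMeasurable h.isOpen.measurableSet)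
    M ((ae_restrict_mem h.isOpen.measurableSet).mono hM)

lemma exists_greenOp_eq (h : IsRiemannMap U φ ψ) {f : ℂ → ℝ} {M : ℝ}
    (hf : ContinuousOn f U) (hM : ∀ w ∈ U, |f w| ≤ M) {z₀ : ℂ} (hz₀ : z₀ ∈ U) :
    ∃ F H : ℂ → ℝ, Continuous F ∧ HasCompactSupport F ∧ F z₀ = f z₀ ∧
      (ContDiffOn ℝ 1 f U → ContDiff ℝ 1 F) ∧ InnerProductSpace.HarmonicAt H z₀ ∧
      greenOp U φ f =ᶠ[𝓝 z₀] (2 * π)⁻¹ • (H - logPot F) := by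
  obtain ⟨χ, ρ, hρ, hχ, hχ01, hχ1, hχ0, hF, hFc, hF1⟩ := exists_cutoff h.isOpen hf hz₀
  have hfi := h.integrableOn_of_bounded hf hM
  obtain ⟨hH1, hI1⟩ := h.harmonicAt_regular_part hfi hz₀
  have hf2 : ContinuousOn (fun w => (1 - χ w) * f w) U :=
    (continuousOn_const.sub hχ.continuousOn).mul hf
  have hM2 : ∀ w ∈ U, |(1 - χ w) * f w| ≤ M := fun w hw => by
    rw [abs_mul, abs_of_nonneg (by linarith [(hχ01 w).2])]
    nlinarith [hM w hw, abs_nonneg (f w), (hχ01 w).1, (hχ01 w).2]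
  have hf2i := h.integrableOn_of_bounded hf2 hM2
  have hH2 : InnerProductSpace.HarmonicAt
      (fun z => ∫ w in U \ ball z₀ ρ, Real.log ‖z - w‖ * ((1 - χ w) * f w)) z₀ :=
    harmonicAt_integral_log_norm_sub (h.isBounded.subset sdiff_subset)
      (h.isOpen.measurableSet.diff measurableSet_ball) (hf2i.mono_set sdiff_subset) hρ
      disjoint_sdiff_left
  refine ⟨fun w => χ w * f w, _, hF, hFc, by simp [hχ1 z₀ (mem_ball_self hρ)], hF1,
    hH1.sub hH2, ?_⟩
  filter_upwards [h.isOpen.mem_nhds hz₀, hI1] with z hz hI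
  have hsub : ∫ w in U \ ball z₀ ρ, Real.log ‖z - w‖ * ((1 - χ w) * f w) =
      ∫ w in U, Real.log ‖z - w‖ * ((1 - χ w) * f w) := by
    refine (setIntegral_eq_of_subset_of_forall_sdiff_eq_zero h.isOpen.measurableSet
      sdiff_subset fun w hw => ?_).symm
    have : w ∈ ball z₀ ρ := by
      by_contra hn
      exact hw.2 ⟨hw.1, hn⟩
    simp [hχ1 w this]
  have hlog : logPot (fun w => χ w * f w) z = ∫ w in U, Real.log ‖z - w‖ * (χ w * f w) := by
    rw [logPot_eq]
    refine (setIntegral_eq_integral_of_forall_compl_eq_zero fun w hw => ?_).symm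
    simp [hχ0 w hw]
  have hi2 := integrableOn_log_norm_sub_mul h.isOpen h.isBounded hf2 hM2 z
  have hi3 : IntegrableOn (fun w => Real.log ‖z - w‖ * (χ w * f w)) U :=
    (integrable_logPot hF hFc z).integrableOn
  have hae : ∫ w in U, green φ z w * f w = ∫ w in U,
      (Real.log ‖(1 - conj (φ w) * φ z) / dslope φ w z‖ * f w -
        Real.log ‖z - w‖ * ((1 - χ w) * f w)) - Real.log ‖z - w‖ * (χ w * f w) := by
    refine integral_congr_ae ?_
    filter_upwards [ae_restrict_mem h.isOpen.measurableSet,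
      ae_restrict_of_ae (Measure.ae_ne volume z)] with w hw hne
    rw [h.green_eq hz hw hne.symm]
    ring
  simp only [greenOp, Pi.smul_apply, Pi.sub_apply, smul_eq_mul]
  rw [hae, hsub, hlog, integral_sub (hI.fun_sub hi2) hi3, integral_sub hI hi2]

lemma contDiffAt_greenOp_one (h : IsRiemannMap U φ ψ) {f : ℂ → ℝ} {M : ℝ}
    (hf : ContinuousOn f U) (hM : ∀ w ∈ U, |f w| ≤ M) {z₀ : ℂ} (hz₀ : z₀ ∈ U) :
    ContDiffAt ℝ 1 (greenOp U φ f) z₀ := by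
  obtain ⟨F, H, hF, hFc, -, -, hH, heq⟩ := h.exists_greenOp_eq hf hM hz₀
  have h1 : ContDiff ℝ 1 (logPot F) := contDiff_one_iff_hasFDerivAt.2
    ⟨fun z => reMul (cauchyPot F z), reMul.continuous.comp (continuous_cauchyPot hF hFc),
      hasFDerivAt_logPot hF hFc⟩
  refine ContDiffAt.congr_of_eventuallyEq ?_ heq
  exact contDiffAt_const.smul ((hH.1.of_le one_le_two).sub h1.contDiffAt)

lemma contDiffAt_greenOp_two (h : IsRiemannMap U φ ψ) {f : ℂ → ℝ} {M : ℝ}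
    (hf : ContDiffOn ℝ 1 f U) (hM : ∀ w ∈ U, |f w| ≤ M) {z₀ : ℂ} (hz₀ : z₀ ∈ U) :
    ContDiffAt ℝ 2 (greenOp U φ f) z₀ ∧ Laplacian.laplacian (greenOp U φ f) z₀ = -f z₀ := by
  obtain ⟨F, H, hF, hFc, hF0, hF1, hH, heq⟩ := h.exists_greenOp_eq hf.continuousOn hM hz₀
  have h1 : ContDiffAt ℝ 2 (logPot F) z₀ := (contDiff_logPot (hF1 hf) hFc).contDiffAt
  have h2 : ContDiffAt ℝ 2 (H - logPot F) z₀ := hH.1.sub h1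
  refine ⟨ContDiffAt.congr_of_eventuallyEq (contDiffAt_const.smul h2) heq, ?_⟩
  rw [(InnerProductSpace.laplacian_congr_nhds heq).eq_of_nhds,
    InnerProductSpace.laplacian_smul _ h2, hH.1.laplacian_sub h1, hH.2.eq_of_nhds,
    laplacian_logPot (hF1 hf) hFc, hF0]
  simp only [Pi.zero_apply, smul_eq_mul, zero_sub]
  have := Real.pi_ne_zero
  field_simp

end IsRiemannMap

/-! ### Maximum principle and the torsion function -/

lemma iteratedDeriv_two_line {E : Type*} [NormedAddCommGroup E] [NormedSpace ℝ E] {u : E → ℝ}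
    {p : E} (hu : ContDiffAt ℝ 2 u p) (e : E) :
    iteratedDeriv 2 (fun t : ℝ => u (p + t • e)) 0 = iteratedFDeriv ℝ 2 u p ![e, e] := by
  have hline : ∀ t : ℝ, HasDerivAt (fun t : ℝ => p + t • e) e t := fun t => by
    simpa using ((hasDerivAt_id t).smul_const e).const_add p
  have hp : p + (0 : ℝ) • e = p := by simp
  have hev : ∀ᶠ t in 𝓝 (0 : ℝ), DifferentiableAt ℝ u (p + t • e) := by
    have h1 : ∀ᶠ q in 𝓝 p, DifferentiableAt ℝ u q :=
      (hu.eventually (by simp)).mono fun q hq => hq.differentiableAt two_ne_zero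
    have h2 := (hline 0).continuousAt.tendsto
    rw [hp] at h2
    exact h2.eventually h1
  have hd : deriv (fun t : ℝ => u (p + t • e)) =ᶠ[𝓝 0] fun t => fderiv ℝ u (p + t • e) e :=
    hev.mono fun t ht => (ht.hasFDerivAt.comp_hasDerivAt t (hline t)).deriv
  have h2 : DifferentiableAt ℝ (fderiv ℝ u) (p + (0 : ℝ) • e) := by
    rw [hp]
    exact (hu.fderiv_right (m := 1) (by norm_num)).differentiableAt one_ne_zero
  have h3 : HasDerivAt (fun t : ℝ => fderiv ℝ u (p + t • e)) (fderiv ℝ (fderiv ℝ u) p e) 0 := by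
    have := h2.hasFDerivAt.comp_hasDerivAt (0 : ℝ) (hline 0)
    rw [hp] at this
    exact this
  have h4 := (ContinuousLinearMap.apply ℝ ℝ e).hasFDerivAt.comp_hasDerivAt (0 : ℝ) h3
  rw [iteratedDeriv_succ, iteratedDeriv_one, hd.deriv_eq, iteratedFDeriv_two_apply]
  exact h4.deriv

lemma laplacian_eq_lines {u : ℂ → ℝ} {z : ℂ} (hu : ContDiffAt ℝ 2 u z) :
    Laplacian.laplacian u z = iteratedDeriv 2 (fun t : ℝ => u (z + t • (1 : ℂ))) 0 +
      iteratedDeriv 2 (fun t : ℝ => u (z + t • Complex.I)) 0 := by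
  rw [InnerProductSpace.laplacian_eq_iteratedFDeriv_complexPlane, iteratedDeriv_two_line hu,
    iteratedDeriv_two_line hu]

lemma deriv_deriv_nonpos_of_isLocalMax {f : ℝ → ℝ} {x : ℝ} (h : IsLocalMax f x)
    (hc : ContinuousAt f x) : deriv (deriv f) x ≤ 0 := by
  by_contra! hpos
  have hmin := isLocalMin_of_deriv_deriv_pos hpos h.deriv_eq_zero hc
  have hconst : f =ᶠ[𝓝 x] fun _ => f x := by
    filter_upwards [h, hmin] with y h1 h2 using le_antisymm h1 h2
  have : deriv (deriv f) x = 0 := by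
    rw [hconst.deriv.deriv_eq]
    simp
  linarith

lemma laplacian_nonpos_of_isLocalMax {u : ℂ → ℝ} {z : ℂ} (hu : ContDiffAt ℝ 2 u z)
    (h : IsLocalMax u z) : Laplacian.laplacian u z ≤ 0 := by
  have key : ∀ e : ℂ, iteratedDeriv 2 (fun t : ℝ => u (z + t • e)) 0 ≤ 0 := by
    intro e
    have hz : z + (0 : ℝ) • e = z := by simp
    have hc : ContinuousAt (fun t : ℝ => z + t • e) 0 := by fun_prop
    rw [iteratedDeriv_succ, iteratedDeriv_one]
    refine deriv_deriv_nonpos_of_isLocalMax ?_ ?_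
    · have h1 := hc.tendsto
      rw [hz] at h1
      refine (h1.eventually h).mono fun t ht => ?_
      simpa using ht
    · refine ContinuousAt.comp (g := u) ?_ hc
      rw [hz]
      exact hu.continuousAt
  rw [laplacian_eq_lines hu]
  linarith [key 1, key Complex.I]

/-- **Weak maximum principle** for strictly subharmonic functions. -/
lemma nonpos_of_laplacian_pos {U : Set ℂ} (hU : IsOpen U) (hb : Bornology.IsBounded U) {u : ℂ → ℝ}
    (hu : ∀ z ∈ U, ContDiffAt ℝ 2 u z) (hpos : ∀ z ∈ U, 0 < Laplacian.laplacian u z)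
    (hbd : ∀ ζ ∈ frontier U, ∀ m > 0, ∀ᶠ z in 𝓝[U] ζ, u z < m) : ∀ z ∈ U, u z ≤ 0 := by
  intro z₁ hz₁
  by_contra! hz₁pos
  set K := {z ∈ U | u z₁ ≤ u z} with hK
  have hcont : ContinuousOn u U := fun z hz => (hu z hz).continuousAt.continuousWithinAt
  have hclosed : IsClosed K := by
    refine isClosed_of_closure_subset fun ζ hζ => ?_
    have hfreq : ∃ᶠ z in 𝓝 ζ, z ∈ K := mem_closure_iff_frequently.1 hζ
    by_cases hζU : ζ ∈ U
    · refine ⟨hζU, ?_⟩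
      exact ge_of_tendsto_of_frequently (hu ζ hζU).continuousAt (hfreq.mono fun z hz => hz.2)
    · have hfr : ζ ∈ frontier U := by
        rw [hU.frontier_eq]
        exact ⟨closure_mono (fun z hz => hz.1) hζ, hζU⟩
      have h1 := eventually_nhdsWithin_iff.1 (hbd ζ hfr (u z₁) hz₁pos)
      obtain ⟨z, hz, hlt⟩ := (hfreq.and_eventually h1).exists
      exact absurd (hlt hz.1) (not_lt.2 hz.2)
  have hcomp : IsCompact K := isCompact_of_isClosed_isBounded hclosed (hb.subset fun z hz => hz.1)
  obtain ⟨z₂, hz₂, hmax⟩ := hcomp.exists_isMaxOn ⟨z₁, hz₁, le_rfl⟩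
    (hcont.mono fun z hz => hz.1)
  refine absurd (laplacian_nonpos_of_isLocalMax (hu z₂ hz₂.1) ?_) (not_le.2 (hpos z₂ hz₂.1))
  filter_upwards [hU.mem_nhds hz₂.1] with z hz
  by_cases hle : u z₁ ≤ u z
  · exact hmax ⟨hz, hle⟩
  · exact (not_le.1 hle).le.trans hz₂.2

lemma iteratedDeriv_two_quadratic (a b c : ℝ) :
    iteratedDeriv 2 (fun t : ℝ => a + b * t + c * t ^ 2) 0 = 2 * c := by
  have h1 : deriv (fun t : ℝ => a + b * t + c * t ^ 2) = fun t => b + c * (2 * t) := by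
    ext t
    have h : HasDerivAt (fun t : ℝ => a + b * t + c * t ^ 2) _ t :=
      (((hasDerivAt_id t).const_mul b).const_add a).add (((hasDerivAt_id t).pow 2).const_mul c)
    simpa using h.deriv
  rw [iteratedDeriv_succ, iteratedDeriv_one, h1]
  have h := ((((hasDerivAt_id (0 : ℝ)).const_mul 2).const_mul c).const_add b).deriv
  simp only [id, mul_one] at h
  rw [h, mul_comm]

/-- The torsion function of the ellipse `α² x² + y² < β²`. -/
def ellipseTorsion (α β : ℝ) (z : ℂ) : ℝ :=
  (β ^ 2 - α ^ 2 * z.re ^ 2 - z.im ^ 2) / (2 * (1 + α ^ 2))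

lemma contDiff_ellipseTorsion (α β : ℝ) : ContDiff ℝ 2 (ellipseTorsion α β) := by
  have h1 : ContDiff ℝ 2 fun z : ℂ => z.re := Complex.reCLM.contDiff
  have h2 : ContDiff ℝ 2 fun z : ℂ => z.im := Complex.imCLM.contDiff
  unfold ellipseTorsion
  fun_prop

lemma laplacian_ellipseTorsion (α β : ℝ) (z : ℂ) :
    Laplacian.laplacian (ellipseTorsion α β) z = -1 := by
  have h0 : (1 + α ^ 2) ≠ 0 := by positivity
  have h1 : (fun t : ℝ => ellipseTorsion α β (z + t • (1 : ℂ))) = fun t =>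
      ellipseTorsion α β z + (-(α ^ 2 * z.re) / (1 + α ^ 2)) * t +
        (-α ^ 2 / (2 * (1 + α ^ 2))) * t ^ 2 := by
    ext t
    simp only [ellipseTorsion, Complex.add_re, Complex.add_im, Complex.real_smul, mul_one,
      Complex.ofReal_re, Complex.ofReal_im]
    field_simp
    ring
  have h2 : (fun t : ℝ => ellipseTorsion α β (z + t • Complex.I)) = fun t =>
      ellipseTorsion α β z + (-z.im / (1 + α ^ 2)) * t +
        (-1 / (2 * (1 + α ^ 2))) * t ^ 2 := by
    ext t
    simp only [ellipseTorsion, Complex.add_re, Complex.add_im, Complex.real_smul,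
      Complex.re_ofReal_mul, Complex.im_ofReal_mul, Complex.I_re, Complex.I_im]
    field_simp
    ring
  rw [laplacian_eq_lines (contDiff_ellipseTorsion α β).contDiffAt, h1, h2,
    iteratedDeriv_two_quadratic, iteratedDeriv_two_quadratic]
  field_simp
  ring

lemma IsRiemannMap.greenOp_one_le {U : Set ℂ} {φ ψ : ℂ → ℂ} (h : IsRiemannMap U φ ψ) {α β : ℝ}
    (hU : ∀ z ∈ U, α ^ 2 * z.re ^ 2 + z.im ^ 2 ≤ β ^ 2) {z : ℂ} (hz : z ∈ U) :
    greenOp U φ (fun _ => 1) z ≤ β ^ 2 / 2 := by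
  have hτ := fun z (hz : z ∈ U) => h.contDiffAt_greenOp_two (f := fun _ => 1) (M := 1)
    contDiffOn_const (by simp) hz
  have hP := contDiff_ellipseTorsion α β
  have hPnn : ∀ z ∈ U, 0 ≤ ellipseTorsion α β z := fun z hz => by
    have := hU z hz
    unfold ellipseTorsion
    apply div_nonneg <;> nlinarith [sq_nonneg α]
  have key : ∀ ε > 0, greenOp U φ (fun _ => 1) z ≤ (1 + ε) * ellipseTorsion α β z := by
    intro ε hε
    have hcd : ∀ z, ContDiffAt ℝ 2 ((1 + ε) • ellipseTorsion α β) z := fun z =>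
      contDiffAt_const.smul hP.contDiffAt
    have := nonpos_of_laplacian_pos h.isOpen h.isBounded
      (u := greenOp U φ (fun _ => 1) - (1 + ε) • ellipseTorsion α β)
      (fun z hz => (hτ z hz).1.sub (hcd z)) (fun z hz => ?_) (fun ζ hζ m hm => ?_) z hz
    · simpa using this
    · rw [(hτ z hz).1.laplacian_sub (hcd z), InnerProductSpace.laplacian_smul _ hP.contDiffAt,
        (hτ z hz).2, laplacian_ellipseTorsion]
      simpa using hε
    · have ht := ((h.tendsto_integral_green hζ).const_mul (2 * π)⁻¹)
      rw [mul_zero] at ht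
      filter_upwards [ht.eventually (gt_mem_nhds hm), self_mem_nhdsWithin] with z hz hzU
      have h1 : 0 ≤ (1 + ε) * ellipseTorsion α β z := mul_nonneg (by linarith) (hPnn z hzU)
      simp only [Pi.sub_apply, Pi.smul_apply, smul_eq_mul, greenOp, mul_one]
      linarith
  have hle : greenOp U φ (fun _ => 1) z ≤ ellipseTorsion α β z := by
    refine le_of_forall_pos_le_add fun δ hδ => ?_
    have hp := hPnn z hz
    have h1 := key (δ / (ellipseTorsion α β z + 1)) (by positivity)
    have h2 : δ / (ellipseTorsion α β z + 1) * ellipseTorsion α β z ≤ δ := by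
      rw [div_mul_eq_mul_div, div_le_iff₀ (by positivity)]
      nlinarith
    linarith
  refine hle.trans ?_
  unfold ellipseTorsion
  rw [div_le_div_iff₀ (by positivity) two_pos]
  nlinarith [sq_nonneg α, sq_nonneg (α * β), sq_nonneg (α * z.re), sq_nonneg z.im]

/-! ### The fixed point problem -/

/-- The exponential truncated at height `e`. -/
def truncExp (s : ℝ) : ℝ := Real.exp (min s 1)

lemma truncExp_pos (s : ℝ) : 0 < truncExp s := Real.exp_pos _

lemma truncExp_le (s : ℝ) : truncExp s ≤ Real.exp 1 := Real.exp_le_exp.2 (min_le_right _ _)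

lemma abs_truncExp_le (s : ℝ) : |truncExp s| ≤ Real.exp 1 := by
  rw [abs_of_pos (truncExp_pos s)]
  exact truncExp_le s

lemma continuous_truncExp : Continuous truncExp := by
  unfold truncExp
  fun_prop

lemma abs_truncExp_sub_le (a b : ℝ) : |truncExp a - truncExp b| ≤ Real.exp 1 * |a - b| := by
  have h1 : |truncExp a - truncExp b| ≤ Real.exp 1 * |min a 1 - min b 1| := by
    have := (convex_Iic (1 : ℝ)).norm_image_sub_le_of_norm_deriv_le (f := Real.exp)
      (C := Real.exp 1) (fun x _ => Real.differentiableAt_exp) (fun x hx => by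
        rw [Real.deriv_exp, Real.norm_of_nonneg (Real.exp_pos x).le]
        exact Real.exp_le_exp.2 hx) (min_le_right b 1) (min_le_right a 1)
    simpa [truncExp] using this
  refine h1.trans (mul_le_mul_of_nonneg_left ?_ (Real.exp_pos 1).le)
  simpa using abs_min_sub_min_le_max a 1 b 1

/-- The nonlinearity `e^v`, truncated, for `v` given on `U` only. -/
def nonlin {U : Set ℂ} (v : U →ᵇ ℝ) (w : ℂ) : ℝ :=
  truncExp (Function.extend Subtype.val v 0 w)

lemma nonlin_apply {U : Set ℂ} (v : U →ᵇ ℝ) (w : U) : nonlin v w = truncExp (v w) := by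
  rw [nonlin, Subtype.val_injective.extend_apply]

lemma continuousOn_nonlin {U : Set ℂ} (v : U →ᵇ ℝ) : ContinuousOn (nonlin v) U := by
  rw [continuousOn_iff_continuous_domRestrict]
  exact (continuous_truncExp.comp v.continuous).congr fun w => (nonlin_apply v w).symm

lemma abs_nonlin_sub_le {U : Set ℂ} (v v' : U →ᵇ ℝ) {w : ℂ} (hw : w ∈ U) :
    |nonlin v w - nonlin v' w| ≤ Real.exp 1 * dist v v' := by
  rw [nonlin_apply v ⟨w, hw⟩, nonlin_apply v' ⟨w, hw⟩]
  refine (abs_truncExp_sub_le _ _).trans (mul_le_mul_of_nonneg_left ?_ (Real.exp_pos 1).le)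
  rw [← Real.dist_eq]
  exact BoundedContinuousFunction.dist_coe_le_dist _

namespace IsRiemannMap

variable {U : Set ℂ} {φ ψ : ℂ → ℂ}

lemma greenOp_nonneg (h : IsRiemannMap U φ ψ) {z : ℂ} (hz : z ∈ U) {f : ℂ → ℝ}
    (hf : ∀ w ∈ U, 0 ≤ f w) : 0 ≤ greenOp U φ f z :=
  mul_nonneg (by positivity) (setIntegral_nonneg h.isOpen.measurableSet fun w hw =>
    mul_nonneg (h.green_nonneg hz hw) (hf w hw))

lemma abs_greenOp_le (h : IsRiemannMap U φ ψ) {z : ℂ} (hz : z ∈ U) {f : ℂ → ℝ} {M : ℝ}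
    (hM : ∀ w ∈ U, |f w| ≤ M) : |greenOp U φ f z| ≤ M * greenOp U φ (fun _ => 1) z := by
  have h1 : ‖∫ w in U, green φ z w * f w‖ ≤ ∫ w in U, green φ z w * M := by
    refine norm_integral_le_of_norm_le ((h.integrableOn_green hz).mul_const M) ?_
    filter_upwards [ae_restrict_mem h.isOpen.measurableSet] with w hw
    rw [norm_mul, Real.norm_of_nonneg (h.green_nonneg hz hw)]
    exact mul_le_mul_of_nonneg_left (hM w hw) (h.green_nonneg hz hw)
  rw [integral_mul_const, Real.norm_eq_abs] at h1
  rw [greenOp, greenOp, abs_mul, abs_of_pos (by positivity : 0 < (2 * π)⁻¹)]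
  simp only [mul_one]
  calc _ ≤ (2 * π)⁻¹ * ((∫ w in U, green φ z w) * M) := by gcongr
    _ = _ := by ring

lemma greenOp_sub (h : IsRiemannMap U φ ψ) {z : ℂ} (hz : z ∈ U) {f g : ℂ → ℝ} {M : ℝ}
    (hf : ContinuousOn f U) (hM : ∀ w ∈ U, |f w| ≤ M) (hg : ContinuousOn g U)
    (hM' : ∀ w ∈ U, |g w| ≤ M) :
    greenOp U φ f z - greenOp U φ g z = greenOp U φ (fun w => f w - g w) z := by
  rw [greenOp, greenOp, greenOp, ← mul_sub,
    ← integral_sub (h.integrableOn_green_mul hz hf hM) (h.integrableOn_green_mul hz hg hM')]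
  simp only [mul_sub]

lemma tendsto_greenOp_frontier (h : IsRiemannMap U φ ψ) {f : ℂ → ℝ} {M : ℝ}
    (hM : ∀ w ∈ U, |f w| ≤ M) {ζ : ℂ} (hζ : ζ ∈ frontier U) :
    Tendsto (greenOp U φ f) (𝓝[U] ζ) (𝓝 0) := by
  have h1 := ((h.tendsto_integral_green hζ).const_mul (2 * π)⁻¹).const_mul M
  rw [mul_zero, mul_zero] at h1
  refine squeeze_zero_norm' ?_ h1
  filter_upwards [self_mem_nhdsWithin] with z hz
  have := h.abs_greenOp_le hz hM
  simpa [greenOp] using this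

/-- The solution map `v ↦ μ G[e^v]` of the truncated problem. -/
def solMap (h : IsRiemannMap U φ ψ) {τ : ℝ} (hτ : ∀ z ∈ U, greenOp U φ (fun _ => 1) z ≤ τ)
    (μ : ℝ) (v : U →ᵇ ℝ) : U →ᵇ ℝ :=
  BoundedContinuousFunction.ofNormedAddCommGroup (fun z : U => μ * greenOp U φ (nonlin v) z)
    (continuous_iff_continuousAt.2 fun z => ((h.contDiffAt_greenOp_one (continuousOn_nonlin v)
      (fun w _ => abs_truncExp_le _) z.2).continuousAt.comp
        continuousAt_subtype_val).const_mul μ)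
    (|μ| * (Real.exp 1 * τ)) fun z => by
      rw [Real.norm_eq_abs, abs_mul]
      refine mul_le_mul_of_nonneg_left ((h.abs_greenOp_le z.2 fun w _ => abs_truncExp_le _).trans
        (mul_le_mul_of_nonneg_left (hτ z z.2) (Real.exp_pos 1).le)) (abs_nonneg μ)

variable {τ : ℝ}

lemma solMap_apply (h : IsRiemannMap U φ ψ) (hτ : ∀ z ∈ U, greenOp U φ (fun _ => 1) z ≤ τ)
    (μ : ℝ) (v : U →ᵇ ℝ) (z : U) : h.solMap hτ μ v z = μ * greenOp U φ (nonlin v) z := rfl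

lemma dist_solMap_le (h : IsRiemannMap U φ ψ) (hτ : ∀ z ∈ U, greenOp U φ (fun _ => 1) z ≤ τ)
    (hτ0 : 0 ≤ τ) {μ : ℝ} (hμ : 0 ≤ μ) (v v' : U →ᵇ ℝ) :
    dist (h.solMap hτ μ v) (h.solMap hτ μ v') ≤ μ * Real.exp 1 * τ * dist v v' := by
  refine (BoundedContinuousFunction.dist_le (by positivity)).2 fun z => ?_
  rw [Real.dist_eq, solMap_apply, solMap_apply, ← mul_sub, greenOp_sub h z.2 (continuousOn_nonlin v)
    (fun w _ => abs_truncExp_le _) (continuousOn_nonlin v') (fun w _ => abs_truncExp_le _), abs_mul,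
    abs_of_nonneg hμ]
  have h1 := h.abs_greenOp_le z.2 fun w hw => abs_nonlin_sub_le v v' hw
  have h2 := mul_le_mul_of_nonneg_left (hτ z z.2)
    (by positivity : 0 ≤ Real.exp 1 * dist v v')
  calc _ ≤ μ * (Real.exp 1 * dist v v' * τ) := mul_le_mul_of_nonneg_left (h1.trans h2) hμ
    _ = _ := by ring

lemma dist_solMap_param_le (h : IsRiemannMap U φ ψ)
    (hτ : ∀ z ∈ U, greenOp U φ (fun _ => 1) z ≤ τ) (hτ0 : 0 ≤ τ) (μ μ' : ℝ) (v : U →ᵇ ℝ) :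
    dist (h.solMap hτ μ v) (h.solMap hτ μ' v) ≤ Real.exp 1 * τ * |μ - μ'| := by
  refine (BoundedContinuousFunction.dist_le (by positivity)).2 fun z => ?_
  rw [Real.dist_eq, solMap_apply, solMap_apply, ← sub_mul, abs_mul, mul_comm]
  exact mul_le_mul_of_nonneg_right ((h.abs_greenOp_le z.2 fun w _ => abs_truncExp_le _).trans
    (mul_le_mul_of_nonneg_left (hτ z z.2) (Real.exp_pos 1).le)) (abs_nonneg _)

/-- The truncated problem has a continuous family of solutions. -/
lemma exists_family (h : IsRiemannMap U φ ψ) (hτ : ∀ z ∈ U, greenOp U φ (fun _ => 1) z ≤ τ)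
    (hτ0 : 0 ≤ τ) {μ₁ : ℝ} (hμ₁ : 0 ≤ μ₁) (hK1 : μ₁ * Real.exp 1 * τ < 1) :
    ∃ s : Icc (0 : ℝ) μ₁ → (U →ᵇ ℝ), Continuous s ∧
      ∀ (μ : Icc (0 : ℝ) μ₁) (z : U), s μ z = μ * greenOp U φ (nonlin (s μ)) z := by
  obtain ⟨K, hK⟩ : ∃ K : NNReal, (K : ℝ) = μ₁ * Real.exp 1 * τ :=
    ⟨⟨μ₁ * Real.exp 1 * τ, by positivity⟩, rfl⟩
  have hcontr : ∀ μ : Icc (0 : ℝ) μ₁, ContractingWith K (h.solMap hτ μ) := fun μ => by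
    refine ⟨by rw [← NNReal.coe_lt_coe, hK]; exact hK1,
      LipschitzWith.of_dist_le_mul fun v v' => ?_⟩
    refine (h.dist_solMap_le hτ hτ0 μ.2.1 v v').trans (mul_le_mul_of_nonneg_right ?_ dist_nonneg)
    rw [hK]
    have := μ.2.2
    gcongr
  have hex : ∀ μ : Icc (0 : ℝ) μ₁, ∃ v, Function.IsFixedPt (h.solMap hτ μ) v := fun μ =>
    ⟨_, (hcontr μ).fixedPoint_isFixedPt⟩
  choose s hfix using hex
  refine ⟨s, continuous_iff_continuousAt.2 fun μ => ?_, fun μ z => ?_⟩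
  · rw [ContinuousAt, tendsto_iff_dist_tendsto_zero]
    have hlim : Tendsto (fun μ' : Icc (0 : ℝ) μ₁ => Real.exp 1 * τ * |(μ' : ℝ) - μ| / (1 - K))
        (𝓝 μ) (𝓝 0) := by
      have : Continuous fun μ' : Icc (0 : ℝ) μ₁ => Real.exp 1 * τ * |(μ' : ℝ) - μ| / (1 - K) := by
        fun_prop
      simpa using this.tendsto μ
    refine squeeze_zero (fun _ => dist_nonneg) (fun μ' => ?_) hlim
    exact (hcontr μ').dist_fixedPoint_fixedPoint_of_dist_le' (h.solMap hτ μ) (hfix μ')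
      (hfix μ) fun v => h.dist_solMap_param_le hτ hτ0 μ' μ v
  · rw [← h.solMap_apply hτ, (hfix μ).eq]

lemma integrableOn_nonlin (h : IsRiemannMap U φ ψ) (v : U →ᵇ ℝ) : IntegrableOn (nonlin v) U :=
  h.integrableOn_of_bounded (continuousOn_nonlin _) fun _ _ => abs_truncExp_le _

lemma continuous_integral_nonlin (h : IsRiemannMap U φ ψ) :
    Continuous fun v : U →ᵇ ℝ => ∫ w in U, nonlin v w := by
  refine continuous_iff_continuousAt.2 fun v => ?_
  rw [ContinuousAt, tendsto_iff_dist_tendsto_zero]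
  have hlim : Tendsto (fun v' => Real.exp 1 * dist v' v * volume.real U) (𝓝 v) (𝓝 0) := by
    have := ((tendsto_iff_dist_tendsto_zero.1 (tendsto_id (x := 𝓝 v))).const_mul
      (Real.exp 1)).mul_const (volume.real U)
    simpa using this
  refine squeeze_zero (fun _ => dist_nonneg) (fun v' => ?_) hlim
  rw [dist_eq_norm, ← integral_sub (h.integrableOn_nonlin v') (h.integrableOn_nonlin v)]
  exact norm_setIntegral_le_of_norm_le_const h.isBounded.measure_lt_top
    fun w hw => abs_nonlin_sub_le _ _ hw

/-- A solution of the truncated problem of the prescribed mass. -/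
lemma exists_truncated (h : IsRiemannMap U φ ψ) (hne : U.Nonempty)
    (hτ : ∀ z ∈ U, greenOp U φ (fun _ => 1) z ≤ τ) {lam : ℝ} (hlam : 0 < lam)
    (hsmall : lam * Real.exp 1 * τ < volume.real U) :
    ∃ (μ : ℝ) (v : U →ᵇ ℝ), (∀ z : U, v z = μ * greenOp U φ (nonlin v) z) ∧ (∀ z : U, v z ≤ 1) ∧
      μ * ∫ w in U, nonlin v w = lam := by
  have hτ0 : 0 ≤ τ := by
    obtain ⟨z, hz⟩ := hne
    exact (h.greenOp_nonneg hz fun _ _ => zero_le_one).trans (hτ z hz)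
  have hVpos : 0 < volume.real U :=
    ENNReal.toReal_pos (h.isOpen.measure_pos volume hne).ne' h.isBounded.measure_lt_top.ne
  obtain ⟨μ₁, hμ₁⟩ : ∃ μ₁, μ₁ = lam / volume.real U := ⟨_, rfl⟩
  have hμ₁pos : 0 < μ₁ := hμ₁ ▸ div_pos hlam hVpos
  have hK1 : μ₁ * Real.exp 1 * τ < 1 := by
    rw [hμ₁, div_mul_eq_mul_div, div_mul_eq_mul_div, div_lt_one hVpos]
    exact hsmall
  obtain ⟨s, hscont, hs⟩ := h.exists_family hτ hτ0 hμ₁pos.le hK1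
  have hGnn : ∀ (μ : Icc (0 : ℝ) μ₁) (z : U), 0 ≤ greenOp U φ (nonlin (s μ)) z := fun μ z =>
    h.greenOp_nonneg z.2 fun w _ => (truncExp_pos _).le
  obtain ⟨μ, hμ⟩ : ∃ μ : Icc (0 : ℝ) μ₁, (μ : ℝ) * ∫ w in U, nonlin (s μ) w = lam := by
    have hconn : PreconnectedSpace (Icc (0 : ℝ) μ₁) := isPreconnected_iff_preconnectedSpace.1
      isPreconnected_Icc
    refine mem_range_of_exists_le_of_exists_ge
      (f := fun μ : Icc (0 : ℝ) μ₁ => (μ : ℝ) * ∫ w in U, nonlin (s μ) w)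
      (continuous_subtype_val.mul (h.continuous_integral_nonlin.comp hscont))
      ⟨⟨0, le_rfl, hμ₁pos.le⟩, ?_⟩ ⟨⟨μ₁, hμ₁pos.le, le_rfl⟩, ?_⟩
    · simpa using hlam.le
    · have h1 : volume.real U ≤ ∫ w in U, nonlin (s ⟨μ₁, hμ₁pos.le, le_rfl⟩) w := by
        have h2 : ∫ w in U, (1 : ℝ) = volume.real U := by simp
        rw [← h2]
        refine setIntegral_mono_on (integrableOn_const h.isBounded.measure_lt_top.ne)
          (h.integrableOn_nonlin _) h.isOpen.measurableSet fun w hw => ?_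
        rw [nonlin_apply _ ⟨w, hw⟩, truncExp, hs]
        exact Real.one_le_exp (le_min (mul_nonneg hμ₁pos.le (hGnn _ _)) zero_le_one)
      calc lam = μ₁ * volume.real U := by rw [hμ₁, div_mul_cancel₀ _ hVpos.ne']
        _ ≤ _ := mul_le_mul_of_nonneg_left h1 hμ₁pos.le
  refine ⟨μ, s μ, hs μ, fun z => ?_, hμ⟩
  rw [hs]
  have h1 := (le_abs_self _).trans (h.abs_greenOp_le z.2 fun w _ => abs_truncExp_le
    (Function.extend Subtype.val (s μ) 0 w))
  have h2 := h1.trans (mul_le_mul_of_nonneg_left (hτ z z.2) (Real.exp_pos 1).le)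
  calc _ ≤ μ₁ * (Real.exp 1 * τ) := mul_le_mul μ.2.2 h2 (hGnn μ z) hμ₁pos.le
    _ ≤ 1 := by linarith

/-- Existence whenever `λ e τ < |U|`, with `τ` a bound for the torsion function. -/
theorem exists_solution (h : IsRiemannMap U φ ψ) (hne : U.Nonempty)
    (hτ : ∀ z ∈ U, greenOp U φ (fun _ => 1) z ≤ τ) {lam : ℝ} (hlam : 0 < lam)
    (hsmall : lam * Real.exp 1 * τ < volume.real U) :
    ∃ u : ℂ → ℝ, (∀ z ∈ U, ContDiffAt ℝ 2 u z) ∧ ContinuousOn u (closure U) ∧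
      (∀ z ∈ frontier U, u z = 0) ∧ ∀ z ∈ U, -Laplacian.laplacian u z =
        lam * Real.exp (u z) / ∫ w in U, Real.exp (u w) := by
  obtain ⟨μ, v, hv, hv1, hμ⟩ := h.exists_truncated hne hτ hlam hsmall
  have hμval : μ = lam / ∫ w in U, nonlin v w := by
    rw [eq_div_iff, hμ]
    intro h0
    rw [h0, mul_zero] at hμ
    exact hlam.ne hμ
  set G := greenOp U φ (nonlin v) with hG
  set u : ℂ → ℝ := U.indicator fun z => μ * G z with hu
  have huU : ∀ z ∈ U, u z = μ * G z := fun z hz => indicator_of_mem hz _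
  have hun : ∀ z ∈ U, nonlin v z = Real.exp (u z) := fun z hz => by
    rw [nonlin_apply _ ⟨z, hz⟩, truncExp, min_eq_left (hv1 _), hv, huU z hz]
  have hev : ∀ z ∈ U, u =ᶠ[𝓝 z] μ • G := fun z hz => by
    filter_upwards [h.isOpen.mem_nhds hz] with w hw
    rw [huU w hw]
    rfl
  have hb : ∀ w ∈ U, |nonlin v w| ≤ Real.exp 1 := fun w _ => abs_truncExp_le _
  have hu1 : ContDiffOn ℝ 1 u U := fun z hz =>
    ((contDiffAt_const.smul (h.contDiffAt_greenOp_one (continuousOn_nonlin _) hb hz)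
      ).congr_of_eventuallyEq (hev z hz)).contDiffWithinAt
  have hn1 : ContDiffOn ℝ 1 (nonlin v) U := hu1.exp.congr hun
  have hG2 := fun z (hz : z ∈ U) => h.contDiffAt_greenOp_two hn1 hb hz
  have hu2 : ∀ z ∈ U, ContDiffAt ℝ 2 u z := fun z hz =>
    (contDiffAt_const.smul (hG2 z hz).1).congr_of_eventuallyEq (hev z hz)
  have hfr : ∀ z ∈ frontier U, u z = 0 := fun z hz => by
    rw [h.isOpen.frontier_eq] at hz
    exact indicator_of_notMem hz.2 _
  refine ⟨u, hu2, ?_, hfr, fun z hz => ?_⟩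
  · intro ζ hζ
    by_cases hζU : ζ ∈ U
    · exact (hu2 ζ hζU).continuousAt.continuousWithinAt
    have hζf : ζ ∈ frontier U := by
      rw [h.isOpen.frontier_eq]
      exact ⟨hζ, hζU⟩
    refine ContinuousAt.continuousWithinAt ?_
    rw [ContinuousAt, hfr ζ hζf]
    have ht := (h.tendsto_greenOp_frontier hb hζf).const_mul μ
    rw [mul_zero] at ht
    rw [Metric.tendsto_nhds] at ht ⊢
    intro ε hε
    filter_upwards [eventually_nhdsWithin_iff.1 (ht ε hε)] with z hz
    by_cases hzU : z ∈ U
    · rw [huU z hzU]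
      exact hz hzU
    · rw [hu, indicator_of_notMem hzU, dist_self]
      exact hε
  · have hint : ∫ w in U, nonlin v w = ∫ w in U, Real.exp (u w) :=
      setIntegral_congr_fun h.isOpen.measurableSet hun
    rw [(InnerProductSpace.laplacian_congr_nhds (hev z hz)).eq_of_nhds,
      InnerProductSpace.laplacian_smul _ (hG2 z hz).1, (hG2 z hz).2, hun z hz, smul_eq_mul,
      hμval, hint]
    ring

end IsRiemannMap

/-! ### Ellipses and the threshold -/

lemma le_volume_of_ellipse_subset {U : Set ℂ} (hb : Bornology.IsBounded U) {α β : ℝ} (hα : 0 < α)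
    (hβ : 0 < β) (hU : ∀ z : ℂ, α ^ 2 * z.re ^ 2 + z.im ^ 2 ≤ β ^ 2 → z ∈ U) :
    π * β ^ 2 / α ≤ volume.real U := by
  set f : ℂ →ₗ[ℝ] ℂ := Matrix.toLin Complex.basisOneI Complex.basisOneI !![α, 0; 0, 1] with hf
  have hdet : LinearMap.det f = α := by
    rw [hf, LinearMap.det_toLin, Matrix.det_fin_two_of]
    ring
  have hfz : ∀ z : ℂ, f z = ⟨α * z.re, z.im⟩ := fun z => by
    rw [hf, Matrix.toLin_apply]
    apply Complex.ext <;> simp [Fin.sum_univ_two, Matrix.mulVec, dotProduct]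
  have hsub : f ⁻¹' ball 0 β ⊆ U := fun z hz => by
    refine hU z ?_
    rw [mem_preimage, mem_ball_zero_iff, hfz] at hz
    have h1 := Complex.sq_norm (⟨α * z.re, z.im⟩ : ℂ)
    rw [Complex.normSq_apply] at h1
    have h2 := pow_le_pow_left₀ (norm_nonneg _) hz.le 2
    rw [h1] at h2
    simp only at h2
    nlinarith
  have hvol : volume.real (f ⁻¹' ball 0 β) = π * β ^ 2 / α := by
    rw [measureReal_def, Measure.addHaar_preimage_linearMap _ (by rw [hdet]; exact hα.ne'), hdet,
      Complex.volume_ball, ENNReal.toReal_mul, ENNReal.toReal_ofReal (abs_nonneg _),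
      abs_of_pos (inv_pos.2 hα), ENNReal.toReal_mul, ENNReal.toReal_pow,
      ENNReal.toReal_ofReal hβ.le]
    simp only [ENNReal.coe_toReal, NNReal.coe_real_pi]
    field_simp
  rw [← hvol]
  exact measureReal_mono hsub hb.measure_lt_top.ne

lemma continuousAt_gammaLowSq {c : ℝ} (hc : c ≤ 1) :
    ContinuousAt (fun α => gammaLowSq α c) 0 := by
  unfold gammaLowSq
  refine ContinuousAt.div (by fun_prop) (by fun_prop) ?_
  norm_num
  linarith

lemma gammaLowSq_zero (c : ℝ) : gammaLowSq 0 c = c / (8 - c) := by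
  simp [gammaLowSq]

lemma exists_threshold {c : ℝ} (hc : 0 < c) (hc1 : c ≤ 1) :
    ∃ αs ∈ Ioo (0 : ℝ) 1, ∀ α ∈ Ioc (0 : ℝ) αs, 8 * π ≤ lamLow α c ∧
      Real.exp 1 * ((1 + α ^ 2) ^ 2 * (1 + gammaLowSq α c)) < 4 := by
  have h8 : 0 < 8 - c := by linarith
  have hcont := continuousAt_gammaLowSq hc1
  have hexp := Real.exp_one_lt_d9
  have h1 : ∀ᶠ α in 𝓝 (0 : ℝ), Real.exp 1 * ((1 + α ^ 2) ^ 2 * (1 + gammaLowSq α c)) < 4 := by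
    have hlim : ContinuousAt
        (fun α : ℝ => Real.exp 1 * ((1 + α ^ 2) ^ 2 * (1 + gammaLowSq α c))) 0 := by fun_prop
    refine hlim.eventually_lt continuousAt_const ?_
    rw [gammaLowSq_zero]
    have : c / (8 - c) ≤ 1 / 7 := by
      rw [div_le_div_iff₀ h8 (by norm_num)]
      linarith
    nlinarith [Real.exp_pos 1]
  have h2 : ∀ᶠ α in 𝓝 (0 : ℝ), -(1 / 2) < gammaLowSq α c := by
    refine continuousAt_const.eventually_lt hcont ?_
    rw [gammaLowSq_zero]
    have : 0 < c / (8 - c) := div_pos hc h8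
    linarith
  obtain ⟨ε, hε, hball⟩ := Metric.eventually_nhds_iff.1 (h1.and h2)
  refine ⟨min (ε / 2) (c / 32), ⟨by positivity, (min_le_right _ _).trans_lt (by linarith)⟩,
    fun α hα => ?_⟩
  have hαε : α ≤ ε / 2 := hα.2.trans (min_le_left _ _)
  have hαc : α ≤ c / 32 := hα.2.trans (min_le_right _ _)
  have hα0 : 0 < α := hα.1
  obtain ⟨h3, h4⟩ := hball (y := α) (by
    rw [Real.dist_eq, sub_zero, abs_of_pos hα0]
    linarith)
  refine ⟨?_, h3⟩
  rw [lamLow, div_mul_eq_mul_div, le_div_iff₀ (by positivity)]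
  have h5 : 1 ≤ (1 + α ^ 2) ^ 2 := one_le_pow₀ (by nlinarith)
  calc 8 * π * (2 * α) ≤ π * c * 1 * (1 / 2) := by nlinarith [Real.pi_pos]
    _ ≤ π * c * (1 + α ^ 2) ^ 2 * (1 + gammaLowSq α c) := by
      gcongr
      linarith

/-! ### Transfer to the Euclidean plane -/

/-- The standard isometry of `ℂ` with the Euclidean plane. -/
def planeEquiv : ℂ ≃ₗᵢ[ℝ] R2 := Complex.orthonormalBasisOneI.repr

lemma planeEquiv_apply_zero (z : ℂ) : planeEquiv z 0 = z.re := by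
  simp [planeEquiv]

lemma planeEquiv_apply_one (z : ℂ) : planeEquiv z 1 = z.im := by
  simp [planeEquiv]

lemma planeEquiv_symm_single_zero :
    planeEquiv.symm (EuclideanSpace.single (0 : Fin 2) (1 : ℝ)) = 1 := by
  simp [planeEquiv]

lemma planeEquiv_symm_single_one :
    planeEquiv.symm (EuclideanSpace.single (1 : Fin 2) (1 : ℝ)) = Complex.I := by
  simp [planeEquiv]

lemma lap_comp_planeEquiv_symm {u : ℂ → ℝ} {p : R2} (hu : ContDiffAt ℝ 2 u (planeEquiv.symm p)) :
    lap (fun q => u (planeEquiv.symm q)) p = Laplacian.laplacian u (planeEquiv.symm p) := by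
  rw [laplacian_eq_lines hu, lap, Fin.sum_univ_two]
  simp only [map_add, map_smul, planeEquiv_symm_single_zero, planeEquiv_symm_single_one]

lemma isSolP_comp_planeEquiv_symm {Ω : Set R2} {lam : ℝ} {u : ℂ → ℝ}
    (h2 : ∀ z ∈ planeEquiv ⁻¹' Ω, ContDiffAt ℝ 2 u z)
    (hc : ContinuousOn u (closure (planeEquiv ⁻¹' Ω)))
    (h0 : ∀ z ∈ frontier (planeEquiv ⁻¹' Ω), u z = 0)
    (heq : ∀ z ∈ planeEquiv ⁻¹' Ω, -Laplacian.laplacian u z =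
      lam * Real.exp (u z) / ∫ w in planeEquiv ⁻¹' Ω, Real.exp (u w)) :
    IsSolP Ω lam (fun p => u (planeEquiv.symm p)) := by
  have hcl : closure (planeEquiv ⁻¹' Ω) = planeEquiv ⁻¹' closure Ω :=
    (planeEquiv.toHomeomorph.preimage_closure Ω).symm
  have hfr : frontier (planeEquiv ⁻¹' Ω) = planeEquiv ⁻¹' frontier Ω :=
    (planeEquiv.toHomeomorph.preimage_frontier Ω).symm
  have hmem : ∀ p ∈ Ω, planeEquiv.symm p ∈ planeEquiv ⁻¹' Ω := fun p hp => by
    rwa [mem_preimage, planeEquiv.apply_symm_apply]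
  refine ⟨fun p hp => ?_, ?_, fun p hp => h0 _ ?_, fun p hp => ?_⟩
  · exact ((h2 _ (hmem p hp)).comp p
      planeEquiv.symm.contDiff.contDiffAt).contDiffWithinAt
  · refine hc.comp planeEquiv.symm.continuous.continuousOn fun p hp => ?_
    rwa [hcl, mem_preimage, planeEquiv.apply_symm_apply]
  · rwa [hfr, mem_preimage, planeEquiv.apply_symm_apply]
  · rw [lap_comp_planeEquiv_symm (h2 _ (hmem p hp)), heq _ (hmem p hp)]
    have := planeEquiv.measurePreserving.setIntegral_preimage_emb
      planeEquiv.toHomeomorph.measurableEmbedding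
      (fun q => Real.exp (u (planeEquiv.symm q))) Ω
    simp only [planeEquiv.symm_apply_apply] at this
    rw [this]

lemma exists_isSolP {α c : ℝ} (hα : 0 < α)
    (hsmall : Real.exp 1 * ((1 + α ^ 2) ^ 2 * (1 + gammaLowSq α c)) < 4)
    {Ω : Set R2} (hΩ : IsSimpleDomain Ω) (hs : Sandwiched α c Ω) {lam : ℝ}
    (hlam : lam ∈ Ioc 0 (lamLow α c)) : ∃ u : R2 → ℝ, IsSolP Ω lam u := by
  obtain ⟨hopen, hbdd, hsc, -⟩ := hΩ
  obtain ⟨βm, βp, hβm, hβ, hc, hin, hout⟩ := hs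
  have hβp : 0 < βp := hβm.trans_le hβ
  have hUo : IsOpen (planeEquiv ⁻¹' Ω) := hopen.preimage planeEquiv.continuous
  have hUb : Bornology.IsBounded (planeEquiv ⁻¹' Ω) :=
    planeEquiv.antilipschitz.isBounded_preimage hbdd
  have hUc : IsSimplyConnected (planeEquiv ⁻¹' Ω) :=
    planeEquiv.toHomeomorph.isSimplyConnected_preimage.2 hsc
  obtain ⟨φ, ψ, hφ, hψ, hm, hm', hl, hr, hd⟩ := exists_biholomorphic_ball hUo hUc hUb
  have h : IsRiemannMap (planeEquiv ⁻¹' Ω) φ ψ := ⟨hUo, hUb, hφ, hψ, hm, hm', hl, hr, hd⟩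
  have hvol : π * βm ^ 2 / α ≤ volume.real (planeEquiv ⁻¹' Ω) :=
    le_volume_of_ellipse_subset hUb hα hβm fun z hz => hin (by
      simpa [EllipseSet, planeEquiv_apply_zero, planeEquiv_apply_one] using hz)
  have hτ : ∀ z ∈ planeEquiv ⁻¹' Ω, greenOp (planeEquiv ⁻¹' Ω) φ (fun _ => 1) z ≤ βp ^ 2 / 2 :=
    fun z hz => h.greenOp_one_le (α := α) (fun w hw => by
      simpa [EllipseSet, planeEquiv_apply_zero, planeEquiv_apply_one] using hout hw) hz
  have hmass : lam * Real.exp 1 * (βp ^ 2 / 2) < volume.real (planeEquiv ⁻¹' Ω) := by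
    refine lt_of_lt_of_le ?_ hvol
    calc lam * Real.exp 1 * (βp ^ 2 / 2) ≤ lamLow α c * Real.exp 1 * (βp ^ 2 / 2) := by
          gcongr
          exact hlam.2
      _ = π * βm ^ 2 / α * (Real.exp 1 * ((1 + α ^ 2) ^ 2 * (1 + gammaLowSq α c)) / 4) := by
          rw [lamLow]
          generalize gammaLowSq α c = g
          rw [hc]
          field_simp
          ring
      _ < π * βm ^ 2 / α * 1 := by
          gcongr
          linarith
      _ = _ := mul_one _
  obtain ⟨u, h2, hcl, h0, heq⟩ := h.exists_solution hUc.nonempty hτ hlam.1 hmass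
  exact ⟨_, isSolP_comp_planeEquiv_symm h2 hcl h0 heq⟩

end MeanField

/-- For every `c ∈ (0,1]` there is `α_*(c) ∈ (0,1)` such that `λ̲(α,c) ≥ 8π` for all
`α ∈ (0, α_*(c)]`, and for all such `α`, every simple `(α,c)`-sandwiched domain `Ω` and every
`λ ∈ (0, λ̲(α,c)]`, the problem `P(λ,Ω)` admits a solution. -/
theorem statement0 :
    ∀ c ∈ Set.Ioc (0 : ℝ) 1, ∃ αs ∈ Set.Ioo (0 : ℝ) 1,
      (∀ α ∈ Set.Ioc (0 : ℝ) αs, 8 * π ≤ lamLow α c) ∧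
      ∀ α ∈ Set.Ioc (0 : ℝ) αs, ∀ Ω : Set R2, IsSimpleDomain Ω → Sandwiched α c Ω →
        ∀ lam ∈ Set.Ioc (0 : ℝ) (lamLow α c), ∃ u : R2 → ℝ, IsSolP Ω lam u := by
  intro c hc
  obtain ⟨αs, hαs, h⟩ := MeanField.exists_threshold hc.1 hc.2
  exact ⟨αs, hαs, fun α hα => (h α hα).1, fun α hα Ω hΩ hs lam hlam =>
    MeanField.exists_isSolP hα.1 (h α hα).2 hΩ hs hlam⟩
end
end

section
/- For every c ∈ (0,1] there exists α_*(c) ∈ (0,1) with the following property. Let α ∈ (0, α_*(c)], let Ω ⊂ ℝ² be a regular domain that is (α,c)-sandwiched, let μ ∈ (0, (1+α²)²/2], and let u ∈ C²(Ω) ∩ C⁰(cl Ω) solve −Δu = μ e^u in Ω with u = 0 on ∂Ω and 0 ≤ u ≤ v_{α,γ⁺(α,μ)} in Ω, and set λ = μ ∫_Ω e^u. Then u is a strict local minimizer of the free energy F_λ with respect to smooth compactly supported perturbations: there exists ε > 0 such that F_λ(u + φ) > F_λ(u) for every φ ∈ C_c^∞(Ω) with 0 < (∫_Ω (φ² + |∇φ|²))^{1/2}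 ≤ ε. -/
open MeasureTheory Real Set Filter

noncomputable section

/-- Identification of `R2` with `ℂ`. -/
def toC (p : R2) : ℂ := (p 0 : ℂ) + (p 1 : ℂ) * Complex.I

/-- A regular domain: a simple domain whose boundary is a continuous piecewise `C²` Jordan
curve with bounded derivative, having at most finitely many corner points: at each corner the
one-sided limiting tangent vectors exist, are nonzero and non-parallel (so that the inner angle
is well defined and lies in `(0, 2π) \ {π}`), and each corner admits a conformal bijection of a
neighborhood mapping the boundary onto a `C²` curve. -/
def IsRegularDomain (Ω : Set R2) : Prop :=
  IsSimpleDomain Ω ∧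
    ∃ (γ : ℝ → R2) (m : ℕ) (t : Fin m → ℝ) (C : ℝ),
      ContinuousOn γ (Icc 0 1) ∧ γ 0 = γ 1 ∧ InjOn γ (Ico 0 1) ∧
      γ '' Icc 0 1 = frontier Ω ∧
      StrictMono t ∧ (∀ i, t i ∈ Ico (0 : ℝ) 1) ∧
      (∀ s ∈ Icc (0 : ℝ) 1, (∀ i, s ≠ t i) →
        ContDiffWithinAt ℝ 2 γ (Icc 0 1) s ∧ ‖derivWithin γ (Icc 0 1) s‖ ≤ C) ∧
      (∀ i : Fin m, ∃ vm vp : R2, vm ≠ 0 ∧ vp ≠ 0 ∧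
        Filter.Tendsto (fun s => (s - t i)⁻¹ • (γ s - γ (t i)))
          (nhdsWithin (t i) (Iio (t i))) (nhds vm) ∧
        Filter.Tendsto (fun s => (s - t i)⁻¹ • (γ s - γ (t i)))
          (nhdsWithin (t i) (Ioi (t i))) (nhds vp) ∧
        (∀ r : ℝ, vp ≠ r • vm)) ∧
      (∀ i : Fin m, ∃ (U : Set ℂ) (f : ℂ → ℂ) (η : ℝ → ℂ),
        IsOpen U ∧ toC (γ (t i)) ∈ U ∧ DifferentiableOn ℂ f U ∧ InjOn f U ∧
        ContDiff ℝ 2 η ∧ f '' (U ∩ toC '' frontier Ω) ⊆ Set.range η)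

/-- `v_{α,γ}(x,y) = 2 log((1+γ²)/(1+γ²(α²x²+y²)))`. -/
def vag (α γ : ℝ) (p : R2) : ℝ :=
  2 * Real.log ((1 + γ ^ 2) / (1 + γ ^ 2 * (α ^ 2 * p 0 ^ 2 + p 1 ^ 2)))

/-- `γ⁺(α,μ)²`. -/
def gammaPlusSq (α μ : ℝ) : ℝ :=
  (2 * (1 + α ^ 2) - μ - 2 * Real.sqrt ((1 + α ^ 2) ^ 2 - 2 * μ)) / (μ + 4 * (1 - α ^ 2))

/-- `γ⁺(α,μ)`. -/
def gammaPlus (α μ : ℝ) : ℝ := Real.sqrt (gammaPlusSq α μ)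

/-- `φ ∈ C_c^∞(Ω)`. -/
def IsTestFun (Ω : Set R2) (φ : R2 → ℝ) : Prop :=
  ContDiff ℝ (⊤ : ℕ∞) φ ∧ HasCompactSupport φ ∧ tsupport φ ⊆ Ω

/-- The free-energy functional `F_λ(u) = (1/2)∫_Ω |∇u|² − λ log ∫_Ω eᵘ`. -/
def freeEnergy (Ω : Set R2) (lam : ℝ) (u : R2 → ℝ) : ℝ :=
  (1 / 2) * (∫ p in Ω, ‖gradient u p‖ ^ 2) - lam * Real.log (∫ p in Ω, Real.exp (u p))

/-- `u` has finite Dirichlet energy on `Ω`. -/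
def FiniteDirichlet (Ω : Set R2) (u : R2 → ℝ) : Prop :=
  IntegrableOn (fun p => ‖gradient u p‖ ^ 2) Ω

section PartialDerivatives

/-- The product of a function continuous on an open set with a continuous function supported
in that set is continuous. -/
lemma continuous_mul_of_tsupport_subset {X : Type*} [TopologicalSpace X] {Ω : Set X}
    (hΩ : IsOpen Ω) {a ψ : X → ℝ} (ha : ContinuousOn a Ω) (hψ : Continuous ψ)
    (hs : tsupport ψ ⊆ Ω) : Continuous fun x => ψ x * a x := by
  rw [continuous_iff_continuousAt]
  intro x
  by_cases hx : x ∈ tsupport ψ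
  · exact hψ.continuousAt.mul (ha.continuousAt (hΩ.mem_nhds (hs hx)))
  · have h0 : (fun x => ψ x * a x) =ᶠ[nhds x] fun _ => 0 := by
      filter_upwards [(isClosed_tsupport ψ).isOpen_compl.mem_nhds hx] with y hy
      rw [image_eq_zero_of_notMem_tsupport hy, zero_mul]
    exact continuousAt_const.congr h0.symm

lemma integrable_mul_of_tsupport_subset {Ω : Set R2} (hΩ : IsOpen Ω) {a ψ : R2 → ℝ}
    (ha : ContinuousOn a Ω) (hψ : Continuous ψ) (hc : HasCompactSupport ψ)
    (hs : tsupport ψ ⊆ Ω) : Integrable fun x => ψ x * a x :=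
  (continuous_mul_of_tsupport_subset hΩ ha hψ hs).integrable_of_hasCompactSupport hc.mul_right

/-- Integration by parts against a compactly supported function. -/
lemma integral_mul_fderiv_of_tsupport_subset {Ω : Set R2} (hΩ : IsOpen Ω) {a ψ : R2 → ℝ}
    (ha : ContDiffOn ℝ 1 a Ω) (hψ : ContDiff ℝ 1 ψ) (hc : HasCompactSupport ψ)
    (hs : tsupport ψ ⊆ Ω) (v : R2) :
    ∫ x, ψ x * fderiv ℝ a x v = -∫ x, fderiv ℝ ψ x v * a x := by
  have hda : ContinuousOn (fun x => fderiv ℝ a x v) Ω :=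
    (ha.continuousOn_fderiv_of_isOpen hΩ le_rfl).clm_apply continuousOn_const
  have hdψ : Continuous fun x => fderiv ℝ ψ x v :=
    (hψ.continuous_fderiv one_ne_zero).clm_apply continuous_const
  refine integral_smul_fderiv_eq_neg_fderiv_smul_of_integrable (f := ψ) (g := a) (v := v)
    ?_ ?_ ?_ ?_ ?_
  · exact integrable_mul_of_tsupport_subset hΩ ha.continuousOn hdψ
      (hc.fderiv_apply ℝ v) ((tsupport_fderiv_apply_subset ℝ v).trans hs)
  · exact integrable_mul_of_tsupport_subset hΩ hda hψ.continuous hc hs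
  · exact integrable_mul_of_tsupport_subset hΩ ha.continuousOn hψ.continuous hc hs
  · exact fun x _ => hψ.differentiable one_ne_zero x
  · exact fun x hx => (ha.differentiableOn one_ne_zero).differentiableAt (hΩ.mem_nhds (hs hx))

/-- The inner product of gradients in coordinates. -/
lemma inner_gradient_gradient (f g : R2 → ℝ) (p : R2) :
    inner ℝ (gradient f p) (gradient g p) =
      ∑ i, fderiv ℝ f p (EuclideanSpace.single i 1) * fderiv ℝ g p (EuclideanSpace.single i 1) := by
  have h (f : R2 → ℝ) (i : Fin 2) :
      fderiv ℝ f p (EuclideanSpace.single i 1) = gradient f p i := by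
    rw [← inner_gradient_left, EuclideanSpace.inner_single_right]
    simp
  simp only [h]
  rw [PiLp.inner_apply]
  simp [mul_comm]

lemma norm_gradient (f : R2 → ℝ) (p : R2) : ‖gradient f p‖ = ‖fderiv ℝ f p‖ := by
  simp [gradient]

lemma norm_gradient_sq (f : R2 → ℝ) (p : R2) :
    ‖gradient f p‖ ^ 2 = ∑ i, fderiv ℝ f p (EuclideanSpace.single i 1) ^ 2 := by
  rw [← real_inner_self_eq_norm_sq, inner_gradient_gradient]
  simp [sq]

/-- Partial derivatives of a `C²` function are `C¹`. -/
lemma contDiffOn_fderiv_apply {Ω : Set R2} (hΩ : IsOpen Ω) {w : R2 → ℝ}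
    (hw : ContDiffOn ℝ 2 w Ω) (v : R2) : ContDiffOn ℝ 1 (fun q => fderiv ℝ w q v) Ω :=
  (hw.fderiv_of_isOpen hΩ (by norm_num)).clm_apply contDiffOn_const

lemma lap_eq_sum_fderiv {Ω : Set R2} (hΩ : IsOpen Ω) {w : R2 → ℝ}
    (hw : ContDiffOn ℝ 2 w Ω) {p : R2} (hp : p ∈ Ω) :
    lap w p = ∑ i : Fin 2, fderiv ℝ (fun q => fderiv ℝ w q (EuclideanSpace.single i 1)) p
      (EuclideanSpace.single i 1) := by
  refine Finset.sum_congr rfl fun i _ => ?_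
  set e : R2 := EuclideanSpace.single i 1
  have hline (t : ℝ) : HasDerivAt (fun t : ℝ => p + t • e) e t := by
    simpa using ((hasDerivAt_id t).smul_const e).const_add p
  have hnhds : ∀ᶠ t : ℝ in nhds 0, p + t • e ∈ Ω := by
    refine (hline 0).continuousAt.eventually_mem (hΩ.mem_nhds ?_)
    simpa using hp
  have h1 : deriv (fun t : ℝ => w (p + t • e)) =ᶠ[nhds 0] fun t => fderiv ℝ w (p + t • e) e := by
    filter_upwards [hnhds] with t ht
    exact (((hw.differentiableOn two_ne_zero).differentiableAt
      (hΩ.mem_nhds ht)).hasFDerivAt.comp_hasDerivAt t (hline t)).deriv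
  rw [iteratedDeriv_succ, iteratedDeriv_one, h1.deriv_eq]
  have h2 : HasFDerivAt (fun q => fderiv ℝ w q e) (fderiv ℝ (fun q => fderiv ℝ w q e) p)
      (p + (0 : ℝ) • e) := by
    simpa using (((contDiffOn_fderiv_apply hΩ hw e).differentiableOn one_ne_zero).differentiableAt
      (hΩ.mem_nhds hp)).hasFDerivAt
  exact (h2.comp_hasDerivAt 0 (hline 0)).deriv

lemma continuousOn_gradient {Ω : Set R2} (hΩ : IsOpen Ω) {w : R2 → ℝ}
    (hw : ContDiffOn ℝ 1 w Ω) : ContinuousOn (gradient w) Ω :=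
  (InnerProductSpace.toDual ℝ R2).symm.continuous.comp_continuousOn
    (hw.continuousOn_fderiv_of_isOpen hΩ le_rfl)

lemma gradient_eq_zero_of_notMem_tsupport {ψ : R2 → ℝ} {x : R2} (hx : x ∉ tsupport ψ) :
    gradient ψ x = 0 := by
  have : fderiv ℝ ψ x = 0 :=
    image_eq_zero_of_notMem_tsupport fun h => hx (tsupport_fderiv_subset (𝕜 := ℝ) h)
  simp [gradient, this]

/-- Green's first identity on an open set, against a compactly supported function. -/
lemma integral_inner_gradient_eq_neg_integral_lap {Ω : Set R2} (hΩ : IsOpen Ω) {w ψ : R2 → ℝ}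
    (hw : ContDiffOn ℝ 2 w Ω) (hψ : ContDiff ℝ 1 ψ) (hc : HasCompactSupport ψ)
    (hs : tsupport ψ ⊆ Ω) :
    ∫ x in Ω, inner ℝ (gradient ψ x) (gradient w x) = -∫ x in Ω, ψ x * lap w x := by
  have hzero (x : R2) (hx : x ∉ Ω) : x ∉ tsupport ψ := fun h => hx (hs h)
  have hpart (i : Fin 2) := contDiffOn_fderiv_apply hΩ hw (EuclideanSpace.single i 1)
  have hL : ∫ x in Ω, ψ x * lap w x = ∫ x, ∑ i : Fin 2, ψ x *
      fderiv ℝ (fun q => fderiv ℝ w q (EuclideanSpace.single i 1)) x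
        (EuclideanSpace.single i 1) := by
    refine Eq.trans (setIntegral_congr_fun hΩ.measurableSet fun x hx => ?_)
      (setIntegral_eq_integral_of_forall_compl_eq_zero (s := Ω) fun x hx => ?_)
    · simp only [lap_eq_sum_fderiv hΩ hw hx, Finset.mul_sum]
    · simp [image_eq_zero_of_notMem_tsupport (hzero x hx)]
  have hR : ∫ x in Ω, inner ℝ (gradient ψ x) (gradient w x) = ∫ x, ∑ i : Fin 2,
      fderiv ℝ ψ x (EuclideanSpace.single i 1) * fderiv ℝ w x (EuclideanSpace.single i 1) := by
    rw [setIntegral_eq_integral_of_forall_compl_eq_zero (s := Ω)]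
    · simp only [inner_gradient_gradient]
    · intro x hx
      simp [gradient_eq_zero_of_notMem_tsupport (hzero x hx)]
  rw [hL, hR, integral_finsetSum, integral_finsetSum, ← Finset.sum_neg_distrib]
  · refine Finset.sum_congr rfl fun i _ => ?_
    rw [integral_mul_fderiv_of_tsupport_subset hΩ (hpart i) hψ hc hs, neg_neg]
  · exact fun i _ => integrable_mul_of_tsupport_subset hΩ
      (((hpart i).continuousOn_fderiv_of_isOpen hΩ le_rfl).clm_apply continuousOn_const)
      hψ.continuous hc hs
  · exact fun i _ => integrable_mul_of_tsupport_subset hΩ (hpart i).continuousOn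
      ((hψ.continuous_fderiv one_ne_zero).clm_apply continuous_const)
      (hc.fderiv_apply ℝ _) ((tsupport_fderiv_apply_subset ℝ _).trans hs)

end PartialDerivatives

section Sobolev

lemma sq_integral_mul_le {X : Type*} [MeasurableSpace X] {ν : Measure X} {f g : X → ℝ}
    (hf : Integrable (fun x => f x ^ 2) ν) (hg : Integrable (fun x => g x ^ 2) ν)
    (hfg : Integrable (fun x => f x * g x) ν) :
    (∫ x, f x * g x ∂ν) ^ 2 ≤ (∫ x, f x ^ 2 ∂ν) * ∫ x, g x ^ 2 ∂ν := by
  have key (t : ℝ) : 0 ≤ (∫ x, g x ^ 2 ∂ν) * (t * t) + (2 * ∫ x, f x * g x ∂ν) * t +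
      ∫ x, f x ^ 2 ∂ν := by
    have h : ∫ x, (f x + t * g x) ^ 2 ∂ν = (∫ x, g x ^ 2 ∂ν) * (t * t) +
        (2 * ∫ x, f x * g x ∂ν) * t + ∫ x, f x ^ 2 ∂ν := by
      have h1 : ∀ x, (f x + t * g x) ^ 2 =
          (t * t) * g x ^ 2 + (2 * t) * (f x * g x) + f x ^ 2 := fun x => by ring
      have h2 : Integrable (fun x => (t * t) * g x ^ 2 + (2 * t) * (f x * g x)) ν :=
        (hg.const_mul _).add (hfg.const_mul _)
      simp only [h1]
      rw [integral_add h2 hf,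
        integral_add (hg.const_mul _) (hfg.const_mul _), integral_const_mul, integral_const_mul]
      ring
    rw [← h]
    positivity
  have := discrim_le_zero key
  unfold discrim at this
  nlinarith

/-- The Gagliardo–Nirenberg–Sobolev inequality in the plane. -/
lemma exists_integral_sq_le_sq_integral_fderiv : ∃ C : ℝ, 0 < C ∧ ∀ f : R2 → ℝ,
    ContDiff ℝ 1 f → HasCompactSupport f → ∫ x, f x ^ 2 ≤ C * (∫ x, ‖fderiv ℝ f x‖) ^ 2 := by
  refine ⟨lintegralPowLePowLIntegralFDerivConst (volume : Measure R2) 2 + 1, by positivity, ?_⟩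
  intro f hf hc
  have hconj : Real.HolderConjugate (Module.finrank ℝ R2) 2 := by
    rw [finrank_euclideanSpace_fin]
    exact_mod_cast Real.HolderConjugate.two_two
  have h := lintegral_pow_le_pow_lintegral_fderiv (volume : Measure R2) hf hc hconj
  have hdc : Continuous (fderiv ℝ f) := hf.continuous_fderiv one_ne_zero
  have hdi : Integrable (fderiv ℝ f) :=
    hdc.integrable_of_hasCompactSupport (hc.fderiv ℝ)
  have h1 : ∫ x, f x ^ 2 = (∫⁻ x, ‖f x‖ₑ ^ (2 : ℝ)).toReal := by
    rw [integral_eq_lintegral_of_nonneg_ae (Filter.Eventually.of_forall fun x => sq_nonneg _)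
      (hf.continuous.pow 2).aestronglyMeasurable]
    congr 1
    refine lintegral_congr fun x => ?_
    rw [← sq_abs, ENNReal.ofReal_pow (abs_nonneg _), ← Real.norm_eq_abs, ofReal_norm]
    norm_cast
  have h2 : ∫ x, ‖fderiv ℝ f x‖ = (∫⁻ x, ‖fderiv ℝ f x‖ₑ).toReal :=
    integral_norm_eq_lintegral_enorm hdi.aestronglyMeasurable
  have hfin : ∫⁻ x, ‖fderiv ℝ f x‖ₑ ≠ ⊤ := hdi.2.ne
  have h3 := ENNReal.toReal_mono (by finiteness) h
  rw [← h1, ENNReal.toReal_mul, ← ENNReal.toReal_rpow, ← h2] at h3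
  simp only [ENNReal.coe_toReal, Real.rpow_ofNat] at h3
  nlinarith [sq_nonneg (∫ x, ‖fderiv ℝ f x‖)]

lemma integrableOn_of_continuous {Ω : Set R2} (hb : Bornology.IsBounded Ω) {f : R2 → ℝ}
    (hf : Continuous f) : IntegrableOn f Ω :=
  (hf.continuousOn.integrableOn_compact hb.isCompact_closure).mono_set subset_closure

/-- Exponential integrability of functions with small Dirichlet energy: a quartic
version of the Moser–Trudinger inequality. -/
lemma exists_integral_cosh_sub_one_sq_le : ∃ C : ℝ, 0 < C ∧ ∀ Ω : Set R2, IsOpen Ω →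
    Bornology.IsBounded Ω → ∀ φ : R2 → ℝ, ContDiff ℝ 1 φ → HasCompactSupport φ →
    tsupport φ ⊆ Ω → C * (∫ p in Ω, ‖gradient φ p‖ ^ 2) ≤ 1 / 2 →
    ∫ p in Ω, (Real.cosh (φ p) - 1) ^ 2 ≤
      2 * C ^ 2 * volume.real Ω * (∫ p in Ω, ‖gradient φ p‖ ^ 2) ^ 2 := by
  obtain ⟨C, hC, hSob⟩ := exists_integral_sq_le_sq_integral_fderiv
  refine ⟨C, hC, fun Ω hΩ hb φ hφ hc hs hsmall => ?_⟩
  set D := ∫ p in Ω, ‖gradient φ p‖ ^ 2 with hD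
  simp only [norm_gradient] at hD
  have hD0 : 0 ≤ D := by rw [hD]; positivity
  have hout (x : R2) (hx : x ∉ Ω) : x ∉ tsupport φ := fun h => hx (hs h)
  have hφc := hφ.continuous
  have hdφ : Continuous fun x => ‖fderiv ℝ φ x‖ := (hφ.continuous_fderiv one_ne_zero).norm
  -- Sobolev and Cauchy–Schwarz for a composition `G ∘ φ`
  have main (G G' : ℝ → ℝ) (hG : ∀ t, HasDerivAt G (G' t) t) (hG' : Continuous G')
      (hG0 : G 0 = 0) :
      ∫ p in Ω, G (φ p) ^ 2 ≤ C * ((∫ p in Ω, G' (φ p) ^ 2) * D) := by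
    have hGd : ContDiff ℝ 1 G := by
      rw [contDiff_one_iff_deriv]
      refine ⟨fun t => (hG t).differentiableAt, ?_⟩
      rwa [show deriv G = G' from funext fun t => (hG t).deriv]
    have hder (x : R2) : ‖fderiv ℝ (fun p => G (φ p)) x‖ = |G' (φ x)| * ‖fderiv ℝ φ x‖ := by
      have := ((hG (φ x)).comp_hasFDerivAt x
        (hφ.differentiable one_ne_zero x).hasFDerivAt).fderiv
      have h2 : fderiv ℝ (fun p => G (φ p)) x = G' (φ x) • fderiv ℝ φ x := this
      rw [h2, norm_smul, Real.norm_eq_abs]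
    have h1 := hSob (fun p => G (φ p)) (hGd.comp hφ) (hc.comp_left hG0)
    simp only [hder] at h1
    rw [← setIntegral_eq_integral_of_forall_compl_eq_zero (s := Ω)
        (f := fun x => G (φ x) ^ 2), ← setIntegral_eq_integral_of_forall_compl_eq_zero (s := Ω)
        (f := fun x => |G' (φ x)| * ‖fderiv ℝ φ x‖)] at h1
    · refine h1.trans (mul_le_mul_of_nonneg_left ?_ hC.le)
      have h3 := sq_integral_mul_le (ν := volume.restrict Ω) (f := fun x => |G' (φ x)|)
        (g := fun x => ‖fderiv ℝ φ x‖)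
        (integrableOn_of_continuous hb (by fun_prop)) (integrableOn_of_continuous hb (by fun_prop))
        (integrableOn_of_continuous hb (by fun_prop))
      simpa only [sq_abs, ← hD] using h3
    · intro x hx
      have := gradient_eq_zero_of_notMem_tsupport (hout x hx)
      rw [← norm_gradient, this, norm_zero, mul_zero]
    · intro x hx
      simp [image_eq_zero_of_notMem_tsupport (hout x hx), hG0]
  have hX := main Real.sinh Real.cosh Real.hasDerivAt_sinh Real.continuous_cosh Real.sinh_zero
  have hY := main (fun t => Real.cosh t - 1) Real.sinh
    (fun t => (Real.hasDerivAt_cosh t).sub_const 1) Real.continuous_sinh (by simp)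
  have hVX : ∫ p in Ω, Real.cosh (φ p) ^ 2 = volume.real Ω + ∫ p in Ω, Real.sinh (φ p) ^ 2 := by
    simp only [Real.cosh_sq']
    rw [integral_add (integrableOn_of_continuous hb continuous_const)
      (integrableOn_of_continuous hb (by fun_prop))]
    simp
  rw [hVX] at hX
  set X := ∫ p in Ω, Real.sinh (φ p) ^ 2
  have hX0 : 0 ≤ X := by positivity
  have hX2 : X ≤ 2 * (C * D) * volume.real Ω := by nlinarith
  calc _ ≤ C * (X * D) := hY
    _ ≤ C * ((2 * (C * D) * volume.real Ω) * D) := by gcongr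
    _ = _ := by ring

end Sobolev

section Poincare

lemma exp_sub_one_sub_le (t : ℝ) :
    Real.exp t - 1 - t ≤ (1 / 2 + 1 / 1000) * t ^ 2 + 1000 * (Real.cosh t - 1) ^ 2 := by
  by_cases ht : |t| ≤ 1
  · have h := Real.exp_bound ht (n := 3) (by norm_num)
    have h1 : Real.exp t - (1 + t + t ^ 2 / 2) ≤ |t| ^ 3 * (2 / 9) := by
      refine (le_abs_self _).trans (le_trans (le_of_eq ?_) (h.trans (le_of_eq ?_)))
      · simp [Finset.sum_range_succ]
      · norm_num [Nat.factorial]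
    have h2 : t ^ 2 / 2 ≤ Real.cosh t - 1 := by
      have h6 : (t / 2) ^ 2 ≤ Real.sinh (t / 2) ^ 2 := by
        rw [sq_le_sq, Real.abs_sinh]
        exact Real.self_le_sinh_iff.mpr (abs_nonneg _)
      have h7 : Real.cosh t = 1 + 2 * Real.sinh (t / 2) ^ 2 := by
        have := Real.cosh_two_mul (t / 2)
        rw [Real.cosh_sq', mul_div_cancel₀ t two_ne_zero] at this
        linarith
      linarith
    have h3 : (t ^ 2 / 2) ^ 2 ≤ (Real.cosh t - 1) ^ 2 := by gcongr
    have h4 : |t| ^ 3 ≤ 1 / 1000 * t ^ 2 + 250 * t ^ 4 := by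
      have : t ^ 4 = |t| ^ 4 := by rw [Even.pow_abs (by decide)]
      rw [this, ← sq_abs t]
      nlinarith [mul_nonneg (sq_nonneg |t|) (sq_nonneg (|t| - 1 / 500))]
    have h5 : 0 ≤ |t| ^ 3 := by positivity
    nlinarith
  · have ht1 : 1 < |t| := not_le.mp ht
    set E := Real.exp |t| with hE
    have hE2 : 2 ≤ E := by linarith [Real.add_one_le_exp |t|]
    have h1 : Real.exp t ≤ E := Real.exp_le_exp.mpr (le_abs_self t)
    have h2 : -t ≤ E := by linarith [Real.add_one_le_exp |t|, neg_le_abs t]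
    have h3 : Real.cosh t - 1 = (E - 1) ^ 2 / (2 * E) := by
      rw [← Real.cosh_abs, Real.cosh_eq, Real.exp_neg, ← hE]
      field_simp
      ring
    have h4 : E / 8 ≤ (E - 1) ^ 2 / (2 * E) := by
      rw [div_le_div_iff₀ (by norm_num) (by positivity)]
      nlinarith
    have h5 : (E / 8) ^ 2 ≤ (Real.cosh t - 1) ^ 2 := by rw [h3]; gcongr
    nlinarith [sq_nonneg t]

/-- Poincaré inequality in the strip `|y| ≤ 1`. -/
lemma integral_sq_le_integral_norm_gradient_sq {Ω : Set R2} (hΩ : IsOpen Ω)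
    (hstrip : ∀ p ∈ Ω, |p 1| ≤ 1) {φ : R2 → ℝ} (hφ : ContDiff ℝ 1 φ) (hc : HasCompactSupport φ)
    (hs : tsupport φ ⊆ Ω) :
    ∫ p in Ω, φ p ^ 2 ≤ ∫ p in Ω, ‖gradient φ p‖ ^ 2 := by
  set e : R2 := EuclideanSpace.single 1 1
  have hcos (p : R2) (hp : p ∈ Ω) : Real.cos (p 1) ≠ 0 := by
    have h := abs_le.mp (hstrip p hp)
    have hpi := Real.pi_gt_three
    exact (Real.cos_pos_of_mem_Ioo ⟨by linarith, by linarith⟩).ne'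
  have hcoord : ContDiff ℝ 1 fun p : R2 => p 1 :=
    (EuclideanSpace.proj (𝕜 := ℝ) (1 : Fin 2)).contDiff
  have htan : ContDiffOn ℝ 1 (fun p : R2 => Real.tan (p 1)) Ω := by
    intro p hp
    exact ((Real.contDiffAt_tan.mpr (hcos p hp)).comp p hcoord.contDiffAt).contDiffWithinAt
  have hdtan (p : R2) (hp : p ∈ Ω) :
      fderiv ℝ (fun p : R2 => Real.tan (p 1)) p e = 1 + Real.tan (p 1) ^ 2 := by
    have h := (Real.hasDerivAt_tan (hcos p hp)).comp_hasFDerivAt p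
      (EuclideanSpace.proj (𝕜 := ℝ) (1 : Fin 2)).hasFDerivAt
    have h2 : fderiv ℝ (fun p : R2 => Real.tan (p 1)) p =
      (1 / Real.cos (p 1) ^ 2) • (EuclideanSpace.proj (𝕜 := ℝ) (1 : Fin 2)) := h.fderiv
    rw [h2]
    simp only [smul_apply, smul_eq_mul, e]
    rw [← Real.inv_one_add_tan_sq (hcos p hp)]
    simp
  have hsq : ContDiff ℝ 1 fun p => φ p ^ 2 := hφ.pow 2
  have hsub : tsupport (fun p => φ p ^ 2) ⊆ tsupport φ :=
    closure_mono fun p hp h => hp (by simp [h])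
  have hcsq : HasCompactSupport fun p => φ p ^ 2 := hc.mono' (subset_closure.trans hsub)
  have hdsq (p : R2) : fderiv ℝ (fun p => φ p ^ 2) p e = 2 * φ p * fderiv ℝ φ p e := by
    have h := ((hφ.differentiable one_ne_zero p).hasFDerivAt.pow 2).fderiv
    have h2 : fderiv ℝ (fun p => φ p ^ 2) p = (2 • φ p ^ (2 - 1)) • fderiv ℝ φ p := h
    rw [h2]
    simp
  have hibp := integral_mul_fderiv_of_tsupport_subset hΩ htan hsq hcsq (hsub.trans hs) e
  have hi1 := integrable_mul_of_tsupport_subset hΩ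
    ((htan.continuousOn_fderiv_of_isOpen hΩ le_rfl).clm_apply (continuousOn_const (c := e)))
    hsq.continuous hcsq (hsub.trans hs)
  have hi2 := integrable_mul_of_tsupport_subset hΩ htan.continuousOn
    ((hsq.continuous_fderiv one_ne_zero).clm_apply (continuous_const (y := e)))
    (hcsq.fderiv_apply ℝ e) ((tsupport_fderiv_apply_subset ℝ e).trans (hsub.trans hs))
  have hgc : Continuous fun p => ‖gradient φ p‖ ^ 2 := by
    simp only [norm_gradient]
    exact (hφ.continuous_fderiv one_ne_zero).norm.pow 2
  have hgs : HasCompactSupport fun p => ‖gradient φ p‖ ^ 2 := by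
    refine HasCompactSupport.intro hc fun p hp => ?_
    simp [gradient_eq_zero_of_notMem_tsupport hp]
  have hout (x : R2) (hx : x ∉ Ω) : x ∉ tsupport φ := fun h => hx (hs h)
  rw [setIntegral_eq_integral_of_forall_compl_eq_zero (s := Ω) (f := fun p => φ p ^ 2),
    setIntegral_eq_integral_of_forall_compl_eq_zero (s := Ω) (f := fun p => ‖gradient φ p‖ ^ 2)]
  · have hsum : ∫ x, (φ x ^ 2 * fderiv ℝ (fun p : R2 => Real.tan (p 1)) x e +
        fderiv ℝ (fun p => φ p ^ 2) x e * Real.tan (x 1)) = 0 := by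
      rw [integral_add hi1 hi2, hibp, neg_add_cancel]
    have hle : ∫ x, φ x ^ 2 ≤ ∫ x, (‖gradient φ x‖ ^ 2 +
        (φ x ^ 2 * fderiv ℝ (fun p : R2 => Real.tan (p 1)) x e +
          fderiv ℝ (fun p => φ p ^ 2) x e * Real.tan (x 1))) := by
      refine integral_mono (hsq.continuous.integrable_of_hasCompactSupport hcsq)
        ((hgc.integrable_of_hasCompactSupport hgs).add (hi1.add hi2)) fun x => ?_
      by_cases hx : x ∈ Ω
      · simp only [hdtan x hx, hdsq, norm_gradient_sq, Fin.sum_univ_two]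
        nlinarith [sq_nonneg (fderiv ℝ φ x (EuclideanSpace.single 0 1)),
          sq_nonneg (fderiv ℝ φ x e + φ x * Real.tan (x 1))]
      · simp [hdsq, image_eq_zero_of_notMem_tsupport (hout x hx)]
    have hi3 : Integrable fun x => φ x ^ 2 * fderiv ℝ (fun p : R2 => Real.tan (p 1)) x e +
        fderiv ℝ (fun p => φ p ^ 2) x e * Real.tan (x 1) := hi1.add hi2
    rwa [integral_add (hgc.integrable_of_hasCompactSupport hgs) hi3, hsum, add_zero] at hle
  · exact fun x hx => by simp [gradient_eq_zero_of_notMem_tsupport (hout x hx)]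
  · exact fun x hx => by simp [image_eq_zero_of_notMem_tsupport (hout x hx)]

end Poincare

section DirichletEnergy

/-- A smooth monotone cut-off of the identity, vanishing on `(-∞, ε]`. -/
def idCutoff (ε t : ℝ) : ℝ := t * Real.smoothTransition (t / ε - 1)

lemma idCutoff_eq_zero {ε t : ℝ} (hε : 0 < ε) (ht : t ≤ ε) : idCutoff ε t = 0 := by
  have : t / ε ≤ 1 := (div_le_one hε).mpr ht
  rw [idCutoff, Real.smoothTransition.zero_of_nonpos (by linarith), mul_zero]

lemma contDiff_idCutoff (ε : ℝ) : ContDiff ℝ 1 (idCutoff ε) :=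
  contDiff_id.mul (Real.smoothTransition.contDiff.comp
    ((contDiff_id.div_const ε).sub contDiff_const))

lemma abs_idCutoff_le (ε t : ℝ) : |idCutoff ε t| ≤ |t| := by
  rw [idCutoff, abs_mul, abs_of_nonneg (Real.smoothTransition.nonneg _)]
  exact mul_le_of_le_one_right (abs_nonneg _) (Real.smoothTransition.le_one _)

lemma monotone_idCutoff {ε : ℝ} (hε : 0 < ε) : Monotone (idCutoff ε) := by
  intro s t hst
  by_cases hs : s ≤ ε
  · rw [idCutoff_eq_zero hε hs]
    by_cases ht : t ≤ ε
    · rw [idCutoff_eq_zero hε ht]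
    · exact mul_nonneg (hε.le.trans (not_le.mp ht).le) (Real.smoothTransition.nonneg _)
  · have hs0 : 0 ≤ s := hε.le.trans (not_le.mp hs).le
    refine mul_le_mul hst (Real.smoothTransition.monotone ?_) (Real.smoothTransition.nonneg _)
      (hs0.trans hst)
    gcongr

lemma deriv_idCutoff_eq_one {ε t : ℝ} (hε : 0 < ε) (ht : 2 * ε < t) :
    deriv (idCutoff ε) t = 1 := by
  have h : idCutoff ε =ᶠ[nhds t] id := by
    filter_upwards [eventually_gt_nhds ht] with s hs
    have : 2 ≤ s / ε := (le_div_iff₀ hε).mpr hs.le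
    rw [idCutoff, Real.smoothTransition.one_of_one_le (by linarith), mul_one, id]
  rw [h.deriv_eq, deriv_id]

/-- A nonnegative `C²` function vanishing on the boundary, with bounded Laplacian, has finite
Dirichlet energy. -/
lemma finiteDirichlet_of_lap_bounded {Ω : Set R2} (hΩ : IsOpen Ω) (hb : Bornology.IsBounded Ω)
    {u : R2 → ℝ} (hu : ContDiffOn ℝ 2 u Ω) (huc : ContinuousOn u (closure Ω))
    (hbd : ∀ p ∈ frontier Ω, u p = 0) (hpos : ∀ p ∈ Ω, 0 ≤ u p) {K : ℝ}
    (hK : ∀ p ∈ Ω, |lap u p| ≤ K) : FiniteDirichlet Ω u := by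
  have hvol : volume Ω < ⊤ := hb.measure_lt_top
  obtain ⟨B, hB⟩ := hb.isCompact_closure.exists_bound_of_continuousOn huc
  have hgradc : ContinuousOn (gradient u) Ω :=
    continuousOn_gradient hΩ (hu.of_le (by norm_num))
  have hdiff (p : R2) (hp : p ∈ Ω) : DifferentiableAt ℝ u p :=
    (hu.differentiableOn two_ne_zero).differentiableAt (hΩ.mem_nhds hp)
  have henergy (ε : ℝ) (hε : 0 < ε) :
      ∫⁻ p in Ω, ENNReal.ofReal (deriv (idCutoff ε) (u p) * ‖gradient u p‖ ^ 2) ≤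
        ENNReal.ofReal (B * K * volume.real Ω) := by
    set ψ : R2 → ℝ := Ω.indicator fun p => idCutoff ε (u p) with hψ
    have hψΩ (p : R2) (hp : p ∈ Ω) : ψ =ᶠ[nhds p] fun p => idCutoff ε (u p) := by
      filter_upwards [hΩ.mem_nhds hp] with q hq
      exact indicator_of_mem hq _
    set S : Set R2 := closure Ω ∩ u ⁻¹' Ici ε
    have hSc : IsClosed S := huc.preimage_isClosed_of_isClosed isClosed_closure isClosed_Ici
    have hScomp : IsCompact S := hb.isCompact_closure.of_isClosed_subset hSc inter_subset_left
    have hSΩ : S ⊆ Ω := by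
      intro p hp
      by_contra hpΩ
      have h0 := hbd p (hΩ.frontier_eq ▸ ⟨hp.1, hpΩ⟩)
      have h1 : ε ≤ u p := hp.2
      linarith
    have hψS : tsupport ψ ⊆ S := by
      refine closure_minimal (fun p hp => ?_) hSc
      have hpΩ : p ∈ Ω := mem_of_indicator_ne_zero hp
      refine ⟨subset_closure hpΩ, ?_⟩
      by_contra hlt
      exact hp (by rw [hψ, indicator_of_mem hpΩ, idCutoff_eq_zero hε (not_le.mp hlt).le])
    have hψs : tsupport ψ ⊆ Ω := hψS.trans hSΩ
    have hψc : HasCompactSupport ψ := hScomp.of_isClosed_subset (isClosed_tsupport ψ) hψS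
    have hψd : ContDiff ℝ 1 ψ := by
      rw [contDiff_iff_contDiffAt]
      intro p
      by_cases hp : p ∈ Ω
      · have h1 : ContDiffAt ℝ 1 u p := (hu.contDiffAt (hΩ.mem_nhds hp)).of_le (by norm_num)
        exact ((contDiff_idCutoff ε).contDiffAt.comp p h1).congr_of_eventuallyEq (hψΩ p hp)
      · have h0 : ψ =ᶠ[nhds p] fun _ => 0 := by
          filter_upwards [(isClosed_tsupport ψ).isOpen_compl.mem_nhds
            fun h => hp (hψs h)] with q hq
          exact image_eq_zero_of_notMem_tsupport hq
        exact contDiffAt_const.congr_of_eventuallyEq h0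
    have hgrad (p : R2) (hp : p ∈ Ω) : inner ℝ (gradient ψ p) (gradient u p) =
        deriv (idCutoff ε) (u p) * ‖gradient u p‖ ^ 2 := by
      have h1 : fderiv ℝ (fun p => idCutoff ε (u p)) p = deriv (idCutoff ε) (u p) • fderiv ℝ u p :=
        ((((contDiff_idCutoff ε).differentiable one_ne_zero (u p)).hasDerivAt).comp_hasFDerivAt p
          (hdiff p hp).hasFDerivAt).fderiv
      rw [← real_inner_self_eq_norm_sq, inner_gradient_left, inner_gradient_left,
        (hψΩ p hp).fderiv_eq, h1]
      simp
    have hint : IntegrableOn (fun p => inner ℝ (gradient ψ p) (gradient u p)) Ω := by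
      simp only [inner_gradient_gradient]
      refine (integrable_finsetSum _ fun i _ => ?_).integrableOn
      exact integrable_mul_of_tsupport_subset hΩ (contDiffOn_fderiv_apply hΩ hu _).continuousOn
        ((hψd.continuous_fderiv one_ne_zero).clm_apply continuous_const)
        (hψc.fderiv_apply ℝ _) ((tsupport_fderiv_apply_subset ℝ _).trans hψs)
    have hnonneg (p : R2) : 0 ≤ deriv (idCutoff ε) (u p) * ‖gradient u p‖ ^ 2 :=
      mul_nonneg (monotone_idCutoff hε).deriv_nonneg (sq_nonneg _)
    have hint2 : IntegrableOn (fun p => deriv (idCutoff ε) (u p) * ‖gradient u p‖ ^ 2) Ω :=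
      hint.congr_fun hgrad hΩ.measurableSet
    rw [← ofReal_integral_eq_lintegral_ofReal hint2 (Filter.Eventually.of_forall hnonneg)]
    refine ENNReal.ofReal_le_ofReal ?_
    rw [← setIntegral_congr_fun hΩ.measurableSet hgrad,
      integral_inner_gradient_eq_neg_integral_lap hΩ hu hψd hψc hψs]
    refine (neg_le_abs _).trans ?_
    rw [← Real.norm_eq_abs]
    refine norm_setIntegral_le_of_norm_le_const hvol fun p hp => ?_
    have hup := hB p (subset_closure hp)
    rw [norm_mul, Real.norm_eq_abs, Real.norm_eq_abs, hψ, indicator_of_mem hp]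
    exact mul_le_mul ((abs_idCutoff_le _ _).trans hup) (hK p hp) (abs_nonneg _)
      ((norm_nonneg _).trans hup)
  set d : ℕ → ℝ := fun n => 1 / ((n : ℝ) + 1)
  have hd0 (n : ℕ) : 0 < d n := Nat.one_div_pos_of_nat
  have hlim (p : R2) (hp : p ∈ Ω) : Tendsto
      (fun n => ENNReal.ofReal (deriv (idCutoff (d n)) (u p) * ‖gradient u p‖ ^ 2)) atTop
      (nhds (ENNReal.ofReal (‖gradient u p‖ ^ 2))) := by
    refine tendsto_const_nhds.congr' ?_
    rcases (hpos p hp).eq_or_lt with h0 | h0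
    · have hmin : IsLocalMin u p := by
        filter_upwards [hΩ.mem_nhds hp] with q hq
        rw [← h0]
        exact hpos q hq
      have : gradient u p = 0 := by simp [gradient, hmin.fderiv_eq_zero]
      simp [this]
    · have hev : ∀ᶠ n in atTop, d n < u p / 2 :=
        tendsto_one_div_add_atTop_nhds_zero_nat.eventually_lt_const (half_pos h0)
      filter_upwards [hev] with n hn
      rw [deriv_idCutoff_eq_one (hd0 n) (by linarith), one_mul]
  have hmeas (n : ℕ) : AEMeasurable
      (fun p => ENNReal.ofReal (deriv (idCutoff (d n)) (u p) * ‖gradient u p‖ ^ 2))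
      (volume.restrict Ω) := by
    refine ENNReal.measurable_ofReal.comp_aemeasurable (ContinuousOn.aemeasurable ?_
      hΩ.measurableSet)
    exact (((contDiff_idCutoff (d n)).continuous_deriv le_rfl).comp_continuousOn
      hu.continuousOn).mul (hgradc.norm.pow 2)
  refine ⟨(hgradc.norm.pow 2).aestronglyMeasurable hΩ.measurableSet, ?_⟩
  rw [hasFiniteIntegral_iff_ofReal (Filter.Eventually.of_forall fun p => sq_nonneg _)]
  calc ∫⁻ p in Ω, ENNReal.ofReal (‖gradient u p‖ ^ 2)
      = ∫⁻ p in Ω, liminf (fun n => ENNReal.ofReal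
          (deriv (idCutoff (d n)) (u p) * ‖gradient u p‖ ^ 2)) atTop :=
        setLIntegral_congr_fun hΩ.measurableSet fun p hp => (hlim p hp).liminf_eq.symm
    _ ≤ liminf (fun n => ∫⁻ p in Ω, ENNReal.ofReal
          (deriv (idCutoff (d n)) (u p) * ‖gradient u p‖ ^ 2)) atTop := lintegral_liminf_le' hmeas
    _ ≤ liminf (fun _ : ℕ => ENNReal.ofReal (B * K * volume.real Ω)) atTop :=
        liminf_le_liminf (Filter.Eventually.of_forall fun n => henergy _ (hd0 n))
    _ < ⊤ := by simp

end DirichletEnergy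

section Stability

lemma gammaPlusSq_bounds {α μ : ℝ} (hα : α ∈ Ioc (0 : ℝ) (1 / 100))
    (hμ : μ ∈ Ioc (0 : ℝ) ((1 + α ^ 2) ^ 2 / 2)) :
    0 < gammaPlusSq α μ ∧ gammaPlusSq α μ ≤ 2 / 5 := by
  obtain ⟨hμ0, hμ1⟩ := hμ
  have ha : α ^ 2 ≤ 1 / 10000 := by nlinarith [hα.1, hα.2]
  have ha0 : 0 ≤ α ^ 2 := sq_nonneg α
  rw [gammaPlusSq]
  set a := α ^ 2
  set s := Real.sqrt ((1 + a) ^ 2 - 2 * μ)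
  have hs0 : 0 ≤ s := Real.sqrt_nonneg _
  have hs2 : s ^ 2 = (1 + a) ^ 2 - 2 * μ := Real.sq_sqrt (by linarith)
  have hs1 : s ≤ 1 + a := by nlinarith
  have hden : 0 < μ + 4 * (1 - a) := by linarith
  have hs3 : s < 1 + a := by nlinarith
  refine ⟨div_pos ?_ hden, ?_⟩
  · nlinarith
  · rw [div_le_iff₀ hden]
    nlinarith

/-- The solutions between `0` and the supersolution live in the strip `|y| ≤ 1`, where the
linearised potential is small. -/
lemma bounds_of_le_vag {α μ t : ℝ} {p : R2} (hα : α ∈ Ioc (0 : ℝ) (1 / 100))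
    (hμ : μ ∈ Ioc (0 : ℝ) ((1 + α ^ 2) ^ 2 / 2)) (h0 : 0 ≤ t)
    (ht : t ≤ vag α (gammaPlus α μ) p) : |p 1| ≤ 1 ∧ μ * Real.exp t ≤ 99 / 100 := by
  obtain ⟨hg0, hg1⟩ := gammaPlusSq_bounds hα hμ
  have ha : α ^ 2 ≤ 1 / 10000 := by nlinarith [hα.1, hα.2]
  rw [vag, gammaPlus, Real.sq_sqrt hg0.le] at ht
  set g := gammaPlusSq α μ
  have hρ0 : 0 ≤ α ^ 2 * p 0 ^ 2 := by positivity
  set r := (1 + g) / (1 + g * (α ^ 2 * p 0 ^ 2 + p 1 ^ 2)) with hr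
  have hden : 0 < 1 + g * (α ^ 2 * p 0 ^ 2 + p 1 ^ 2) := by positivity
  have hr0 : 0 < r := by positivity
  have hr1 : 1 ≤ r := by
    by_contra hlt
    linarith [Real.log_neg hr0 (not_le.mp hlt)]
  constructor
  · rw [hr, one_le_div hden] at hr1
    have h1 : α ^ 2 * p 0 ^ 2 + p 1 ^ 2 ≤ 1 := le_of_mul_le_mul_left (by linarith) hg0
    exact (sq_le_one_iff_abs_le_one _).mp (by linarith)
  · have hr2 : r ≤ 7 / 5 := by
      rw [hr, div_le_iff₀ hden]
      nlinarith [mul_nonneg hg0.le (add_nonneg hρ0 (sq_nonneg (p 1)))]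
    have hexp : Real.exp t ≤ r ^ 2 := by
      refine (Real.exp_le_exp.mpr ht).trans (le_of_eq ?_)
      rw [mul_comm, Real.exp_mul, Real.exp_log hr0]
      norm_cast
    have hμ2 : μ ≤ 50011 / 100000 := by nlinarith [hμ.2, sq_nonneg α]
    calc μ * Real.exp t ≤ (50011 / 100000) * (7 / 5) ^ 2 := by
          gcongr
          exact hexp.trans (by gcongr)
      _ ≤ 99 / 100 := by norm_num

/-- A solution of `-Δu = μ eᵘ` in a strip of half-width one for which `μ eᵘ ≤ 99/100` is a strict
local minimizer of the free energy. -/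
lemma exists_freeEnergy_lt {Ω : Set R2} (hΩ : IsOpen Ω) (hb : Bornology.IsBounded Ω)
    (hne : Ω.Nonempty) (hstrip : ∀ p ∈ Ω, |p 1| ≤ 1) {μ : ℝ} (hμ : 0 < μ) {u : R2 → ℝ}
    (hu : ContDiffOn ℝ 2 u Ω) (huc : ContinuousOn u (closure Ω))
    (heq : ∀ p ∈ Ω, -lap u p = μ * Real.exp (u p)) (hbd : ∀ p ∈ frontier Ω, u p = 0)
    (hpos : ∀ p ∈ Ω, 0 ≤ u p) (hsmall : ∀ p ∈ Ω, μ * Real.exp (u p) ≤ 99 / 100) :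
    ∃ ε : ℝ, 0 < ε ∧ ∀ φ : R2 → ℝ, IsTestFun Ω φ →
      0 < Real.sqrt (∫ p in Ω, (φ p ^ 2 + ‖gradient φ p‖ ^ 2)) →
      Real.sqrt (∫ p in Ω, (φ p ^ 2 + ‖gradient φ p‖ ^ 2)) ≤ ε →
      freeEnergy Ω (μ * ∫ p in Ω, Real.exp (u p)) u <
        freeEnergy Ω (μ * ∫ p in Ω, Real.exp (u p)) (fun p => u p + φ p) := by
  obtain ⟨C, hC, hcosh⟩ := exists_integral_cosh_sub_one_sq_le
  set V := volume.real Ω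
  have hV : 0 ≤ V := measureReal_nonneg
  have hfin : FiniteDirichlet Ω u := by
    refine finiteDirichlet_of_lap_bounded hΩ hb hu huc hbd hpos (K := 99 / 100) fun p hp => ?_
    rw [← abs_neg, heq p hp, abs_of_nonneg (by positivity)]
    exact hsmall p hp
  have hintexp (f : R2 → ℝ) (hf : Continuous f) :
      IntegrableOn (fun p => Real.exp (u p) * f p) Ω :=
    (((Real.continuous_exp.comp_continuousOn huc).mul hf.continuousOn).integrableOn_compact
      hb.isCompact_closure).mono_set subset_closure
  have hexpu : IntegrableOn (fun p => Real.exp (u p)) Ω := by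
    simpa using hintexp (fun _ => 1) continuous_const
  have hvolΩ : volume Ω ≠ 0 := (hΩ.measure_pos volume hne).ne'
  have hexp_pos (f : R2 → ℝ) (hf : IntegrableOn (fun p => Real.exp (f p)) Ω) :
      0 < ∫ p in Ω, Real.exp (f p) := by
    have : NeZero (volume.restrict Ω) := ⟨by simpa using hvolΩ⟩
    exact integral_exp_pos hf
  set m := min (1 / (2 * C)) (1 / 1000 / (2000 * C ^ 2 * V + 1))
  have hm : 0 < m := by positivity
  refine ⟨Real.sqrt m, Real.sqrt_pos.mpr hm, fun φ hφ hφ0 hφm => ?_⟩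
  obtain ⟨hφd, hφc, hφs⟩ := hφ
  have hφ1 : ContDiff ℝ 1 φ := hφd.of_le (by exact_mod_cast le_top)
  have hφcont := hφ1.continuous
  have hgradφ : Continuous (gradient φ) :=
    (InnerProductSpace.toDual ℝ R2).symm.continuous.comp (hφ1.continuous_fderiv one_ne_zero)
  have hiφ : IntegrableOn (fun p => φ p ^ 2) Ω := integrableOn_of_continuous hb (by fun_prop)
  have hiD : IntegrableOn (fun p => ‖gradient φ p‖ ^ 2) Ω :=
    integrableOn_of_continuous hb (by fun_prop)
  have hpoin := integral_sq_le_integral_norm_gradient_sq hΩ hstrip hφ1 hφc hφs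
  have hsplit : ∫ p in Ω, (φ p ^ 2 + ‖gradient φ p‖ ^ 2) =
      (∫ p in Ω, φ p ^ 2) + ∫ p in Ω, ‖gradient φ p‖ ^ 2 := integral_add hiφ hiD
  have hcoshφ := hcosh Ω hΩ hb φ hφ1 hφc hφs
  rw [hsplit] at hφ0 hφm
  have hP0 : 0 ≤ ∫ p in Ω, φ p ^ 2 := by positivity
  set P := ∫ p in Ω, φ p ^ 2
  set D := ∫ p in Ω, ‖gradient φ p‖ ^ 2
  set Y := ∫ p in Ω, (Real.cosh (φ p) - 1) ^ 2
  have hD0 : 0 < D := by linarith [Real.sqrt_pos.mp hφ0]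
  have hDm : D ≤ m := by linarith [(Real.sqrt_le_sqrt_iff hm.le).mp hφm]
  have hD1 : C * D ≤ 1 / 2 := by
    have := (le_div_iff₀ (by positivity)).mp (hDm.trans (min_le_left _ _))
    linarith
  have hD2 : D * (2000 * C ^ 2 * V + 1) ≤ 1 / 1000 :=
    (le_div_iff₀ (by positivity)).mp (hDm.trans (min_le_right _ _))
  have hY := hcoshφ hD1
  -- the second-order remainder
  have hrem : ∫ p in Ω, μ * (Real.exp (u p) * (Real.exp (φ p) - 1 - φ p)) ≤
      99 / 100 * ((1 / 2 + 1 / 1000) * P + 1000 * Y) := by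
    have hiY : IntegrableOn (fun p => (Real.cosh (φ p) - 1) ^ 2) Ω :=
      integrableOn_of_continuous hb (by fun_prop)
    have hR : 99 / 100 * ((1 / 2 + 1 / 1000) * P + 1000 * Y) = ∫ p in Ω, 99 / 100 *
        ((1 / 2 + 1 / 1000) * φ p ^ 2 + 1000 * (Real.cosh (φ p) - 1) ^ 2) := by
      rw [integral_const_mul, integral_add (hiφ.const_mul _) (hiY.const_mul _),
        integral_const_mul, integral_const_mul]
    rw [hR]
    refine setIntegral_mono_on ((hintexp _ (by fun_prop)).const_mul _)
      (integrableOn_of_continuous hb (by fun_prop)) hΩ.measurableSet fun p hp => ?_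
    rw [← mul_assoc]
    have h1 := Real.add_one_le_exp (φ p)
    exact mul_le_mul (hsmall p hp) (exp_sub_one_sub_le _) (by linarith) (by norm_num)
  -- expansion of the Dirichlet energy
  have hdir : ∫ p in Ω, ‖gradient (fun p => u p + φ p) p‖ ^ 2 =
      (∫ p in Ω, ‖gradient u p‖ ^ 2) + 2 * (μ * ∫ p in Ω, Real.exp (u p) * φ p) + D := by
    have hcross : IntegrableOn (fun p => inner ℝ (gradient φ p) (gradient u p)) Ω := by
      simp only [inner_gradient_gradient]
      refine (integrable_finsetSum _ fun i _ => ?_).integrableOn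
      exact integrable_mul_of_tsupport_subset hΩ (contDiffOn_fderiv_apply hΩ hu _).continuousOn
        ((hφ1.continuous_fderiv one_ne_zero).clm_apply continuous_const)
        (hφc.fderiv_apply ℝ _) ((tsupport_fderiv_apply_subset ℝ _).trans hφs)
    have hgreen : ∫ p in Ω, inner ℝ (gradient φ p) (gradient u p) =
        μ * ∫ p in Ω, Real.exp (u p) * φ p := by
      rw [integral_inner_gradient_eq_neg_integral_lap hΩ hu hφ1 hφc hφs, ← integral_neg,
        ← integral_const_mul]
      refine setIntegral_congr_fun hΩ.measurableSet fun p hp => ?_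
      linear_combination φ p * heq p hp
    have hpt : EqOn (fun p => ‖gradient (fun p => u p + φ p) p‖ ^ 2)
        (fun p => ‖gradient u p‖ ^ 2 + 2 * inner ℝ (gradient φ p) (gradient u p) +
          ‖gradient φ p‖ ^ 2) Ω := by
      intro p hp
      have hup : DifferentiableAt ℝ u p :=
        (hu.differentiableOn two_ne_zero).differentiableAt (hΩ.mem_nhds hp)
      have hsum : gradient (fun p => u p + φ p) p = gradient u p + gradient φ p := by
        rw [gradient, fderiv_fun_add hup (hφ1.differentiable one_ne_zero p), map_add]
        rfl
      simp only [hsum]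
      rw [norm_add_sq_real, real_inner_comm]
    have hi2 : IntegrableOn (fun p => ‖gradient u p‖ ^ 2 +
        2 * inner ℝ (gradient φ p) (gradient u p)) Ω := Integrable.add hfin (hcross.const_mul 2)
    rw [setIntegral_congr_fun hΩ.measurableSet hpt, integral_add hi2 hiD,
      integral_add hfin (hcross.const_mul 2), integral_const_mul, hgreen]
  -- the logarithmic term
  have hiJ : IntegrableOn (fun p => Real.exp (u p + φ p)) Ω := by
    simpa only [Real.exp_add] using hintexp (fun p => Real.exp (φ p)) (by fun_prop)
  have hI := hexp_pos u hexpu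
  have hJ := hexp_pos (fun p => u p + φ p) hiJ
  have hremJ : ∫ p in Ω, μ * (Real.exp (u p) * (Real.exp (φ p) - 1 - φ p)) =
      μ * ((∫ p in Ω, Real.exp (u p + φ p)) - (∫ p in Ω, Real.exp (u p)) -
        ∫ p in Ω, Real.exp (u p) * φ p) := by
    have hiJI : IntegrableOn (fun p => Real.exp (u p + φ p) - Real.exp (u p)) Ω := hiJ.sub hexpu
    rw [integral_const_mul, ← integral_sub hiJ hexpu, ← integral_sub hiJI (hintexp φ hφcont)]
    congr 2 with p
    rw [Real.exp_add]
    ring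
  set I := ∫ p in Ω, Real.exp (u p)
  set J := ∫ p in Ω, Real.exp (u p + φ p)
  set L := ∫ p in Ω, Real.exp (u p) * φ p
  have hlog : μ * I * (Real.log J - Real.log I) ≤ μ * (J - I) := by
    rw [← Real.log_div hJ.ne' hI.ne']
    calc μ * I * Real.log (J / I) ≤ μ * I * (J / I - 1) :=
          mul_le_mul_of_nonneg_left (Real.log_le_sub_one_of_pos (by positivity)) (by positivity)
      _ = μ * (J - I) := by field_simp
  have hYD : 1000 * Y ≤ 1 / 1000 * D := by
    calc 1000 * Y ≤ 1000 * (2 * C ^ 2 * V * D ^ 2) := by gcongr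
      _ ≤ (D * (2000 * C ^ 2 * V + 1)) * D := by nlinarith [sq_nonneg D]
      _ ≤ 1 / 1000 * D := by gcongr
  rw [freeEnergy, freeEnergy, hdir]
  nlinarith

end Stability

/-- The sub-supersolution solutions of `Q(μ,Ω)` on thin sandwiched regular domains are, with
`λ = μ ∫_Ω eᵘ`, strict local minimizers of the free energy `F_λ` with respect to smooth
compactly supported perturbations. -/
theorem statement8 :
    ∀ c ∈ Set.Ioc (0 : ℝ) 1, ∃ αs ∈ Set.Ioo (0 : ℝ) 1,
      ∀ α ∈ Set.Ioc (0 : ℝ) αs, ∀ Ω : Set R2, IsRegularDomain Ω → Sandwiched α c Ω →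
        ∀ μ ∈ Set.Ioc (0 : ℝ) ((1 + α ^ 2) ^ 2 / 2), ∀ u : R2 → ℝ,
          ContDiffOn ℝ 2 u Ω → ContinuousOn u (closure Ω) →
          (∀ p ∈ Ω, -lap u p = μ * Real.exp (u p)) →
          (∀ p ∈ frontier Ω, u p = 0) →
          (∀ p ∈ Ω, 0 ≤ u p ∧ u p ≤ vag α (gammaPlus α μ) p) →
          ∃ ε : ℝ, 0 < ε ∧ ∀ φ : R2 → ℝ, IsTestFun Ω φ →
            0 < Real.sqrt (∫ p in Ω, (φ p ^ 2 + ‖gradient φ p‖ ^ 2)) →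
            Real.sqrt (∫ p in Ω, (φ p ^ 2 + ‖gradient φ p‖ ^ 2)) ≤ ε →
            freeEnergy Ω (μ * ∫ p in Ω, Real.exp (u p)) u <
              freeEnergy Ω (μ * ∫ p in Ω, Real.exp (u p)) (fun p => u p + φ p) := by
  intro c _
  refine ⟨1 / 100, by norm_num, fun α hα Ω hreg hsand μ hμ u hu huc heq hbd hle => ?_⟩
  obtain ⟨hΩ, hb, -, -⟩ := hreg.1
  obtain ⟨βm, -, -, -, -, hsub, -⟩ := hsand
  have hne : Ω.Nonempty := ⟨0, hsub (by simp [EllipseSet, sq_nonneg])⟩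
  have hbounds (p : R2) (hp : p ∈ Ω) := bounds_of_le_vag hα hμ (hle p hp).1 (hle p hp).2
  exact exists_freeEnergy_lt hΩ hb hne (fun p hp => (hbounds p hp).1) hμ.1 hu huc heq hbd
    (fun p hp => (hle p hp).1) fun p hp => (hbounds p hp).2
end
end
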